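/- arXiv:1907.10754 — 9 statements merged into one kernel-verified Lean document; each statement's English description precedes it below -/
import Mathlib

section
/- Let R be a Noetherian ring and let 𝒜 ⊆ ℬ be Noetherian R-algebras with ℬ a finitely generated 𝒜-algebra. Then the set Ass_𝒜(ℬ/𝒜) of associated primes of the 𝒜-module ℬ/𝒜 is finite. -/
open Polynomial

/-- Associated primes over a subring of scalars are contracted from associated primes. -/
theorem associatedPrimes_subset_image_comap (A S M : Type*) [CommRing A] [CommRing S]
    [IsNoetherianRing A] [IsNoetherianRing S] [Algebra A S] [AddCommGroup M] [Module A M]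
    [Module S M] [IsScalarTower A S M] :
    associatedPrimes A M ⊆ Ideal.comap (algebraMap A S) '' associatedPrimes S M := by
  intro P hP
  obtain ⟨hprime, m, hm⟩ := isAssociatedPrime_iff.mp hP
  let colonS (x : M) : Ideal S := Submodule.colon ⊥ {x}
  have mem_colonS (s : S) (x : M) : s ∈ colonS x ↔ s • x = 0 := by
    simp [colonS, Submodule.mem_colon_singleton]
  have mem_P (a : A) (x : M) (hx : (colonS x).comap (algebraMap A S) = P) :
      a ∈ P ↔ a • x = 0 := by
    rw [← hx, Ideal.mem_comap, mem_colonS, algebraMap_smul]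
  have hne : {J | ∃ x : M, (colonS x).comap (algebraMap A S) = P ∧ J = colonS x}.Nonempty := by
    refine ⟨_, m, ?_, rfl⟩
    ext a
    rw [Ideal.mem_comap, mem_colonS, algebraMap_smul, hm, Submodule.mem_colon_singleton,
      Submodule.mem_bot]
  obtain ⟨J, ⟨n, hn, rfl⟩, hmax⟩ := set_has_maximal_iff_noetherian.mpr ‹IsNoetherianRing S› _ hne
  have eq_of_smul (v : S) (hv : (colonS (v • n)).comap (algebraMap A S) = P) :
      colonS n = colonS (v • n) := by
    refine eq_of_le_of_not_lt (fun s hs ↦ ?_) (hmax _ ⟨_, hv, rfl⟩)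
    rw [mem_colonS] at hs ⊢
    rw [smul_comm, hs, smul_zero]
  refine ⟨colonS n, isAssociatedPrime_iff.mpr ⟨⟨fun htop ↦ ?_, fun {u v} huv ↦ ?_⟩, n, rfl⟩, hn⟩
  · exact hprime.ne_top (by rw [← hn, htop, Ideal.comap_top])
  · rw [or_iff_not_imp_right]
    intro hv
    rw [mem_colonS, mul_smul] at huv
    rw [eq_of_smul v, mem_colonS, huv]
    ext a
    rw [Ideal.mem_comap, mem_colonS, algebraMap_smul]
    refine ⟨fun ha ↦ by_contra fun haP ↦ hv ?_, fun ha ↦ ?_⟩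
    · rw [eq_of_smul (algebraMap A S a), mem_colonS, algebraMap_smul, smul_comm, ha]
      ext b
      rw [Ideal.mem_comap, mem_colonS, algebraMap_smul, algebraMap_smul, ← mul_smul,
        ← mem_P _ _ hn]
      exact ⟨fun h ↦ (hprime.mem_or_mem h).resolve_right haP, fun h ↦ P.mul_mem_right _ h⟩
    · rw [smul_comm, (mem_P a n hn).mp ha, smul_zero]

theorem finite_associatedPrimes_quotient (A : Type*) {S : Type*} [CommRing A] [CommRing S]
    [IsNoetherianRing A] [IsNoetherianRing S] [Algebra A S] (I : Ideal S) :
    (associatedPrimes A (S ⧸ I)).Finite :=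
  ((associatedPrimes.finite S (S ⧸ I)).image _).subset
    (associatedPrimes_subset_image_comap A S (S ⧸ I))

section Rees

variable {A B : Type*} [CommRing A] [CommRing B] [Algebra A B]

/-- The Rees algebra, inside `B[X]`, of the filtration of `A[s]` by degree in the elements
of `s`. -/
noncomputable def degreeRees (A : Type*) {B : Type*} [CommRing A] [CommRing B] [Algebra A B] (s : Set B) :
    Subalgebra A B[X] :=
  Algebra.adjoin A (insert X ((fun b ↦ C b * X) '' s))

theorem X_mem_degreeRees (s : Set B) : X ∈ degreeRees A s :=
  Algebra.subset_adjoin (Set.mem_insert _ _)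

theorem degreeRees_isNoetherianRing [IsNoetherianRing A] {s : Set B} (hs : s.Finite) :
    IsNoetherianRing (degreeRees A s) := by
  have : Algebra.FiniteType A (degreeRees A s) :=
    (Subalgebra.fg_iff_finiteType _).mp
      (Subalgebra.fg_def.mpr ⟨_, (hs.image _).insert _, rfl⟩)
  exact Algebra.FiniteType.isNoetherianRing A _

theorem mem_range_of_C_mem_degreeRees {s : Set B} {y : B} (hy : C y ∈ degreeRees A s) :
    y ∈ LinearMap.range (Algebra.linearMap A B) := by
  have hle : degreeRees A s ≤ (⊥ : Subalgebra A B).comap ((aeval (0 : B)).restrictScalars A) := by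
    refine Algebra.adjoin_le ?_
    rintro _ (rfl | ⟨b, -, rfl⟩) <;>
      simpa [Algebra.mem_bot] using ⟨0, map_zero (algebraMap A B)⟩
  simpa [Algebra.mem_bot] using hle hy

theorem C_mul_X_pow_mem_degreeRees_of_le {s : Set B} {y : B} {k l : ℕ} (hkl : k ≤ l)
    (hy : C y * X ^ k ∈ degreeRees A s) : C y * X ^ l ∈ degreeRees A s := by
  rw [← Nat.add_sub_cancel' hkl, pow_add, ← mul_assoc]
  exact mul_mem hy (pow_mem (X_mem_degreeRees s) _)

theorem C_algebraMap_mul_X_pow_mem_degreeRees (s : Set B) (a : A) (k : ℕ) :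
    C (algebraMap A B a) * X ^ k ∈ degreeRees A s :=
  mul_mem ((degreeRees A s).algebraMap_mem a) (pow_mem (X_mem_degreeRees s) _)

theorem exists_C_mul_X_pow_mem_degreeRees {s : Set B} {y : B} (hy : y ∈ Algebra.adjoin A s) :
    ∃ k, C y * X ^ k ∈ degreeRees A s := by
  induction hy using Algebra.adjoin_induction with
  | mem b hb =>
    refine ⟨1, Algebra.subset_adjoin (Set.mem_insert_of_mem _ ⟨b, hb, ?_⟩)⟩
    simp only [pow_one]
  | algebraMap a => exact ⟨0, C_algebraMap_mul_X_pow_mem_degreeRees s a 0⟩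
  | add x y _ _ hx hy =>
    obtain ⟨k, hk⟩ := hx
    obtain ⟨l, hl⟩ := hy
    refine ⟨max k l, ?_⟩
    rw [C_add, add_mul]
    exact add_mem (C_mul_X_pow_mem_degreeRees_of_le (le_max_left k l) hk)
      (C_mul_X_pow_mem_degreeRees_of_le (le_max_right k l) hl)
  | mul x y _ _ hx hy =>
    obtain ⟨k, hk⟩ := hx
    obtain ⟨l, hl⟩ := hy
    refine ⟨k + l, ?_⟩
    rw [C_mul, pow_add, mul_mul_mul_comm]
    exact mul_mem hk hl

/-- The associated graded ring of the filtration of `A[s]` by degree in the elements of `s`. -/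
abbrev degreeGraded (A : Type*) {B : Type*} [CommRing A] [CommRing B] [Algebra A B]
    (s : Set B) : Type _ :=
  degreeRees A s ⧸ Ideal.span {(⟨X, X_mem_degreeRees s⟩ : degreeRees A s)}

theorem smul_mk_eq_zero_iff {s : Set B} {y : B} {k : ℕ}
    (hy : C y * X ^ (k + 1) ∈ degreeRees A s) (a : A) :
    a • (Ideal.Quotient.mk _ ⟨_, hy⟩ : degreeGraded A s) = 0 ↔
      C (a • y) * X ^ k ∈ degreeRees A s := by
  have key : (a • (Ideal.Quotient.mk _ ⟨_, hy⟩ : degreeGraded A s)) =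
      Ideal.Quotient.mk _ (a • (⟨_, hy⟩ : degreeRees A s)) := rfl
  have hmul : a • (C y * X ^ (k + 1)) = C (a • y) * X ^ k * X := by
    rw [← smul_C, smul_mul_assoc, smul_mul_assoc, pow_succ, mul_assoc]
  rw [key, Ideal.Quotient.eq_zero_iff_mem, Ideal.mem_span_singleton']
  constructor
  · rintro ⟨⟨g, hg⟩, h⟩
    have h' : g * X = a • (C y * X ^ (k + 1)) := congrArg Subtype.val h
    rw [hmul] at h'
    rwa [← isRegular_X.right h']
  · exact fun h ↦ ⟨⟨_, h⟩, Subtype.ext hmul.symm⟩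

theorem associatedPrimes_quotient_subset_degreeGraded [IsNoetherianRing A] {s : Set B}
    (hs : Algebra.adjoin A s = ⊤) :
    associatedPrimes A (B ⧸ LinearMap.range (Algebra.linearMap A B)) ⊆
      associatedPrimes A (degreeGraded A s) := by
  intro P hP
  obtain ⟨hprime, x, hx⟩ := isAssociatedPrime_iff.mp hP
  obtain ⟨x, rfl⟩ := Submodule.Quotient.mk_surjective _ x
  set N := LinearMap.range (Algebra.linearMap A B)
  have mem_P (a : A) : a ∈ P ↔ a • x ∈ N := by
    rw [hx, Submodule.mem_colon_singleton, Submodule.mem_bot, ← Submodule.Quotient.mk_smul,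
      Submodule.Quotient.mk_eq_zero]
  have hex : ∃ k, ∃ a ∉ P, C (a • x) * X ^ k ∈ degreeRees A s := by
    obtain ⟨k, hk⟩ := exists_C_mul_X_pow_mem_degreeRees (A := A) (s := s) (y := x) (by simp [hs])
    exact ⟨k, 1, hprime.one_notMem, by rwa [one_smul]⟩
  classical
  obtain ⟨a, haP, ha⟩ := Nat.find_spec hex
  have hmin {m : ℕ} (hm : m < Nat.find hex) := Nat.find_min hex hm
  generalize Nat.find hex = k at ha hmin
  cases k with
  | zero =>
    exact absurd ((mem_P a).mpr (mem_range_of_C_mem_degreeRees (by simpa using ha))) haP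
  | succ k =>
    refine isAssociatedPrime_iff.mpr ⟨hprime, Ideal.Quotient.mk _ ⟨_, ha⟩, ?_⟩
    ext b
    rw [Submodule.mem_colon_singleton, Submodule.mem_bot, smul_mk_eq_zero_iff, ← mul_smul]
    refine ⟨fun hb ↦ ?_, fun hb ↦ by_contra fun hbP ↦ hmin k.lt_succ_self ⟨b * a, ?_, hb⟩⟩
    · obtain ⟨c, hc⟩ := (mem_P _).mp (P.mul_mem_right a hb)
      rw [← hc]
      exact C_algebraMap_mul_X_pow_mem_degreeRees s c k
    · exact fun h ↦ (hprime.mem_or_mem h).elim hbP haP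

end Rees


/-- Let `R` be a Noetherian ring and let `𝒜 ⊆ ℬ` be Noetherian `R`-algebras
with `ℬ` a finitely generated `𝒜`-algebra.  Then the set of associated primes of the
`𝒜`-module `ℬ/𝒜` is finite.  Here "`𝒜 ⊆ ℬ`" is modelled by an injective algebra map, and
`ℬ/𝒜` is the quotient of `ℬ` by the image of `𝒜`, viewed as an `𝒜`-module. -/
theorem assPrimes_quotient_finite (R A B : Type*) [CommRing R] [IsNoetherianRing R]
    [CommRing A] [CommRing B] [Algebra R A] [Algebra R B]
    [IsNoetherianRing A] [IsNoetherianRing B]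
    [Algebra A B] [IsScalarTower R A B]
    (hinj : Function.Injective (algebraMap A B))
    (hfg : Algebra.FiniteType A B) :
    (associatedPrimes A (B ⧸ LinearMap.range (Algebra.linearMap A B))).Finite := by
  obtain ⟨s, hs⟩ := hfg.out
  have := degreeRees_isNoetherianRing (A := A) s.finite_toSet
  exact (finite_associatedPrimes_quotient A _).subset
    (associatedPrimes_quotient_subset_degreeGraded hs)
end

section
/- Let R be a ring, let 𝒜 ⊆ ℬ be R-algebras, and let R → S be a faithfully flat ring map. Denote by 𝒜̄ the integral closure of 𝒜 in ℬ and by \overline{𝒜⊗_R S} the integral closure of 𝒜⊗_R S in ℬ⊗_R S. Then \overline{𝒜⊗_R S} ∩ ℬ = 𝒜̄, where ℬ is viewed inside ℬ⊗_R S via the canonical (injective) map b ↦ b⊗1. -/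
open scoped TensorProduct

/-- If `b ⊗ₜ 1` is a root of a monic polynomial of degree `n` over `A ⊗[R] S`, then `b ^ n` is the
value at `b` of a polynomial of degree `< n` over `A`. -/
theorem pow_mem_map_degreeLT_of_eval₂_tensor_eq_zero {R S A B : Type*}
    [CommRing R] [CommRing S] [CommRing A] [CommRing B]
    [Algebra R S] [Algebra R A] [Algebra R B] [Algebra A B] [IsScalarTower R A B]
    [Module.FaithfullyFlat R S] {b : B} {p : Polynomial (A ⊗[R] S)} (hp : p.Monic)
    (h : p.eval₂ (Algebra.TensorProduct.map (IsScalarTower.toAlgHom R A B)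
        (AlgHom.id R S)).toRingHom (b ⊗ₜ[R] (1 : S)) = 0) :
    b ^ p.natDegree ∈
      (Polynomial.degreeLT A p.natDegree).map (Polynomial.aeval (R := A) b).toLinearMap := by
  set M := (Polynomial.degreeLT A p.natDegree).map (Polynomial.aeval (R := A) b).toLinearMap
  let q : B →ₗ[R] B ⧸ M.restrictScalars R := (M.restrictScalars R).mkQ
  have hlow (x : A ⊗[R] S) (i : ℕ) (hi : i < p.natDegree) :
      q.rTensor S ((Algebra.TensorProduct.map (IsScalarTower.toAlgHom R A B)
        (AlgHom.id R S)).toRingHom x * (b ⊗ₜ[R] (1 : S)) ^ i) = 0 := by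
    induction x with
    | zero => simp
    | add x y hx hy => rw [map_add, add_mul, map_add, hx, hy, add_zero]
    | tmul a s =>
      have hmem : algebraMap A B a * b ^ i ∈ M := by
        refine ⟨Polynomial.monomial i a, ?_, by simp [Polynomial.aeval_monomial]⟩
        exact Polynomial.mem_degreeLT.2
          ((Polynomial.degree_monomial_le i a).trans_lt (by exact_mod_cast hi))
      have hq : q (algebraMap A B a * b ^ i) = 0 :=
        (Submodule.Quotient.mk_eq_zero (M.restrictScalars R)).2 hmem
      simp [Algebra.TensorProduct.tmul_pow, hq]
  have htop : q.rTensor S ((b ^ p.natDegree) ⊗ₜ[R] (1 : S)) = 0 := by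
    have h' := congrArg (q.rTensor S) h
    rw [Polynomial.eval₂_eq_sum_range, Finset.sum_range_succ, map_add, map_sum,
      Finset.sum_eq_zero fun i hi => hlow (p.coeff i) i (Finset.mem_range.1 hi),
      zero_add,
      hp.coeff_natDegree, map_one, one_mul, map_zero, Algebra.TensorProduct.tmul_pow,
      one_pow] at h'
    exact h'
  have hq : q (b ^ p.natDegree) = 0 := by
    rw [LinearMap.rTensor_tmul] at htop
    apply (Module.FaithfullyFlat.one_tmul_eq_zero_iff R _ (A := S) _).1
    simpa using congrArg (TensorProduct.comm R _ S) htop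
  exact (Submodule.Quotient.mk_eq_zero (M.restrictScalars R)).1 hq

/-- Let `R` be a ring, `𝒜 ⊆ ℬ` be `R`-algebras and `R → S` a faithfully flat
ring map.  Then the integral closure of `𝒜 ⊗[R] S` in `ℬ ⊗[R] S`, intersected with `ℬ`
(embedded via `b ↦ b ⊗ₜ 1`), equals the integral closure of `𝒜` in `ℬ`.  Being in the
integral closure of `𝒜 ⊗[R] S` is expressed via `RingHom.IsIntegralElem` for the canonical
ring map `𝒜 ⊗[R] S →+* ℬ ⊗[R] S`. -/
theorem integralClosure_tensor_faithfullyFlat_inter (R S A B : Type*)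
    [CommRing R] [CommRing S] [CommRing A] [CommRing B]
    [Algebra R S] [Algebra R A] [Algebra R B] [Algebra A B] [IsScalarTower R A B]
    (hinj : Function.Injective (algebraMap A B))
    [Module.FaithfullyFlat R S] (b : B) :
    (Algebra.TensorProduct.map (IsScalarTower.toAlgHom R A B)
        (AlgHom.id R S)).toRingHom.IsIntegralElem (b ⊗ₜ[R] (1 : S)) ↔
      b ∈ integralClosure A B := by
  constructor
  · rintro ⟨p, hp, h⟩
    obtain ⟨r, hr, hrb⟩ := pow_mem_map_degreeLT_of_eval₂_tensor_eq_zero hp h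
    refine ⟨Polynomial.X ^ p.natDegree - r,
      Polynomial.monic_X_pow_sub (Polynomial.mem_degreeLT.1 hr), ?_⟩
    change Polynomial.aeval b r = _ at hrb
    rw [← Polynomial.aeval_def, map_sub, hrb, map_pow, Polynomial.aeval_X, sub_self]
  · rintro ⟨p, hp, h⟩
    refine ⟨p.map (Algebra.TensorProduct.includeLeftRingHom : A →+* A ⊗[R] S), hp.map _, ?_⟩
    have hcomp : (Algebra.TensorProduct.map (IsScalarTower.toAlgHom R A B)
        (AlgHom.id R S)).toRingHom.comp Algebra.TensorProduct.includeLeftRingHom =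
        (Algebra.TensorProduct.includeLeftRingHom : B →+* B ⊗[R] S).comp (algebraMap A B) := by
      ext a
      simp
    have h' := congrArg (Algebra.TensorProduct.includeLeftRingHom : B →+* B ⊗[R] S) h
    rw [Polynomial.hom_eval₂, map_zero] at h'
    rw [Polynomial.eval₂_map, hcomp]
    exact h'
end

section
/- Let 𝒜 be a Noetherian ring, ℬ a finitely generated 𝒜-algebra containing 𝒜, and 𝒜̄ the integral closure of 𝒜 in ℬ. Suppose that every minimal prime of ℬ contracts to a minimal prime of 𝒜 and that 𝒜_{𝔭} = 𝒜̄_{𝔭} for every minimal prime 𝔭 of 𝒜 (the localization map 𝒜_{𝔭} → 𝒜̄_{𝔭} is an isomorphism). Then there exists f ∈ 𝒜 such that Ass_𝒜(ℬ/𝒜̄) ⊆ Ass_𝒜(ℬ_f/𝒜_f) ∪ Ass_𝒜(𝒜_red/f𝒜_red), where 𝒜_red denotes the reduction of 𝒜 (the quotient by its nilradical) and ℬ_f, 𝒜_f are localizations at the powers of f. -/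
theorem pow_dvd_of_pow_dvd_pow_mul {R : Type*} [CommRing R] {f g : R}
    (hf : f ∈ nonZeroDivisors R) (hg : ∀ x, f ∣ g * x → f ∣ x) (K M : ℕ) {x : R}
    (h : f ^ K ∣ g ^ M * x) : f ^ K ∣ x := by
  have hgM : ∀ (M : ℕ) (x : R), f ∣ g ^ M * x → f ∣ x := by
    intro M
    induction M with
    | zero => simp
    | succ M ih =>
      intro x hx
      exact hg x (ih _ (by rwa [pow_succ, mul_assoc] at hx))
  induction K generalizing x with
  | zero => simp
  | succ K ih =>
    obtain ⟨x', rfl⟩ := hgM M x ((dvd_pow_self f K.succ_ne_zero).trans h)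
    obtain ⟨c, hc⟩ := h
    rw [pow_succ']
    refine mul_dvd_mul_left f (ih ⟨c, (mul_cancel_left_mem_nonZeroDivisors hf).1 ?_⟩)
    linear_combination hc

section

variable {R S : Type*} [CommRing R] [CommRing S] [Algebra R S]

theorem Submodule.FG.exists_pow_smul_mem {N P : Submodule R S} (hN : N.FG) {f : R}
    (h : ∀ x ∈ N, ∃ j : ℕ, f ^ j • x ∈ P) : ∃ j : ℕ, ∀ x ∈ N, f ^ j • x ∈ P := by
  obtain ⟨s, rfl⟩ := hN
  choose! j hj using fun x (hx : x ∈ s) ↦ h x (Submodule.subset_span hx)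
  refine ⟨s.sup j, fun x hx ↦ ?_⟩
  suffices Submodule.span R (s : Set S) ≤ P.comap (LinearMap.lsmul R S (f ^ s.sup j)) from this hx
  refine Submodule.span_le.2 fun x hx ↦ ?_
  obtain ⟨d, hd⟩ := Nat.exists_eq_add_of_le' (Finset.le_sup (f := j) hx)
  simpa [hd, pow_add, mul_smul] using P.smul_mem (f ^ d) (hj x hx)

theorem exists_pow_smul_mem_adjoin_singleton {f : R} {y : S} {k : ℕ}
    (hy : f ^ k • y ∈ (⊥ : Subalgebra R S)) {x : S} (hx : x ∈ Algebra.adjoin R {y}) :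
    ∃ j : ℕ, f ^ j • x ∈ (⊥ : Subalgebra R S) := by
  induction hx using Algebra.adjoin_induction with
  | mem x hx => exact ⟨k, by rwa [Set.mem_singleton_iff.1 hx]⟩
  | algebraMap r => exact ⟨0, by simp⟩
  | add x y _ _ hx hy =>
    obtain ⟨i, hi⟩ := hx
    obtain ⟨j, hj⟩ := hy
    refine ⟨i + j, ?_⟩
    rw [smul_add]
    refine add_mem ?_ ?_
    · rw [add_comm, pow_add, mul_smul]; exact Subalgebra.smul_mem _ hi _
    · rw [pow_add, mul_smul]; exact Subalgebra.smul_mem _ hj _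
  | mul x y _ _ hx hy =>
    obtain ⟨i, hi⟩ := hx
    obtain ⟨j, hj⟩ := hy
    exact ⟨i + j, by rw [pow_add, ← smul_mul_smul_comm]; exact mul_mem hi hj⟩

theorem isIntegral_of_pow_smul_pow_mem [IsNoetherianRing R] {f : R} {b : S} {m : ℕ}
    (hfS : algebraMap R S f ∈ nonZeroDivisors S)
    (h : ∀ M : ℕ, f ^ m • b ^ M ∈ (⊥ : Subalgebra R S)) : IsIntegral R b := by
  have key : ∀ x ∈ Algebra.adjoin R {b}, f ^ m • x ∈ (⊥ : Subalgebra R S) := by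
    intro x hx
    rw [Algebra.adjoin_singleton_eq_range_aeval] at hx
    obtain ⟨q, rfl⟩ := hx
    rw [AlgHom.toRingHom_eq_coe, RingHom.coe_coe, Polynomial.aeval_eq_sum_range, Finset.smul_sum]
    refine sum_mem fun i _ ↦ ?_
    rw [smul_comm]
    exact Subalgebra.smul_mem _ (h i) _
  let φ : Algebra.adjoin R {b} →ₗ[R] (⊥ : Subalgebra R S) :=
    ((LinearMap.lsmul R S (f ^ m)).comp (Algebra.adjoin R {b}).val.toLinearMap).codRestrict
      (Subalgebra.toSubmodule ⊥) fun x ↦ key x x.2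
  have hφ : Function.Injective φ := by
    rw [injective_iff_map_eq_zero]
    intro x hx
    have h1 : f ^ m • (x : S) = 0 := congrArg Subtype.val hx
    rw [Algebra.smul_def, map_pow] at h1
    exact Subtype.ext (((pow_mem hfS m).1 _ h1))
  have : IsNoetherian R (⊥ : Subalgebra R S) :=
    isNoetherian_of_surjective (Algebra.ofId R (⊥ : Subalgebra R S)).toLinearMap <| by
      rw [LinearMap.range_eq_top]
      rintro ⟨x, hx⟩
      obtain ⟨r, rfl⟩ := Algebra.mem_bot.1 hx
      exact ⟨r, rfl⟩
  have := isNoetherian_of_injective φ hφ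
  exact IsIntegral.of_mem_of_fg _ ((Submodule.fg_top _).1 (IsNoetherian.noetherian _)) b
    (Algebra.self_mem_adjoin_singleton R b)

/-- If `g` is regular modulo `f` and `b` is a fraction with denominator a power of `f`, then `b` is
integral as soon as `g • b` is. -/
theorem isIntegral_of_smul_of_regular [IsNoetherianRing R]
    (hinj : Function.Injective (algebraMap R S)) {f g : R} {b : S} {k : ℕ}
    (hfS : algebraMap R S f ∈ nonZeroDivisors S) (hg : ∀ x, f ∣ g * x → f ∣ x)
    (hb : f ^ k • b ∈ (⊥ : Subalgebra R S)) (hgb : IsIntegral R (g • b)) : IsIntegral R b := by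
  have hfR : f ∈ nonZeroDivisors R := mem_nonZeroDivisors_of_injective hinj hfS
  obtain ⟨m, hm⟩ := Submodule.FG.exists_pow_smul_mem (P := Subalgebra.toSubmodule ⊥)
    hgb.fg_adjoin_singleton fun x hx ↦ exists_pow_smul_mem_adjoin_singleton (k := k)
      (by rw [smul_comm]; exact Subalgebra.smul_mem _ hb _) hx
  obtain ⟨h, hh⟩ := Algebra.mem_bot.1 hb
  refine isIntegral_of_pow_smul_pow_mem hfS (m := m) fun M ↦ ?_
  obtain ⟨a, ha⟩ := Algebra.mem_bot.1 (hm ((g • b) ^ M)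
    (pow_mem (Algebra.self_mem_adjoin_singleton R _) M))
  have h1 : f ^ m * (g ^ M * h ^ M) = f ^ (k * M) * a := by
    apply hinj
    simp only [map_mul, hh, ha, map_pow, Algebra.smul_def]
    ring
  have h2 : f ^ (k * M) ∣ f ^ m * h ^ M := by
    refine pow_dvd_of_pow_dvd_pow_mul hfR hg _ M ⟨a, ?_⟩
    rw [← h1]; ring
  obtain ⟨c, hc⟩ := h2
  refine Algebra.mem_bot.2 ⟨c, ?_⟩
  refine (mul_cancel_left_mem_nonZeroDivisors (pow_mem hfS (k * M))).1 ?_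
  rw [← map_pow, ← map_mul, ← hc]
  simp only [map_mul, hh, map_pow, Algebra.smul_def]
  ring

end

section

variable {A B : Type*} [CommRing A] [CommRing B] [Algebra A B]

theorem IsLocalRing.exists_regular_of_maximalIdeal_notMem_associatedPrimes {R : Type*} [CommRing R]
    [IsLocalRing R] [IsNoetherianRing R] (J : Ideal R)
    (h : IsLocalRing.maximalIdeal R ∉ associatedPrimes R (R ⧸ J)) :
    ∃ g ∈ IsLocalRing.maximalIdeal R, ∀ x, g * x ∈ J → x ∈ J := by
  by_contra! H
  have hfin := associatedPrimes.finite R (R ⧸ J)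
  have hsub : (IsLocalRing.maximalIdeal R : Set R) ⊆
      ⋃ i ∈ (hfin.toFinset : Set (Ideal R)), (id i : Ideal R) := by
    intro g hg
    obtain ⟨x, hx, hxJ⟩ := H g hg
    simp only [Set.Finite.coe_toFinset, id]
    rw [biUnion_associatedPrimes_eq_zero_divisors]
    refine ⟨Ideal.Quotient.mk J x, mt Ideal.Quotient.eq_zero_iff_mem.1 hxJ, ?_⟩
    exact Ideal.Quotient.eq_zero_iff_mem.2 hx
  obtain ⟨Q, hQ, hle⟩ := (Ideal.subset_union_prime ⊥ ⊥ fun i hi _ _ ↦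
    ((hfin.mem_toFinset.1 hi : IsAssociatedPrime i _)).isPrime).1 hsub
  rw [hfin.mem_toFinset] at hQ
  have hQp : Q.IsPrime := IsAssociatedPrime.isPrime hQ
  rw [(IsLocalRing.maximalIdeal.isMaximal R).eq_of_le hQp.ne_top hle] at h
  exact h hQ

theorem exists_notMem_isIntegral_smul [IsNoetherianRing A]
    (hinj : Function.Injective (algebraMap A B)) {p : Ideal A} [p.IsPrime] {f : A} {b : B} {k : ℕ}
    (hf : algebraMap A B f ∈ nonZeroDivisors B) (hb : f ^ k • b ∈ (⊥ : Subalgebra A B))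
    (hpb : ∀ a ∈ p, IsIntegral A (a • b))
    (hp : p ∉ associatedPrimes A (A ⧸ Ideal.span {f})) :
    ∃ s ∉ p, IsIntegral A (s • b) := by
  let R := Localization.AtPrime p
  let S := Localization (Algebra.algebraMapSubmonoid B p.primeCompl)
  let _ : Algebra R S := localizationAlgebra p.primeCompl B
  have : IsScalarTower A R S := isScalarTower_localizationAlgebra p.primeCompl B
  have : IsNoetherianRing R := IsLocalization.isNoetherianRing p.primeCompl R inferInstance
  let J : Ideal R := (Ideal.span {f}).localized' R p.primeCompl (Algebra.linearMap A R)
  have hJ : J = Ideal.span {algebraMap A R f} := by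
    simp only [J, Ideal.span, Submodule.localized'_span, Set.image_singleton,
      Algebra.linearMap_apply]
  have hJp : IsLocalRing.maximalIdeal R ∉ associatedPrimes R (R ⧸ J) := by
    intro h
    apply hp
    have := Module.associatedPrimes.preimage_comap_associatedPrimes_eq_associatedPrimes_of_isLocalizedModule
      p.primeCompl R ((Ideal.span {f}).toLocalizedQuotient' R p.primeCompl (Algebra.linearMap A R))
    rw [← this, Set.mem_preimage] at h
    rwa [← Ideal.under_def, Localization.AtPrime.under_maximalIdeal] at h
  obtain ⟨g, hgm, hg⟩ :=
    IsLocalRing.exists_regular_of_maximalIdeal_notMem_associatedPrimes J hJp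
  obtain ⟨g', s, rfl⟩ := IsLocalization.exists_mk'_eq p.primeCompl g
  have hg'p : g' ∈ p := (IsLocalization.AtPrime.mk'_mem_maximal_iff R p g' s).1 hgm
  have hg' : ∀ x, algebraMap A R f ∣ algebraMap A R g' * x → algebraMap A R f ∣ x := by
    intro x hx
    rw [← Ideal.mem_span_singleton, ← hJ] at hx ⊢
    refine hg x ?_
    rw [IsLocalization.mk'_eq_mul_mk'_one, mul_right_comm]
    exact J.mul_mem_right _ hx
  have hint : IsIntegral R (algebraMap B S b) := by
    refine isIntegral_of_smul_of_regular (f := algebraMap A R f) (g := algebraMap A R g') (k := k)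
      (localizationAlgebra_injective R S hinj) ?_ hg' ?_ ?_
    · rw [← IsScalarTower.algebraMap_apply, IsScalarTower.algebraMap_apply A B S]
      exact IsLocalization.map_nonZeroDivisors_le (Algebra.algebraMapSubmonoid B p.primeCompl) S
        (Submonoid.mem_map_of_mem _ hf)
    · obtain ⟨c, hc⟩ := Algebra.mem_bot.1 hb
      refine Algebra.mem_bot.2 ⟨algebraMap A R c, ?_⟩
      rw [← IsScalarTower.algebraMap_apply, IsScalarTower.algebraMap_apply A B S, hc,
        ← map_pow, algebraMap_smul, Algebra.smul_def, Algebra.smul_def, map_mul,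
        ← IsScalarTower.algebraMap_apply]
    · rw [algebraMap_smul]
      have h1 : IsIntegral A (algebraMap B S (g' • b)) :=
        (hpb g' hg'p).map (IsScalarTower.toAlgHom A B S)
      rw [Algebra.smul_def, map_mul, ← IsScalarTower.algebraMap_apply, ← Algebra.smul_def] at h1
      exact h1.tower_top
  obtain ⟨m, hm⟩ := hint.exists_multiple_integral_of_isLocalization p.primeCompl
  have h1 : IsIntegral A (algebraMap B S ((m : A) • b)) := by
    rw [Algebra.smul_def, map_mul, ← IsScalarTower.algebraMap_apply, ← Algebra.smul_def]
    exact hm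
  obtain ⟨m', hm', h2⟩ := IsLocalization.exists_isIntegral_smul_of_isIntegral_map p.primeCompl h1
  exact ⟨m' * m, (mul_mem hm' m.2 : m' * m ∈ p.primeCompl), by rwa [mul_smul]⟩

end

section

open Polynomial

variable {A : Type*} [CommRing A]

/-- The contractions of the associated primes of a Noetherian module contain every prime that is the
annihilator of an element. -/
theorem exists_mem_associatedPrimes_comap_eq {R M : Type*} [CommRing R] [IsNoetherianRing R]
    [Algebra A R] [AddCommGroup M] [Module R M] {p : Ideal A} [hp : p.IsPrime] (m : M)
    (h : ∀ a, a ∈ p ↔ algebraMap A R a • m = 0) :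
    ∃ Q ∈ associatedPrimes R M, Q.comap (algebraMap A R) = p := by
  have hc : p = ((⊥ : Submodule R M).colon {m}).comap (algebraMap A R) := by
    ext a
    rw [h, Ideal.mem_comap, Submodule.mem_colon_singleton, Submodule.mem_bot]
  obtain ⟨Q, hQ, rfl⟩ := Ideal.exists_minimalPrimes_comap_eq
    (I := (⊥ : Submodule R M).colon {m}) (algebraMap A R) p
    (by rw [← hc, Ideal.minimalPrimes_eq_subsingleton_self]; rfl)
  refine ⟨Q, ?_, rfl⟩
  rw [AssociatedPrimes.mem_iff, isAssociatedPrime_iff]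
  exact ⟨hQ.isPrime, Submodule.exists_eq_colon_of_mem_minimalPrimes hQ⟩

theorem Subalgebra.finite_of_forall_exists_smul_eq_mul_iff {P : Type*} [CommRing P] [Algebra A P]
    (R : Subalgebra A P) [IsNoetherianRing R] {x : P} (hx : x ∈ R) {T : Set (Ideal A)}
    (h : ∀ p ∈ T, p.IsPrime ∧ ∃ z ∈ R, ∀ a, a ∈ p ↔ ∃ w ∈ R, a • z = x * w) : T.Finite := by
  refine ((associatedPrimes.finite R (R ⧸ Ideal.span {(⟨x, hx⟩ : R)})).image
    (Ideal.comap (algebraMap A R))).subset fun p hp ↦ ?_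
  obtain ⟨hp, z, hzR, hz⟩ := h p hp
  refine exists_mem_associatedPrimes_comap_eq (Ideal.Quotient.mk _ (⟨z, hzR⟩ : R)) fun a ↦ ?_
  have h0 : algebraMap A R a • Ideal.Quotient.mk (Ideal.span {(⟨x, hx⟩ : R)}) ⟨z, hzR⟩ =
    Ideal.Quotient.mk (Ideal.span {(⟨x, hx⟩ : R)}) (algebraMap A R a * ⟨z, hzR⟩) := rfl
  rw [hz, h0, Ideal.Quotient.eq_zero_iff_mem, Ideal.mem_span_singleton']
  simp only [Algebra.smul_def]
  constructor
  · rintro ⟨w, hw, h⟩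
    exact ⟨⟨w, hw⟩, Subtype.ext ((mul_comm _ _).trans h.symm)⟩
  · rintro ⟨w, h⟩
    exact ⟨w, w.2, (congrArg Subtype.val h).symm.trans (mul_comm _ _)⟩

/-- The extended Rees algebra of a generating set `s`: the subalgebra of `B[X]` generated by
`X` and the `b * X` for `b ∈ s`. -/
noncomputable def filtrationRees (A : Type*) {B : Type*} [CommRing A] [CommRing B] [Algebra A B]
    (s : Set B) : Subalgebra A B[X] :=
  Algebra.adjoin A (insert X ((fun b ↦ C b * X) '' s))

variable {B : Type*} [CommRing B] [Algebra A B]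

theorem X_mem_filtrationRees (s : Set B) : X ∈ filtrationRees A s :=
  Algebra.subset_adjoin (Set.mem_insert _ _)

theorem coeff_zero_mem_bot_of_mem_filtrationRees {s : Set B} {q : B[X]}
    (hq : q ∈ filtrationRees A s) : q.coeff 0 ∈ (⊥ : Subalgebra A B) := by
  induction hq using Algebra.adjoin_induction with
  | mem x hx => rcases hx with rfl | ⟨b, _, rfl⟩ <;> simp
  | algebraMap r =>
    rw [Polynomial.algebraMap_apply, coeff_C_zero]
    exact Subalgebra.algebraMap_mem _ _
  | add x y _ _ hx hy => rw [coeff_add]; exact add_mem hx hy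
  | mul x y _ _ hx hy => rw [mul_coeff_zero]; exact mul_mem hx hy

theorem exists_C_mul_X_pow_mem_filtrationRees {s : Set B} (hs : Algebra.adjoin A s = ⊤) (b : B) :
    ∃ n : ℕ, C b * X ^ n ∈ filtrationRees A s := by
  have hb : b ∈ Algebra.adjoin A s := hs ▸ Algebra.mem_top
  have hX (n : ℕ) : (X : B[X]) ^ n ∈ filtrationRees A s := pow_mem (X_mem_filtrationRees s) n
  induction hb using Algebra.adjoin_induction with
  | mem x hx => exact ⟨1, by
      rw [pow_one]; exact Algebra.subset_adjoin (Set.mem_insert_of_mem _ ⟨x, hx, rfl⟩)⟩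
  | algebraMap r => exact ⟨0, by
      rw [pow_zero, mul_one, ← Polynomial.algebraMap_apply]; exact Subalgebra.algebraMap_mem _ _⟩
  | add x y _ _ hx hy =>
    obtain ⟨m, hm⟩ := hx
    obtain ⟨n, hn⟩ := hy
    refine ⟨m + n, ?_⟩
    rw [show C (x + y) * X ^ (m + n) = C x * X ^ m * X ^ n + C y * X ^ n * X ^ m by
      rw [C_add]; ring]
    exact add_mem (mul_mem hm (hX n)) (mul_mem hn (hX m))
  | mul x y _ _ hx hy =>
    obtain ⟨m, hm⟩ := hx
    obtain ⟨n, hn⟩ := hy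
    refine ⟨m + n, ?_⟩
    rw [show C (x * y) * X ^ (m + n) = C x * X ^ m * (C y * X ^ n) by rw [C_mul]; ring]
    exact mul_mem hm hn

theorem exists_C_mul_X_pow_colon [IsNoetherianRing A] {s : Set B} (hs : Algebra.adjoin A s = ⊤)
    {p : Ideal A} [hp : p.IsPrime] {b : B} (hb : ∀ a, a ∈ p ↔ a • b ∈ (⊥ : Subalgebra A B)) :
    ∃ c : B, ∃ n : ℕ, C c * X ^ (n + 1) ∈ filtrationRees A s ∧
      ∀ a, a ∈ p ↔ C (a • c) * X ^ n ∈ filtrationRees A s := by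
  classical
  have hex : ∃ n : ℕ, ∃ c : B, (∀ a, a ∈ p ↔ a • c ∈ (⊥ : Subalgebra A B)) ∧
      C c * X ^ n ∈ filtrationRees A s :=
    (exists_C_mul_X_pow_mem_filtrationRees hs b).imp fun n hn ↦ ⟨b, hb, hn⟩
  obtain ⟨c, hc, hcn⟩ := Nat.find_spec hex
  have hmin : ∀ m < Nat.find hex, ∀ c : B, (∀ a, a ∈ p ↔ a • c ∈ (⊥ : Subalgebra A B)) →
      C c * X ^ m ∉ filtrationRees A s := fun m hm c h1 h2 ↦ Nat.find_min hex hm ⟨c, h1, h2⟩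
  generalize Nat.find hex = N at hcn hmin
  obtain _ | n := N
  · have := coeff_zero_mem_bot_of_mem_filtrationRees hcn
    rw [pow_zero, mul_one, coeff_C_zero] at this
    exact absurd ((hc 1).2 (by rwa [one_smul])) hp.one_notMem
  refine ⟨c, n, hcn, fun a ↦ ⟨fun ha ↦ ?_, fun ha ↦ ?_⟩⟩
  · obtain ⟨r, hr⟩ := Algebra.mem_bot.1 ((hc a).1 ha)
    rw [← hr, ← Polynomial.algebraMap_apply]
    exact mul_mem (Subalgebra.algebraMap_mem _ _) (pow_mem (X_mem_filtrationRees s) n)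
  · by_contra hap
    refine hmin n n.lt_succ_self (a • c) (fun a' ↦ ?_) ha
    rw [smul_smul, ← hc]
    exact ⟨fun h ↦ p.mul_mem_right _ h, fun h ↦ (hp.mem_or_mem h).resolve_right hap⟩

theorem isNoetherianRing_filtrationRees [IsNoetherianRing A] (s : Finset B) :
    IsNoetherianRing (filtrationRees A (s : Set B)) := by
  classical
  have hR : (filtrationRees A (s : Set B)).FG :=
    ⟨insert X (s.image fun b ↦ C b * X), by simp [filtrationRees]⟩
  have := (filtrationRees A (s : Set B)).fg_iff_finiteType.1 hR
  exact Algebra.FiniteType.isNoetherianRing A _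

theorem finite_associatedPrimes_quotient_bot [IsNoetherianRing A] [Algebra.FiniteType A B] :
    (associatedPrimes A (B ⧸ Subalgebra.toSubmodule (⊥ : Subalgebra A B))).Finite := by
  obtain ⟨s, hs⟩ := Algebra.FiniteType.out (R := A) (A := B)
  have := isNoetherianRing_filtrationRees (A := A) s
  refine Subalgebra.finite_of_forall_exists_smul_eq_mul_iff (filtrationRees A (s : Set B))
    (X_mem_filtrationRees _) fun p hp ↦ ?_
  rw [AssociatedPrimes.mem_iff, isAssociatedPrime_iff] at hp
  obtain ⟨hp, y, hy⟩ := hp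
  obtain ⟨b, rfl⟩ := Submodule.Quotient.mk_surjective _ y
  have hb : ∀ a, a ∈ p ↔ a • b ∈ (⊥ : Subalgebra A B) := by
    intro a
    rw [hy, Submodule.mem_colon_singleton, Submodule.mem_bot, ← Submodule.Quotient.mk_smul,
      Submodule.Quotient.mk_eq_zero, Subalgebra.mem_toSubmodule]
  obtain ⟨c, n, hcn, hc⟩ := exists_C_mul_X_pow_colon hs hb
  refine ⟨hp, _, hcn, fun a ↦ ?_⟩
  have h1 : a • (C c * X ^ (n + 1)) = X * (C (a • c) * X ^ n) := by
    rw [← smul_C, smul_mul_assoc, mul_smul_comm, pow_succ]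
    congr 1
    ring
  rw [hc, h1]
  constructor
  · exact fun h ↦ ⟨_, h, rfl⟩
  · rintro ⟨w, hw, h⟩
    rwa [isRegular_X.left h]

end

section

variable {A B : Type*} [CommRing A] [CommRing B] [Algebra A B]

theorem exists_mem_iff_forall_minimalPrimes_notMem [IsNoetherianRing A] (I : Ideal A)
    (h : ∀ q ∈ minimalPrimes A, ¬ I ≤ q) : ∃ f ∈ I, ∀ q ∈ minimalPrimes A, f ∉ q := by
  by_contra! H
  have hfin := minimalPrimes.finite_of_isNoetherianRing A
  have hsub : (I : Set A) ⊆ ⋃ i ∈ (hfin.toFinset : Set (Ideal A)), (id i : Ideal A) := by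
    intro g hg
    obtain ⟨q, hq, hgq⟩ := H g hg
    exact Set.mem_biUnion (by simpa using hq) hgq
  obtain ⟨Q, hQ, hle⟩ := (Ideal.subset_union_prime ⊥ ⊥ fun i hi _ _ ↦
    (hfin.mem_toFinset.1 hi).1.1).1 hsub
  exact h Q (hfin.mem_toFinset.1 hQ) hle

/-- If every integral element becomes an element of `A` at each minimal prime, then inverting a
single element outside all the minimal primes makes `A` integrally closed in `B`. -/
theorem exists_forall_isIntegral_pow_smul_mem_bot [IsNoetherianRing A] [Algebra.FiniteType A B]
    (h : ∀ b : B, IsIntegral A b → ∀ q ∈ minimalPrimes A, ∃ s ∉ q, s • b ∈ (⊥ : Subalgebra A B)) :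
    ∃ f : A, (∀ q ∈ minimalPrimes A, f ∉ q) ∧
      ∀ b : B, IsIntegral A b → ∃ k : ℕ, f ^ k • b ∈ (⊥ : Subalgebra A B) := by
  let N := Subalgebra.toSubmodule (⊥ : Subalgebra A B)
  have hfin : (associatedPrimes A (B ⧸ N) \ minimalPrimes A).Finite :=
    finite_associatedPrimes_quotient_bot.subset Set.sdiff_subset
  obtain ⟨f, hfI, hf⟩ := exists_mem_iff_forall_minimalPrimes_notMem
    (hfin.toFinset.inf id) fun q hq hle ↦ by
      obtain ⟨P, hP, hPq⟩ := (Ideal.IsPrime.inf_le' hq.1.1).1 hle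
      obtain ⟨hP1, hP2⟩ := hfin.mem_toFinset.1 hP
      have hPp := IsAssociatedPrime.isPrime hP1
      have hPq' : P = q := le_antisymm hPq (hq.2 ⟨hPp, bot_le⟩ hPq)
      exact hP2 (hPq' ▸ hq)
  refine ⟨f, hf, fun b hb ↦ ?_⟩
  have hmem (a : A) : a ∈ (⊥ : Submodule A (B ⧸ N)).colon {N.mkQ b} ↔
      a • b ∈ (⊥ : Subalgebra A B) := by
    rw [Submodule.mem_colon_singleton, Submodule.mem_bot, ← map_smul, Submodule.mkQ_apply,
      Submodule.Quotient.mk_eq_zero, Subalgebra.mem_toSubmodule]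
  have hrad : f ∈ ((⊥ : Submodule A (B ⧸ N)).colon {N.mkQ b}).radical := by
    rw [← Ideal.sInf_minimalPrimes, Submodule.mem_sInf]
    intro P hP
    have hPass : P ∈ associatedPrimes A (B ⧸ N) := by
      rw [AssociatedPrimes.mem_iff, isAssociatedPrime_iff]
      exact ⟨hP.isPrime, Submodule.exists_eq_colon_of_mem_minimalPrimes hP⟩
    have hPmin : P ∉ minimalPrimes A := fun hPm ↦ by
      obtain ⟨s, hs, hsb⟩ := h b hb P hPm
      exact hs (hP.1.2 ((hmem s).2 hsb))
    exact (Finset.inf_le (f := id) (hfin.mem_toFinset.2 ⟨hPass, hPmin⟩) : _ ≤ P) hfI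
  obtain ⟨k, hk⟩ := hrad
  exact ⟨k, (hmem _).1 hk⟩

theorem isIntegral_of_isIntegral_mk_nilradical {b : B}
    (h : IsIntegral A (Ideal.Quotient.mk (nilradical B) b)) : IsIntegral A b := by
  obtain ⟨q, hq, hqb⟩ := h
  have h1 : Polynomial.aeval b q ∈ nilradical B := by
    rw [← Ideal.Quotient.eq_zero_iff_mem, ← Ideal.Quotient.mkₐ_eq_mk A,
      ← Polynomial.aeval_algHom_apply]
    exact hqb
  obtain ⟨n, hn⟩ := mem_nilradical.1 h1
  exact ⟨q ^ n, hq.pow n, by rwa [← Polynomial.aeval_def, map_pow]⟩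

theorem mk_nilradical_mem_nonZeroDivisors {x : B} (hx : ∀ Q ∈ minimalPrimes B, x ∉ Q) :
    Ideal.Quotient.mk (nilradical B) x ∈ nonZeroDivisors (B ⧸ nilradical B) := by
  rw [mem_nonZeroDivisors_iff_right]
  intro y hy
  obtain ⟨y, rfl⟩ := Ideal.Quotient.mk_surjective y
  rw [← map_mul, Ideal.Quotient.eq_zero_iff_mem] at hy
  rw [Ideal.Quotient.eq_zero_iff_mem]
  rw [nilradical, ← Ideal.sInf_minimalPrimes, Submodule.mem_sInf] at hy ⊢
  exact fun Q hQ ↦ (hQ.isPrime.mem_or_mem (hy Q hQ)).resolve_right (hx Q hQ)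

theorem mem_associatedPrimes_quotient_nilradical [IsNoetherianRing A]
    (hinj : Function.Injective (algebraMap A B)) {p : Ideal A} [p.IsPrime] {f : A} {b : B} {k : ℕ}
    (hf : ∀ Q ∈ minimalPrimes B, algebraMap A B f ∉ Q) (hb : f ^ k • b ∈ (⊥ : Subalgebra A B))
    (hpb : ∀ a, a ∈ p ↔ IsIntegral A (a • b)) :
    p ∈ associatedPrimes A
      ((A ⧸ nilradical A) ⧸ Ideal.span {Ideal.Quotient.mk (nilradical A) f}) := by
  have hle : nilradical A ≤ (nilradical B).comap (algebraMap A B) := fun a ha ↦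
    mem_nilradical.2 ((mem_nilradical.1 ha).map (algebraMap A B))
  let _ : Algebra (A ⧸ nilradical A) (B ⧸ nilradical B) :=
    (Ideal.quotientMap (nilradical B) (algebraMap A B) hle).toAlgebra
  have : IsScalarTower A (A ⧸ nilradical A) (B ⧸ nilradical B) :=
    IsScalarTower.of_algebraMap_eq fun _ ↦ rfl
  have hinj' : Function.Injective (algebraMap (A ⧸ nilradical A) (B ⧸ nilradical B)) := by
    refine Ideal.quotientMap_injective' (H := hle) fun a ha ↦ ?_
    exact mem_nilradical.2 ((IsNilpotent.map_iff hinj).1 (mem_nilradical.1 ha))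
  have hp : nilradical A ≤ p := nilradical_le_prime p
  have hmem (a : A) : Ideal.Quotient.mk (nilradical A) a ∈ p.map (Ideal.Quotient.mk _) ↔ a ∈ p := by
    rw [← Ideal.mem_comap, Ideal.comap_map_mk hp]
  have : (p.map (Ideal.Quotient.mk (nilradical A))).IsPrime :=
    Ideal.map_isPrime_of_surjective Ideal.Quotient.mk_surjective (by rwa [Ideal.mk_ker])
  have hsmul (a : A) (y : B) :
      Ideal.Quotient.mk (nilradical A) a • Ideal.Quotient.mk (nilradical B) y =
        Ideal.Quotient.mk (nilradical B) (a • y) := by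
    rw [Algebra.smul_def, Algebra.smul_def, map_mul]
    rfl
  by_contra hcon
  obtain ⟨s, hs, hsb⟩ := exists_notMem_isIntegral_smul hinj'
    (p := p.map (Ideal.Quotient.mk (nilradical A))) (f := Ideal.Quotient.mk _ f)
    (b := Ideal.Quotient.mk _ b) (k := k) (mk_nilradical_mem_nonZeroDivisors hf)
    (by
      obtain ⟨c, hc⟩ := Algebra.mem_bot.1 hb
      rw [← map_pow, hsmul, ← hc]
      exact Algebra.mem_bot.2 ⟨Ideal.Quotient.mk _ c, rfl⟩)
    (fun a ha ↦ by
      obtain ⟨a, rfl⟩ := Ideal.Quotient.mk_surjective a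
      rw [hsmul]
      exact (((hpb a).1 ((hmem a).1 ha)).map (Ideal.Quotient.mkₐ A (nilradical B))).tower_top)
    (fun h ↦ hcon <| by
      rw [AssociatedPrimes.mem_iff, isAssociatedPrime_iff] at h ⊢
      obtain ⟨-, x, hx⟩ := h
      refine ⟨inferInstance, x, ?_⟩
      ext a
      rw [← hmem, hx, Submodule.mem_colon_singleton, Submodule.mem_colon_singleton]
      rfl)
  obtain ⟨s, rfl⟩ := Ideal.Quotient.mk_surjective s
  rw [hsmul] at hsb
  have : Algebra.IsIntegral A (A ⧸ nilradical A) := inferInstance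
  exact hs ((hmem s).2 ((hpb s).2 (isIntegral_of_isIntegral_mk_nilradical (isIntegral_trans _ hsb))))

theorem mem_associatedPrimes_quotient_awayMap [IsNoetherianRing A] {p : Ideal A} [p.IsPrime]
    {f : A} {b : B} (hfp : f ∉ p)
    (hf : ∀ b : B, IsIntegral A b → ∃ k : ℕ, f ^ k • b ∈ (⊥ : Subalgebra A B))
    (hpb : ∀ a, a ∈ p ↔ IsIntegral A (a • b)) :
    p ∈ associatedPrimes A (Localization.Away (algebraMap A B f) ⧸
      Submodule.span A (Set.range (Localization.awayMap (algebraMap A B) f))) := by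
  let L := Localization.Away (algebraMap A B f)
  let ψ : Localization.Away f →+* L := Localization.awayMap (algebraMap A B) f
  have hψ (a : A) : ψ (algebraMap A _ a) = algebraMap B L (algebraMap A B a) :=
    IsLocalization.map_eq _ a
  have hspan (y : L) : y ∈ Submodule.span A (Set.range ψ) ↔ ∃ x, ψ x = y := by
    refine ⟨fun hy ↦ ?_, fun hy ↦ Submodule.subset_span hy⟩
    induction hy using Submodule.span_induction with
    | mem x hx => exact hx
    | zero => exact ⟨0, map_zero ψ⟩
    | add x y _ _ hx hy =>
      obtain ⟨x, rfl⟩ := hx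
      obtain ⟨y, rfl⟩ := hy
      exact ⟨x + y, map_add ψ x y⟩
    | smul a x _ hx =>
      obtain ⟨x, rfl⟩ := hx
      refine ⟨algebraMap A _ a * x, ?_⟩
      rw [map_mul, hψ, ← IsScalarTower.algebraMap_apply, ← Algebra.smul_def]
  have hsmul (a : A) (y : B) : a • algebraMap B L y = algebraMap B L (a • y) := by
    rw [Algebra.smul_def, Algebra.smul_def, map_mul, ← IsScalarTower.algebraMap_apply]
  rw [AssociatedPrimes.mem_iff, isAssociatedPrime_iff]
  refine ⟨inferInstance, Submodule.Quotient.mk (algebraMap B L b), ?_⟩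
  ext a
  rw [Submodule.mem_colon_singleton, Submodule.mem_bot, ← Submodule.Quotient.mk_smul,
    Submodule.Quotient.mk_eq_zero, hspan, hpb, hsmul]
  constructor
  · intro h
    obtain ⟨k, hk⟩ := hf _ h
    obtain ⟨c, hc⟩ := Algebra.mem_bot.1 hk
    refine ⟨IsLocalization.mk' _ c (⟨f ^ k, k, rfl⟩ : Submonoid.powers f), ?_⟩
    have hu : IsUnit (algebraMap B L (algebraMap A B f)) := IsLocalization.Away.algebraMap_isUnit _
    refine (hu.pow k).mul_left_cancel ?_
    rw [← map_pow, ← map_pow, ← hψ, ← map_mul, mul_comm, IsLocalization.mk'_spec, hψ, hc, hψ,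
      ← map_mul, Algebra.smul_def]
  · rintro ⟨x, hx⟩
    obtain ⟨c, ⟨_, k, rfl⟩, rfl⟩ := IsLocalization.exists_mk'_eq (Submonoid.powers f) x
    have h1 : algebraMap B L (algebraMap A B c) = algebraMap B L (f ^ k • a • b) := by
      rw [← hsmul, ← hx, Algebra.smul_def, IsScalarTower.algebraMap_apply A B L, ← hψ, ← hψ,
        ← map_mul, mul_comm, IsLocalization.mk'_spec]
    obtain ⟨⟨_, n, rfl⟩, hn⟩ := IsLocalization.exists_of_eq (M := .powers (algebraMap A B f)) h1
    have h2 : (f ^ n * f ^ k * a) • b = algebraMap A B (f ^ n * c) := by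
      rw [map_mul, map_pow]
      refine Eq.trans ?_ hn.symm
      simp only [Algebra.smul_def, map_mul, map_pow, mul_assoc]
    have h3 : f ^ n * f ^ k * a ∈ p := (hpb _).2 (h2 ▸ isIntegral_algebraMap)
    rw [← pow_add] at h3
    have hp : p.IsPrime := inferInstance
    exact (hpb a).1 ((hp.mem_or_mem h3).resolve_left fun h ↦ hfp (hp.mem_of_pow_mem _ h))

end

/-- Let `𝒜` be Noetherian, `ℬ` a finitely generated `𝒜`-algebra containing
`𝒜`, `𝒜̄` the integral closure of `𝒜` in `ℬ`.  Suppose every minimal prime of `ℬ` contracts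
to a minimal prime of `𝒜`, and that the localization map `𝒜_𝔭 → 𝒜̄_𝔭` is an isomorphism
for every minimal prime `𝔭` of `𝒜`.  Then there is `f ∈ 𝒜` with
`Ass_𝒜(ℬ/𝒜̄) ⊆ Ass_𝒜(ℬ_f/𝒜_f) ∪ Ass_𝒜(𝒜_red/f𝒜_red)`, all regarded as sets of primes of
`𝒜` (modules over `𝒜`).  Here the submodule `𝒜_f ⊆ ℬ_f` is realised as the `𝒜`-span of the
range of the canonical map `Localization.Away f →+* Localization.Away (algebraMap 𝒜 ℬ f)`
(this range is an `𝒜`-submodule, so the span adds nothing). -/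
theorem assPrimes_integralClosure_subset_union (A B : Type*)
    [CommRing A] [CommRing B] [IsNoetherianRing A] [Algebra A B]
    (hinj : Function.Injective (algebraMap A B))
    (hfg : Algebra.FiniteType A B)
    (hminB : ∀ Q ∈ minimalPrimes B, Q.comap (algebraMap A B) ∈ minimalPrimes A)
    (hloc : ∀ (p : Ideal A) (hp : p ∈ minimalPrimes A),
      haveI : p.IsPrime := hp.1.1
      Function.Bijective
        (IsLocalization.map
          (Localization (Algebra.algebraMapSubmonoid (integralClosure A B) p.primeCompl))
          (algebraMap A (integralClosure A B))
          (show p.primeCompl ≤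
              (Algebra.algebraMapSubmonoid (integralClosure A B) p.primeCompl).comap _ from
            p.primeCompl.le_comap_map) :
          Localization.AtPrime p →+* _)) :
    ∃ f : A,
      associatedPrimes A (B ⧸ Subalgebra.toSubmodule (integralClosure A B)) ⊆
        associatedPrimes A
          (Localization.Away (algebraMap A B f) ⧸
            Submodule.span A (Set.range (Localization.awayMap (algebraMap A B) f))) ∪
        associatedPrimes A
          ((A ⧸ nilradical A) ⧸
            Ideal.span {Ideal.Quotient.mk (nilradical A) f}) := by
  have h : ∀ b : B, IsIntegral A b → ∀ q ∈ minimalPrimes A,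
      ∃ s ∉ q, s • b ∈ (⊥ : Subalgebra A B) := by
    intro b hb q hq
    have : q.IsPrime := hq.1.1
    obtain ⟨x, hx⟩ := (hloc q hq).2 (algebraMap (integralClosure A B) _ ⟨b, hb⟩)
    obtain ⟨a, s, rfl⟩ := IsLocalization.exists_mk'_eq q.primeCompl x
    rw [IsLocalization.map_mk', IsLocalization.mk'_eq_iff_eq_mul, ← map_mul] at hx
    obtain ⟨⟨_, t, ht, rfl⟩, hn⟩ := IsLocalization.exists_of_eq
      (M := Algebra.algebraMapSubmonoid (integralClosure A B) q.primeCompl) hx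
    refine ⟨t * s, (mul_mem ht s.2 : t * s ∈ q.primeCompl), Algebra.mem_bot.2 ⟨t * a, ?_⟩⟩
    have h1 : algebraMap A B t * algebraMap A B a = algebraMap A B t * (b * algebraMap A B s) :=
      congrArg Subtype.val hn
    rw [map_mul, h1, Algebra.smul_def, map_mul]
    ring
  obtain ⟨f, hfmin, hf⟩ := exists_forall_isIntegral_pow_smul_mem_bot h
  refine ⟨f, fun p hp ↦ ?_⟩
  rw [AssociatedPrimes.mem_iff, isAssociatedPrime_iff] at hp
  obtain ⟨hp, y, hy⟩ := hp
  obtain ⟨b, rfl⟩ := Submodule.Quotient.mk_surjective _ y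
  have hpb (a : A) : a ∈ p ↔ IsIntegral A (a • b) := by
    rw [hy, Submodule.mem_colon_singleton, Submodule.mem_bot, ← Submodule.Quotient.mk_smul,
      Submodule.Quotient.mk_eq_zero, Subalgebra.mem_toSubmodule, mem_integralClosure_iff]
  by_cases hfp : f ∈ p
  · obtain ⟨k, hk⟩ := hf _ ((hpb f).1 hfp)
    rw [smul_smul, ← pow_succ] at hk
    exact Or.inr (mem_associatedPrimes_quotient_nilradical hinj
      (fun Q hQ hfQ ↦ hfmin _ (hminB Q hQ) hfQ) hk hpb)
  · exact Or.inl (mem_associatedPrimes_quotient_awayMap hfp hf hpb)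
end

section
/- Let 𝒜 be a Noetherian ring, ℬ a finitely generated 𝒜-algebra containing 𝒜, and 𝒜̄ the integral closure of 𝒜 in ℬ. Suppose that every minimal prime of ℬ contracts to a minimal prime of 𝒜 and that 𝒜_{𝔭} = 𝒜̄_{𝔭} for every minimal prime 𝔭 of 𝒜. Then the sets Ass_𝒜(ℬ/𝒜̄) and Ass_𝒜̄(ℬ/𝒜̄) are both finite. -/
open Polynomial

/-- The length of the localization of `M` at the prime `P`. -/
noncomputable def localLength {R : Type*} [CommRing R] (P : Ideal R) [P.IsPrime]
    (M : Type*) [AddCommGroup M] [Module R M] : ℕ∞ :=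
  Module.length (Localization P.primeCompl) (LocalizedModule P.primeCompl M)

section localLength

variable {R : Type*} [CommRing R] (P : Ideal R) [P.IsPrime]
  {M N L : Type*} [AddCommGroup M] [Module R M] [AddCommGroup N] [Module R N]
  [AddCommGroup L] [Module R L]

lemma localLength_eq_add (f : M →ₗ[R] N) (g : N →ₗ[R] L) (hf : Function.Injective f)
    (hg : Function.Surjective g) (h : Function.Exact f g) :
    localLength P N = localLength P M + localLength P L :=
  Module.length_eq_add_of_exact (LocalizedModule.map P.primeCompl f)
    (LocalizedModule.map P.primeCompl g) (LocalizedModule.map_injective _ f hf)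
    (LocalizedModule.map_surjective _ g hg) (LocalizedModule.map_exact _ f g h)

lemma localLength_le_of_injective (f : M →ₗ[R] N) (hf : Function.Injective f) :
    localLength P M ≤ localLength P N :=
  Module.length_le_of_injective (LocalizedModule.map P.primeCompl f)
    (LocalizedModule.map_injective _ f hf)

lemma localLength_pos_iff : 0 < localLength P M ↔ ∃ m : M, ∀ s ∉ P, s • m ≠ 0 := by
  rw [localLength, Module.length_pos_iff]
  exact Module.mem_support_iff' (p := ⟨P, inferInstance⟩)

lemma localLength_quotient_self : localLength P (R ⧸ P) ≠ ⊤ := by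
  have hz {a : R} : (Ideal.Quotient.mk P a) = 0 ↔ a ∈ P := Ideal.Quotient.eq_zero_iff_mem
  have : IsSimpleModule (Localization P.primeCompl) (LocalizedModule P.primeCompl (R ⧸ P)) := by
    rw [isSimpleModule_iff_toSpanSingleton_surjective]
    constructor
    · refine Module.length_pos_iff (R := Localization P.primeCompl) |>.1 ?_
      refine (localLength_pos_iff P).2 ⟨Ideal.Quotient.mk P 1, fun s hs h => hs ?_⟩
      rwa [Algebra.smul_def, Ideal.Quotient.algebraMap_eq, ← map_mul, mul_one, hz] at h
    · intro m hm n
      induction m using LocalizedModule.induction_on with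
      | h m s =>
      induction n using LocalizedModule.induction_on with
      | h n t =>
      obtain ⟨a, rfl⟩ := Ideal.Quotient.mk_surjective m
      obtain ⟨b, rfl⟩ := Ideal.Quotient.mk_surjective n
      have ha : a ∉ P := fun ha => hm (by rw [hz.2 ha, LocalizedModule.zero_mk])
      refine ⟨Localization.mk (b * s) (t * ⟨a, ha⟩), ?_⟩
      rw [LinearMap.toSpanSingleton_apply, LocalizedModule.mk_smul_mk, LocalizedModule.mk_eq]
      refine ⟨1, ?_⟩
      simp only [one_smul, Submonoid.smul_def, Algebra.smul_def, Ideal.Quotient.algebraMap_eq,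
        ← map_mul, Submonoid.coe_mul]
      congr 1
      ring
  rw [localLength, Module.length_eq_one]
  exact ENat.one_ne_top

lemma localLength_ne_top [IsNoetherianRing R] [hM : Module.Finite R M]
    (h : ∀ m : M, ∃ k, ∀ c ∈ P ^ k, c • m = 0) : localLength P M ≠ ⊤ := by
  revert h
  induction hM using IsNoetherianRing.induction_on_isQuotientEquivQuotientPrime R with
  | subsingleton N =>
    intro _
    have : localLength P N = 0 := by
      rw [← nonpos_iff_eq_zero, ← not_lt, localLength_pos_iff]
      rintro ⟨m, hm⟩
      exact hm 1 (P.primeCompl.one_mem) (Subsingleton.elim _ _)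
    simp [this]
  | quotient N p e =>
    intro h
    have hPp : P ≤ p.1 := by
      obtain ⟨k, hk⟩ := h (e.symm 1)
      refine p.2.le_of_pow_le (n := k) fun c hc => ?_
      have := congrArg e (hk c hc)
      rw [map_smul, e.apply_symm_apply, map_zero, Algebra.smul_def, mul_one] at this
      exact Ideal.Quotient.eq_zero_iff_mem.1 this
    by_cases hp : p.1 ≤ P
    · have hp : p.1 = P := le_antisymm hp hPp
      have h1 := localLength_le_of_injective P e.toLinearMap e.injective
      rw [hp] at h1
      exact ne_top_of_le_ne_top (localLength_quotient_self P) h1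
    · obtain ⟨s, hs, hsP⟩ := SetLike.not_le_iff_exists.1 hp
      have : localLength P N = 0 := by
        rw [← nonpos_iff_eq_zero, ← not_lt, localLength_pos_iff]
        rintro ⟨m, hm⟩
        refine hm s hsP (e.injective ?_)
        obtain ⟨b, hb⟩ := Ideal.Quotient.mk_surjective (e m)
        rw [map_smul, map_zero, ← hb, Algebra.smul_def, Ideal.Quotient.algebraMap_eq, ← map_mul]
        exact Ideal.Quotient.eq_zero_iff_mem.2 (p.1.mul_mem_right _ hs)
      simp [this]
  | exact N₁ N₂ N₃ f g hf hg hfg h₁ h₃ =>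
    intro h
    rw [localLength_eq_add P f g hf hg hfg]
    refine WithTop.add_ne_top.2 ⟨h₁ fun m => ?_, h₃ fun m => ?_⟩
    · obtain ⟨k, hk⟩ := h (f m)
      exact ⟨k, fun c hc => hf (by rw [map_smul, hk c hc, map_zero])⟩
    · obtain ⟨m, rfl⟩ := hg m
      obtain ⟨k, hk⟩ := h m
      exact ⟨k, fun c hc => by rw [← map_smul, hk c hc, map_zero]⟩

/-- The length at `P` of `V / (U ⊓ V)`. -/
noncomputable def relLength (U V : Submodule R M) : ℕ∞ := localLength P (V ⧸ U.submoduleOf V)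

lemma relLength_eq_add {U V W : Submodule R M} (hUV : U ≤ V) (hVW : V ≤ W) :
    relLength P U W = relLength P U V + relLength P V W := by
  have h1 : U.submoduleOf V ≤ (U.submoduleOf W).comap (Submodule.inclusion hVW) :=
    fun _ hx => hx
  have h2 : U.submoduleOf W ≤ (V.submoduleOf W).comap LinearMap.id := fun _ hx => hUV hx
  refine localLength_eq_add P (Submodule.mapQ _ _ _ h1) (Submodule.mapQ _ _ _ h2) ?_ ?_ ?_
  · rw [injective_iff_map_eq_zero]
    intro a ha
    obtain ⟨a, rfl⟩ := Submodule.mkQ_surjective _ a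
    rw [Submodule.mkQ_apply, Submodule.mapQ_apply, Submodule.Quotient.mk_eq_zero] at ha
    exact (Submodule.Quotient.mk_eq_zero _).2 ha
  · intro b
    obtain ⟨b, rfl⟩ := Submodule.mkQ_surjective _ b
    exact ⟨Submodule.Quotient.mk b, rfl⟩
  · intro b
    obtain ⟨b, rfl⟩ := Submodule.mkQ_surjective _ b
    constructor
    · intro hb
      rw [Submodule.mkQ_apply, Submodule.mapQ_apply, Submodule.Quotient.mk_eq_zero] at hb
      exact ⟨Submodule.Quotient.mk ⟨b, hb⟩, rfl⟩
    · rintro ⟨a, ha⟩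
      obtain ⟨a, rfl⟩ := Submodule.mkQ_surjective _ a
      rw [← ha]
      exact (Submodule.Quotient.mk_eq_zero _).2 a.2

lemma relLength_le {U V : Submodule R M} {U' V' : Submodule R N} (f : M →ₗ[R] N)
    (hV : ∀ v ∈ V, f v ∈ V') (hU : ∀ v ∈ V, f v ∈ U' ↔ v ∈ U) :
    relLength P U V ≤ relLength P U' V' := by
  have h1 : U.submoduleOf V ≤ (U'.submoduleOf V').comap (f.restrict hV) :=
    fun x hx => (hU x x.2).2 hx
  refine localLength_le_of_injective P (Submodule.mapQ _ _ _ h1) ?_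
  rw [injective_iff_map_eq_zero]
  intro a ha
  obtain ⟨a, rfl⟩ := Submodule.mkQ_surjective _ a
  rw [Submodule.mkQ_apply, Submodule.mapQ_apply, Submodule.Quotient.mk_eq_zero] at ha
  exact (Submodule.Quotient.mk_eq_zero _).2 ((hU a a.2).1 ha)

lemma relLength_pos_iff {U V : Submodule R M} :
    0 < relLength P U V ↔ ∃ v ∈ V, ∀ s ∉ P, s • v ∉ U := by
  rw [relLength, localLength_pos_iff]
  constructor
  · rintro ⟨m, hm⟩
    obtain ⟨v, rfl⟩ := Submodule.mkQ_surjective _ m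
    exact ⟨v, v.2, fun s hs h => hm s hs ((Submodule.Quotient.mk_eq_zero (U.submoduleOf V)).2 h)⟩
  · rintro ⟨v, hv, h⟩
    exact ⟨Submodule.Quotient.mk ⟨v, hv⟩,
      fun s hs h' => h s hs ((Submodule.Quotient.mk_eq_zero (U.submoduleOf V)).1 h')⟩

lemma relLength_ne_top [IsNoetherianRing R] {U V : Submodule R M} [Module.Finite R V]
    (h : ∀ v ∈ V, ∃ k, ∀ c ∈ P ^ k, c • v ∈ U) : relLength P U V ≠ ⊤ := by
  refine localLength_ne_top P fun m => ?_
  obtain ⟨v, rfl⟩ := Submodule.mkQ_surjective _ m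
  obtain ⟨k, hk⟩ := h v v.2
  exact ⟨k, fun c hc => (Submodule.Quotient.mk_eq_zero _).2 (hk c hc)⟩

end localLength

section primaryTorsion

variable {R M : Type*} [CommRing R] [AddCommGroup M] [Module R M]

/-- The elements of `Z` whose class modulo `U` is killed by a power of `P`. -/
def primaryTorsion (P : Ideal R) (U Z : Submodule R M) : Submodule R M where
  carrier := {y | y ∈ Z ∧ ∃ k, ∀ c ∈ P ^ k, c • y ∈ U}
  zero_mem' := ⟨Z.zero_mem, 0, fun c _ => by simp⟩
  add_mem' := by
    rintro a b ⟨ha, k, hk⟩ ⟨hb, l, hl⟩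
    refine ⟨Z.add_mem ha hb, k + l, fun c hc => ?_⟩
    rw [smul_add]
    exact U.add_mem (hk c (Ideal.pow_le_pow_right (by lia) hc))
      (hl c (Ideal.pow_le_pow_right (by lia) hc))
  smul_mem' := by
    rintro a y ⟨hy, k, hk⟩
    refine ⟨Z.smul_mem a hy, k, fun c hc => ?_⟩
    rw [smul_comm]
    exact U.smul_mem a (hk c hc)

lemma relLength_primaryTorsion_ne_top [IsNoetherianRing R] (P : Ideal R) [P.IsPrime]
    (U Z : Submodule R M) [IsNoetherian R Z] : relLength P U (primaryTorsion P U Z) ≠ ⊤ := by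
  have : IsNoetherian R (primaryTorsion P U Z) :=
    isNoetherian_of_le (show primaryTorsion P U Z ≤ Z from fun _ h => h.1)
  exact relLength_ne_top P fun v hv => hv.2

end primaryTorsion

section denominators

variable {R : Type*} (S : Type*) [CommRing R] [CommRing S] [Algebra R S] (t : R)

/-- The elements `y` of `S` such that `t ^ n • y` lies in the image of `R`. -/
noncomputable def denominators (n : ℕ) : Submodule R S :=
  (1 : Submodule R S).comap (LinearMap.lsmul R S (t ^ n))

variable {S t}

lemma mem_denominators {n : ℕ} {y : S} :
    y ∈ denominators S t n ↔ t ^ n • y ∈ (1 : Submodule R S) := Iff.rfl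

lemma denominators_mono : Monotone (denominators S t) := by
  intro m n h y hy
  obtain ⟨k, rfl⟩ := Nat.exists_eq_add_of_le h
  rw [mem_denominators, add_comm, pow_add, mul_smul]
  exact Submodule.smul_mem _ _ hy

lemma exists_le_denominators (hS : ∀ x : S, ∃ k, t ^ k • x ∈ (1 : Submodule R S))
    {U : Submodule R S} (hU : U.FG) : ∃ n, U ≤ denominators S t n := by
  induction U, hU using Submodule.fg_induction with
  | singleton x =>
    obtain ⟨k, hk⟩ := hS x
    exact ⟨k, (Submodule.span_singleton_le_iff_mem _ _).2 hk⟩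
  | sup U V _ _ hU hV =>
    obtain ⟨m, hm⟩ := hU
    obtain ⟨n, hn⟩ := hV
    exact ⟨max m n, sup_le (hm.trans (denominators_mono (le_max_left _ _)))
      (hn.trans (denominators_mono (le_max_right _ _)))⟩

lemma smul_pow_injective (ht : ∀ x : S, t • x = 0 → x = 0) (n : ℕ) (x : S)
    (h : t ^ n • x = 0) : x = 0 := by
  induction n with
  | zero => simpa using h
  | succ n ih => exact ih (ht _ (by rwa [smul_smul, ← pow_succ']))

lemma isNoetherian_denominators [IsNoetherianRing R] (ht : ∀ x : S, t • x = 0 → x = 0) (n : ℕ) :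
    IsNoetherian R (denominators S t n) := by
  have h1 : IsNoetherian R (1 : Submodule R S) := by
    rw [Submodule.one_eq_range]
    infer_instance
  have hm : ∀ y ∈ denominators S t n, LinearMap.lsmul R S (t ^ n) y ∈ (1 : Submodule R S) :=
    fun _ hy => hy
  refine isNoetherian_of_injective ((LinearMap.lsmul R S (t ^ n)).restrict hm) ?_
  rw [injective_iff_map_eq_zero]
  intro a ha
  exact Subtype.ext (smul_pow_injective ht n _ (congrArg Subtype.val ha))

lemma one_le_primaryTorsion (P : Ideal R) (n : ℕ) :
    (1 : Submodule R S) ≤ primaryTorsion P 1 (denominators S t n) :=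
  fun _ hy => ⟨Submodule.smul_mem _ _ hy, 0, fun c _ => Submodule.smul_mem _ c hy⟩

variable (S t)

/-- The length at `P` of the `P`-primary torsion of `t⁻¹R / R`. -/
noncomputable def torsionLength (P : Ideal R) [P.IsPrime] : ℕ∞ :=
  relLength P 1 (primaryTorsion P 1 (denominators S t 1))

variable {S t} (P : Ideal R) [P.IsPrime]

lemma torsionLength_ne_top [IsNoetherianRing R] (ht : ∀ x : S, t • x = 0 → x = 0) :
    torsionLength S t P ≠ ⊤ :=
  have := isNoetherian_denominators ht 1
  relLength_primaryTorsion_ne_top P _ _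

lemma relLength_primaryTorsion_denominators_le (n : ℕ) :
    relLength P 1 (primaryTorsion P 1 (denominators S t n)) ≤ n * torsionLength S t P := by
  induction n with
  | zero =>
    rw [Nat.cast_zero, zero_mul, ← not_lt, relLength_pos_iff]
    rintro ⟨v, hv, h⟩
    have h0 := hv.1
    rw [mem_denominators, pow_zero] at h0
    exact h 1 P.primeCompl.one_mem h0
  | succ n ih =>
    have hle : primaryTorsion P (1 : Submodule R S) (denominators S t n) ≤
        primaryTorsion P 1 (denominators S t (n + 1)) :=
      fun y hy => ⟨denominators_mono n.le_succ hy.1, hy.2⟩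
    rw [relLength_eq_add P (one_le_primaryTorsion P n) hle, Nat.cast_succ, add_mul, one_mul]
    refine add_le_add ih (relLength_le P (LinearMap.lsmul R S (t ^ n)) ?_ ?_)
    · rintro v ⟨hv, k, hk⟩
      refine ⟨?_, k, fun c hc => ?_⟩
      · rwa [mem_denominators, LinearMap.lsmul_apply, smul_smul, ← pow_add, add_comm]
      · rw [LinearMap.lsmul_apply, smul_comm]
        exact Submodule.smul_mem _ _ (hk c hc)
    · exact fun v hv => ⟨fun h => ⟨h, hv.2⟩, fun h => h.1⟩

lemma mem_associatedPrimes_of_torsionLength_pos [IsNoetherianRing R]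
    (ht : ∀ x : S, t • x = 0 → x = 0) (hinj : Function.Injective (algebraMap R S))
    (h : 0 < torsionLength S t P) : P ∈ associatedPrimes R (R ⧸ Ideal.span {t}) := by
  obtain ⟨v, ⟨hv, k, hk⟩, h⟩ := (relLength_pos_iff P).1 h
  rw [mem_denominators, pow_one, Submodule.mem_one] at hv
  obtain ⟨b, hb⟩ := hv
  have key : ∀ c : R, c ∈ (⊥ : Submodule R (R ⧸ Ideal.span {t})).colon
      {Ideal.Quotient.mk _ b} ↔ c • v ∈ (1 : Submodule R S) := by
    intro c
    rw [Submodule.mem_colon_singleton, Submodule.mem_bot, Algebra.smul_def,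
      Ideal.Quotient.algebraMap_eq, ← map_mul, Ideal.Quotient.eq_zero_iff_mem,
      Ideal.mem_span_singleton', Submodule.mem_one]
    refine exists_congr fun a => ?_
    have e1 : algebraMap R S (c * b) = t • (c • v) := by
      rw [map_mul, hb, smul_comm, Algebra.smul_def c]
    have e2 : algebraMap R S (a * t) = t • algebraMap R S a := by
      rw [map_mul, mul_comm, Algebra.smul_def]
    rw [← hinj.eq_iff, e1, e2, ← sub_eq_zero, ← smul_sub]
    exact ⟨fun h => sub_eq_zero.1 (ht _ h), fun h => by rw [h, sub_self, smul_zero]⟩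
  have hP : P ∈ ((⊥ : Submodule R (R ⧸ Ideal.span {t})).colon
      {Ideal.Quotient.mk _ b}).minimalPrimes := by
    refine ⟨⟨inferInstance, fun c hc => ?_⟩, fun Q hQ _ => ?_⟩
    · by_contra hcP
      exact h c hcP ((key c).1 hc)
    · exact hQ.1.le_of_pow_le (n := k) fun c hc => hQ.2 ((key c).2 (hk c hc))
  obtain ⟨y, hy⟩ := Submodule.exists_eq_colon_of_mem_minimalPrimes hP
  exact isAssociatedPrime_iff.2 ⟨inferInstance, y, hy⟩

end denominators

section growth

variable {R S : Type*} [CommRing R] [CommRing S] [Algebra R S]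

/-- The elements of `S` that are polynomials of degree at most `n` in `x` over `T`. -/
noncomputable def polynomialSpan (T : Subalgebra R S) (x : S) (n : ℕ) : Submodule R S :=
  ((degreeLE T n).map (aeval x : T[X] →ₐ[T] S).toLinearMap).restrictScalars R

lemma mem_polynomialSpan {T : Subalgebra R S} {x : S} {n : ℕ} {v : S} :
    v ∈ polynomialSpan T x n ↔ ∃ p : T[X], p.natDegree ≤ n ∧ aeval x p = v := by
  simp [polynomialSpan, mem_degreeLE, natDegree_le_iff_degree_le]

lemma polynomialSpan_mono (T : Subalgebra R S) (x : S) : Monotone (polynomialSpan T x) := by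
  intro m n h v hv
  obtain ⟨p, hp, hv⟩ := mem_polynomialSpan.1 hv
  exact mem_polynomialSpan.2 ⟨p, hp.trans h, hv⟩

lemma mem_polynomialSpan_zero {T : Subalgebra R S} {x v : S} :
    v ∈ polynomialSpan T x 0 ↔ v ∈ T := by
  rw [mem_polynomialSpan]
  constructor
  · rintro ⟨p, hp, rfl⟩
    rw [eq_C_of_natDegree_le_zero hp, aeval_C]
    exact (p.coeff 0).2
  · exact fun h => ⟨C ⟨v, h⟩, by simp, by rw [aeval_C]; rfl⟩

lemma isIntegral_of_mul_pow_mem_polynomialSpan {T : Subalgebra R S} [Algebra.IsIntegral R T]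
    {x : S} {n : ℕ} {a : S} (ha : a ∈ T) (h : a * x ^ (n + 1) ∈ polynomialSpan T x n) :
    IsIntegral R (a * x) := by
  obtain ⟨p, hp, hpx⟩ := mem_polynomialSpan.1 h
  by_cases ha0 : (⟨a, ha⟩ : T) = 0
  · have : a = 0 := congrArg Subtype.val ha0
    rw [this, zero_mul]
    exact isIntegral_zero
  have hlt : p.degree < (C (⟨a, ha⟩ : T) * X ^ (n + 1)).degree := by
    rw [degree_C_mul_X_pow _ ha0]
    exact (natDegree_le_iff_degree_le.1 hp).trans_lt (by exact_mod_cast n.lt_succ_self)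
  have h0 : aeval x (C (⟨a, ha⟩ : T) * X ^ (n + 1) - p) = 0 := by
    rw [map_sub, hpx, map_mul, aeval_C, map_pow, aeval_X]
    exact sub_self _
  have h1 := isIntegral_leadingCoeff_smul _ _ h0
  rw [leadingCoeff_sub_of_degree_lt hlt, leadingCoeff_mul_X_pow, leadingCoeff_C] at h1
  exact isIntegral_trans (R := R) (A := T) _ h1

lemma smul_mem_polynomialSpan {T : Subalgebra R S} {x : S} {n : ℕ} {c : R} {v : S}
    (hc : c • x ∈ T) (hv : v ∈ polynomialSpan T x (n + 1)) : c • v ∈ polynomialSpan T x n := by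
  obtain ⟨p, hp, rfl⟩ := mem_polynomialSpan.1 hv
  refine mem_polynomialSpan.2
    ⟨C ⟨c • x, hc⟩ * p.divX + C (algebraMap R T c) * C (p.coeff 0), ?_, ?_⟩
  · refine natDegree_add_le_of_degree_le ((natDegree_C_mul_le _ _).trans ?_)
      (by rw [← C_mul, natDegree_C]; exact n.zero_le)
    rw [natDegree_divX_eq_natDegree_tsub_one]
    lia
  · conv_rhs => rw [← divX_mul_X_add p]
    simp only [map_add, map_mul, aeval_C, aeval_X, smul_add]
    have e1 : algebraMap T S ⟨c • x, hc⟩ = c • x := rfl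
    have e2 : algebraMap T S (algebraMap R T c) = algebraMap R S c := rfl
    rw [e1, e2, Algebra.smul_def, Algebra.smul_def, Algebra.smul_def]
    ring

lemma pow_smul_mem_of_mem_polynomialSpan {T : Subalgebra R S} {x : S} {P : Ideal R}
    (hP : ∀ c ∈ P, c • x ∈ T) {n : ℕ} :
    ∀ v ∈ polynomialSpan T x n, ∀ c ∈ P ^ n, c • v ∈ T := by
  induction n with
  | zero => exact fun v hv c _ => T.smul_mem (mem_polynomialSpan_zero.1 hv) c
  | succ n ih =>
    intro v hv c hc
    rw [pow_succ] at hc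
    induction hc using Submodule.mul_induction_on' with
    | mem_mul_mem a ha b hb =>
      rw [mul_smul]
      exact ih _ (smul_mem_polynomialSpan (hP b hb) hv) a ha
    | add a _ b _ ha hb =>
      rw [add_smul]
      exact T.add_mem ha hb

lemma exists_finite_subalgebra [IsNoetherianRing R] (R₁ : Subalgebra R S) [Module.Finite R R₁]
    {x : S} {I : Ideal R₁} (hI : ∀ a ∈ I, IsIntegral R (a * x)) :
    ∃ T : Subalgebra R S, Module.Finite R T ∧ R₁ ≤ T ∧ ∀ a ∈ I, a * x ∈ T := by
  classical
  have : IsNoetherianRing R₁ := IsNoetherianRing.of_finite R R₁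
  obtain ⟨G, hG⟩ := IsNoetherian.noetherian I
  let F : Finset S := G.image fun a : R₁ => (a : S) * x
  have hF : ∀ y ∈ (F : Set S), IsIntegral R y := by
    intro y hy
    obtain ⟨a, ha, rfl⟩ := Finset.mem_image.1 (Finset.mem_coe.1 hy)
    exact hI a (hG ▸ Submodule.subset_span ha)
  have : Module.Finite R (Algebra.adjoin R (F : Set S)) :=
    ⟨(Submodule.fg_top _).2 (fg_adjoin_of_finite F.finite_toSet hF)⟩
  refine ⟨R₁ ⊔ Algebra.adjoin R F, Subalgebra.finite_sup _ _, le_sup_left, fun a ha => ?_⟩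
  rw [← hG] at ha
  induction ha using Submodule.span_induction with
  | mem a ha =>
    exact le_sup_right (a := R₁)
      (Algebra.subset_adjoin (Finset.mem_coe.2 (Finset.mem_image_of_mem _ ha)))
  | zero => simp
  | add a b _ _ ha hb =>
    rw [Subalgebra.coe_add, add_mul]
    exact add_mem ha hb
  | smul b a _ ha =>
    rw [smul_eq_mul, Subalgebra.coe_mul, mul_assoc]
    exact mul_mem (le_sup_left (a := R₁) b.2) ha

lemma ENat.le_of_forall_mul_le_add {r l k : ℕ∞} (hl : l ≠ ⊤) (hk : k ≠ ⊤)
    (h : ∀ n : ℕ, n * r ≤ k + n * l) : r ≤ l := by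
  lift l to ℕ using hl
  lift k to ℕ using hk
  by_contra! hlt
  have h1 : ((k + 1 : ℕ) : ℕ∞) * ((l + 1 : ℕ) : ℕ∞) ≤ k + ((k + 1 : ℕ) : ℕ∞) * l :=
    (mul_le_mul_right (by simpa using Order.add_one_le_of_lt hlt) _).trans (h (k + 1))
  have h2 : (k + 1) * (l + 1) ≤ k + (k + 1) * l := by exact_mod_cast h1
  lia

lemma relLength_le_torsionLength [IsNoetherianRing R] {t : R} (P : Ideal R) [P.IsPrime]
    (ht : ∀ x : S, t • x = 0 → x = 0) (hS : ∀ x : S, ∃ k, t ^ k • x ∈ (1 : Submodule R S))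
    (htP : t ∈ P) (R₁ : Subalgebra R S) [Module.Finite R R₁] {x : S} {I : Ideal R₁}
    (hI : ∀ a : R₁, a ∈ I ↔ IsIntegral R (a * x)) (hPI : ∀ c ∈ P, algebraMap R R₁ c ∈ I) :
    relLength P (I.restrictScalars R) ⊤ ≤ torsionLength S t P := by
  obtain ⟨T, hT, hRT, hxT⟩ := exists_finite_subalgebra R₁ fun a ha => (hI a).1 ha
  obtain ⟨N, hN⟩ := exists_le_denominators hS
    ((Submodule.fg_top (Subalgebra.toSubmodule T)).1 hT.fg_top)
  have := isNoetherian_denominators ht N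
  have hPT : ∀ c ∈ P, c • x ∈ T := fun c hc => by
    have := hxT _ (hPI c hc)
    rwa [Subalgebra.coe_algebraMap, ← Algebra.smul_def] at this
  have hT0 : ∀ n, Subalgebra.toSubmodule T ≤ polynomialSpan T x n := fun n v hv =>
    polynomialSpan_mono T x n.zero_le (mem_polynomialSpan_zero.2 hv)
  have lower (n : ℕ) : n * relLength P (I.restrictScalars R) ⊤ ≤
      relLength P (Subalgebra.toSubmodule T) (polynomialSpan T x n) := by
    induction n with
    | zero => simp
    | succ n ih =>
      rw [relLength_eq_add P (hT0 n) (polynomialSpan_mono T x n.le_succ), Nat.cast_succ,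
        add_mul, one_mul]
      refine add_le_add ih (relLength_le P
        ((LinearMap.mulRight R (x ^ (n + 1))).comp R₁.val.toLinearMap) ?_ ?_)
      · intro a _
        exact mem_polynomialSpan.2 ⟨C ⟨a, hRT a.2⟩ * X ^ (n + 1), natDegree_C_mul_X_pow_le _ _,
          by rw [map_mul, aeval_C, map_pow, aeval_X]; rfl⟩
      · intro a _
        constructor
        · intro h
          exact (hI a).2 (isIntegral_of_mul_pow_mem_polynomialSpan (hRT a.2) h)
        · intro h
          refine mem_polynomialSpan.2 ⟨C ⟨a * x, hxT a h⟩ * X ^ n, natDegree_C_mul_X_pow_le _ _, ?_⟩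
          rw [map_mul, aeval_C, map_pow, aeval_X]
          change (a * x : S) * x ^ n = a * x ^ (n + 1)
          ring
  refine ENat.le_of_forall_mul_le_add (torsionLength_ne_top P ht)
    (relLength_primaryTorsion_ne_top P (Subalgebra.toSubmodule T) (denominators S t N))
    fun n => (lower n).trans ?_
  rw [relLength_eq_add P (V := polynomialSpan T x n ⊓ denominators S t N)
    (le_inf (hT0 n) hN) inf_le_left]
  have htor := pow_smul_mem_of_mem_polynomialSpan hPT (n := n)
  refine add_le_add (relLength_le P LinearMap.id ?_ fun _ _ => Iff.rfl)
    ((relLength_le P (LinearMap.lsmul R S (t ^ N)) ?_ ?_).trans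
      (relLength_primaryTorsion_denominators_le P n))
  · exact fun v hv => ⟨hv.2, n, htor v hv.1⟩
  · intro v hv
    refine ⟨?_, n, fun c hc => ?_⟩
    · rw [mem_denominators, LinearMap.lsmul_apply, smul_comm]
      exact hN (htor v hv _ (Ideal.pow_mem_pow htP n))
    · rw [LinearMap.lsmul_apply, smul_comm]
      exact hN (htor v hv c hc)
  · exact fun v hv => ⟨fun h => ⟨hv, h⟩, fun h => h.2⟩

end growth

section fibers

variable {R S : Type*} [CommRing R] [CommRing S] [Algebra R S]

lemma inf_not_le_of_comap_eq {T : Type*} [CommRing T] [Algebra R T] [Algebra.IsIntegral R T]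
    {P : Ideal R} {s : Finset (Ideal T)} {Q : Ideal T} [hQ : Q.IsPrime]
    (hQP : Q.comap (algebraMap R T) = P)
    (hs : ∀ Q' ∈ s, Q'.IsPrime ∧ Q'.comap (algebraMap R T) = P) (hQs : Q ∉ s) :
    ¬ s.inf id ≤ Q := by
  rw [Ideal.IsPrime.inf_le' hQ]
  rintro ⟨Q', hQ', hle⟩
  have := (hs Q' hQ').1
  have hlt : Q' < Q := lt_of_le_of_ne hle (by rintro rfl; exact hQs hQ')
  exact (Ideal.IsIntegral.comap_lt_comap (R := R) hlt).ne ((hs Q' hQ').2.trans hQP.symm)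

lemma card_le_relLength {T : Type*} [CommRing T] [Algebra R T] [Algebra.IsIntegral R T]
    (P : Ideal R) [P.IsPrime] (s : Finset (Ideal T))
    (hs : ∀ Q ∈ s, Q.IsPrime ∧ Q.comap (algebraMap R T) = P) :
    (s.card : ℕ∞) ≤ relLength P ((s.inf id).restrictScalars R) ⊤ := by
  classical
  induction s using Finset.induction_on with
  | empty => simp
  | insert Q s hQs ih =>
    have hQ := hs Q (Finset.mem_insert_self _ _)
    have := hQ.1
    have hs' := fun Q' hQ' => hs Q' (Finset.mem_insert_of_mem hQ')
    rw [Finset.card_insert_of_notMem hQs, Finset.inf_insert,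
      relLength_eq_add P (V := (s.inf id).restrictScalars R)
        (inf_le_right : id Q ⊓ s.inf id ≤ s.inf id) le_top,
      add_comm (relLength _ _ _), Nat.cast_add, Nat.cast_one]
    refine add_le_add (ih hs') ?_
    rw [Order.one_le_iff_pos, relLength_pos_iff]
    obtain ⟨v, hv, hvQ⟩ := SetLike.not_le_iff_exists.1 (inf_not_le_of_comap_eq hQ.2 hs' hQs)
    refine ⟨v, hv, fun r hr h => ?_⟩
    have h : r • v ∈ Q := h.1
    rw [Algebra.smul_def] at h
    exact (this.mem_or_mem h).elim (fun h => hr (hQ.2 ▸ h)) hvQ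

lemma exists_mem_inf_iff_isIntegral (R₁ : Subalgebra R S) [Algebra.IsIntegral R R₁]
    (P : Ideal R) (s : Finset (Ideal R₁))
    (hs : ∀ Q ∈ s, Q.IsPrime ∧ Q.comap (algebraMap R R₁) = P)
    (hy : ∀ Q ∈ s, ∃ y : S, ∀ a : R₁, a ∈ Q ↔ IsIntegral R (a * y)) :
    ∃ x : S, ∀ a : R₁, a ∈ s.inf id ↔ IsIntegral R (a * x) := by
  classical
  have hint (a : R₁) : IsIntegral R (a : S) :=
    (Algebra.IsIntegral.isIntegral (R := R) a).map R₁.val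
  have he : ∀ Q ∈ s, ∃ e : R₁, e ∈ (s.erase Q).inf id ∧ e ∉ Q := fun Q hQ =>
    have := (hs Q hQ).1
    SetLike.not_le_iff_exists.1 (inf_not_le_of_comap_eq (hs Q hQ).2
      (fun Q' hQ' => hs Q' (Finset.mem_of_mem_erase hQ')) (Finset.notMem_erase Q s))
  choose! y hy using hy
  choose! e he heQ using he
  have he' : ∀ Q ∈ s, ∀ Q' ∈ s, Q' ≠ Q → e Q ∈ Q' := fun Q hQ Q' hQ' hne =>
    Finset.inf_le (f := id) (Finset.mem_erase.2 ⟨hne, hQ'⟩) (he Q hQ)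
  refine ⟨∑ Q ∈ s, e Q * y Q, fun a => ⟨fun ha => ?_, fun ha => ?_⟩⟩
  · rw [Finset.mul_sum]
    refine IsIntegral.sum _ fun Q hQ => ?_
    rw [mul_left_comm]
    exact (hint _).mul ((hy Q hQ a).1 (Finset.inf_le (f := id) hQ ha))
  · rw [Submodule.mem_finsetInf]
    intro Q hQ
    have hsum : IsIntegral R (∑ Q' ∈ s.erase Q, (e Q * a : S) * (e Q' * y Q')) := by
      refine IsIntegral.sum _ fun Q' hQ' => ?_
      obtain ⟨hne, hQ'⟩ := Finset.mem_erase.1 hQ'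
      have h1 := (hy Q' hQ' (e Q)).1 (he' Q hQ Q' hQ' hne)
      convert ((hint a).mul (hint (e Q'))).mul h1 using 1
      ring
    have h2 := ((hint (e Q)).mul ha).sub hsum
    rw [← mul_assoc, ← Finset.add_sum_erase s _ hQ, mul_add, Finset.mul_sum,
      add_sub_cancel_right] at h2
    have h3 : e Q * a * e Q ∈ Q := (hy Q hQ _).2 (by
      convert h2 using 1
      rw [Subalgebra.coe_mul, Subalgebra.coe_mul]
      ring)
    have := (hs Q hQ).1
    exact ((this.mem_or_mem h3).resolve_right (heQ Q hQ) |> this.mem_or_mem).resolve_left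
      (heQ Q hQ)

lemma card_le_torsionLength [IsNoetherianRing R] {t : R} (P : Ideal R) [P.IsPrime]
    (ht : ∀ x : S, t • x = 0 → x = 0) (hS : ∀ x : S, ∃ k, t ^ k • x ∈ (1 : Submodule R S))
    (htP : t ∈ P) (R₁ : Subalgebra R S) [Module.Finite R R₁] (s : Finset (Ideal R₁))
    (hs : ∀ Q ∈ s, Q.IsPrime ∧ Q.comap (algebraMap R R₁) = P)
    (hy : ∀ Q ∈ s, ∃ y : S, ∀ a : R₁, a ∈ Q ↔ IsIntegral R (a * y)) :
    (s.card : ℕ∞) ≤ torsionLength S t P := by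
  obtain ⟨x, hx⟩ := exists_mem_inf_iff_isIntegral R₁ P s hs hy
  refine (card_le_relLength P s hs).trans
    (relLength_le_torsionLength P ht hS htP R₁ hx fun c hc => ?_)
  rw [Submodule.mem_finsetInf]
  exact fun Q hQ => ((hs Q hQ).2 ▸ hc : c ∈ Q.comap (algebraMap R R₁))

lemma exists_card_le [IsNoetherianRing R] (t : R) (hinj : Function.Injective (algebraMap R S))
    (ht : ∀ x : S, t • x = 0 → x = 0) (hS : ∀ x : S, ∃ k, t ^ k • x ∈ (1 : Submodule R S)) :
    ∃ L : ℕ, ∀ (R₁ : Subalgebra R S) [Module.Finite R R₁] (s : Finset (Ideal R₁)),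
      (∀ Q ∈ s, Q.IsPrime ∧ ∃ y : S, ∀ a : R₁, a ∈ Q ↔ IsIntegral R (a * y)) → s.card ≤ L := by
  classical
  have hfin := associatedPrimes.finite R (R ⧸ Ideal.span {t})
  have := hfin.to_subtype
  obtain ⟨n, hn⟩ := (Set.finite_range fun P : associatedPrimes R (R ⧸ Ideal.span {t}) =>
    (torsionLength S t P.1).toNat).bddAbove
  refine ⟨n * hfin.toFinset.card, fun R₁ _ s hs => ?_⟩
  have key : ∀ Q ∈ s, Q.comap (algebraMap R R₁) ∈ associatedPrimes R (R ⧸ Ideal.span {t}) ∧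
      (s.filter fun Q' => Q'.comap (algebraMap R R₁) = Q.comap (algebraMap R R₁)).card ≤ n := by
    intro Q hQ
    obtain ⟨hQp, y, hy⟩ := hs Q hQ
    have htQ : t ∈ Q.comap (algebraMap R R₁) := by
      obtain ⟨k, hk⟩ := hS y
      obtain ⟨b, hb⟩ := Submodule.mem_one.1 hk
      refine hQp.mem_of_pow_mem k ?_
      rw [hy, ← map_pow, Subalgebra.coe_algebraMap, ← Algebra.smul_def, ← hb]
      exact isIntegral_algebraMap
    have hle := card_le_torsionLength (Q.comap (algebraMap R R₁)) ht hS htQ R₁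
      (s.filter fun Q' => Q'.comap (algebraMap R R₁) = Q.comap (algebraMap R R₁))
      (fun Q' h => ⟨(hs Q' (Finset.mem_filter.1 h).1).1, (Finset.mem_filter.1 h).2⟩)
      (fun Q' h => (hs Q' (Finset.mem_filter.1 h).1).2)
    have hass := mem_associatedPrimes_of_torsionLength_pos (S := S)
      (Q.comap (algebraMap R R₁)) ht hinj (lt_of_lt_of_le (by
        rw [Nat.cast_pos, Finset.card_pos]
        exact ⟨Q, Finset.mem_filter.2 ⟨hQ, rfl⟩⟩) hle)
    refine ⟨hass, le_trans ?_ (hn ⟨⟨_, hass⟩, rfl⟩)⟩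
    exact ENat.natCast_le_natCast.1
      (hle.trans_eq (ENat.natCast_toNat (torsionLength_ne_top _ ht)).symm)
  refine (Finset.card_le_mul_card_image (f := fun Q : Ideal R₁ => Q.comap (algebraMap R R₁)) s n
    fun P hP => ?_).trans (Nat.mul_le_mul_left n (Finset.card_le_card fun P hP => ?_))
  · obtain ⟨Q, hQ, rfl⟩ := Finset.mem_image.1 hP
    exact (key Q hQ).2
  · obtain ⟨Q, hQ, rfl⟩ := Finset.mem_image.1 hP
    exact hfin.mem_toFinset.2 (key Q hQ).1

end fibers

section reesAlgebra

variable {A B : Type*} [CommRing A] [CommRing B] [Algebra A B]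

/-- The extended Rees algebra, inside `B[X]`, of the filtration of `B` by degree in the
generators `G`. -/
noncomputable def reesSubalgebra (A : Type*) {B : Type*} [CommRing A] [CommRing B] [Algebra A B]
    (G : Finset B) : Subalgebra A B[X] :=
  Algebra.adjoin A (insert X ((fun b => C b * X) '' (G : Set B)))

lemma X_mem_reesSubalgebra (G : Finset B) : (X : B[X]) ∈ reesSubalgebra A G :=
  Algebra.subset_adjoin (Set.mem_insert _ _)

lemma isNoetherianRing_reesSubalgebra [IsNoetherianRing A] (G : Finset B) :
    IsNoetherianRing (reesSubalgebra A G) := by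
  classical
  have : Algebra.FiniteType A (reesSubalgebra A G) := by
    rw [← Subalgebra.fg_iff_finiteType]
    exact Subalgebra.fg_def.2 ⟨_, (G.finite_toSet.image _).insert _, rfl⟩
  exact Algebra.FiniteType.isNoetherianRing A _

lemma exists_mul_X_pow_mem_reesSubalgebra {G : Finset B}
    (hG : Algebra.adjoin A (G : Set B) = ⊤) (p : B[X]) : ∃ k, X ^ k * p ∈ reesSubalgebra A G := by
  have hX := X_mem_reesSubalgebra (A := A) G
  have mono {p : B[X]} {k l : ℕ} (h : X ^ k * p ∈ reesSubalgebra A G) :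
      X ^ (k + l) * p ∈ reesSubalgebra A G := by
    rw [add_comm, pow_add, mul_assoc]
    exact mul_mem (pow_mem hX _) h
  have hadd {p q : B[X]} (hp : ∃ k, X ^ k * p ∈ reesSubalgebra A G)
      (hq : ∃ k, X ^ k * q ∈ reesSubalgebra A G) : ∃ k, X ^ k * (p + q) ∈ reesSubalgebra A G := by
    obtain ⟨k, hk⟩ := hp
    obtain ⟨l, hl⟩ := hq
    refine ⟨k + l, ?_⟩
    rw [mul_add]
    exact add_mem (mono hk) (add_comm k l ▸ mono hl)
  have hC (b : B) : ∃ k, X ^ k * C b ∈ reesSubalgebra A G := by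
    have hb : b ∈ Algebra.adjoin A (G : Set B) := hG ▸ Algebra.mem_top
    induction hb using Algebra.adjoin_induction with
    | mem b hb =>
      refine ⟨1, ?_⟩
      rw [pow_one, mul_comm]
      exact Algebra.subset_adjoin (Set.mem_insert_of_mem _ ⟨b, hb, rfl⟩)
    | algebraMap a =>
      refine ⟨0, ?_⟩
      rw [pow_zero, one_mul]
      exact (reesSubalgebra A G).algebraMap_mem a
    | add b c _ _ hb hc => simpa only [map_add] using hadd hb hc
    | mul b c _ _ hb hc =>
      obtain ⟨k, hk⟩ := hb
      obtain ⟨l, hl⟩ := hc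
      refine ⟨k + l, ?_⟩
      rw [map_mul, pow_add, mul_mul_mul_comm]
      exact mul_mem hk hl
  induction p using Polynomial.induction_on' with
  | add p q hp hq => exact hadd hp hq
  | monomial n b =>
    obtain ⟨k, hk⟩ := hC b
    refine ⟨k, ?_⟩
    rw [← C_mul_X_pow_eq_monomial, ← mul_assoc]
    exact mul_mem hk (pow_mem hX _)

lemma isIntegral_reesSubalgebra_C_iff {G : Finset B} {b : B} :
    IsIntegral (reesSubalgebra A G) (C b) ↔ IsIntegral A b := by
  constructor
  · intro h
    have hle : reesSubalgebra A G ≤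
        (⊥ : Subalgebra A B).comap ((aeval (0 : B)).restrictScalars A) := by
      refine Algebra.adjoin_le ?_
      rintro _ (rfl | ⟨b, _, rfl⟩) <;> simpa using ⟨0, map_zero (algebraMap A B)⟩
    have h1 : IsIntegral (⊥ : Subalgebra A B) b := by
      have := IsIntegral.map_of_comp_eq
        (((((aeval (0 : B)).restrictScalars A).comp (reesSubalgebra A G).val).codRestrict ⊥
          fun p => hle p.2).toRingHom) (evalRingHom (0 : B))
        (by ext p; exact congrFun (coe_aeval_eq_eval (0 : B)) p.1) h
      simpa using this
    exact isIntegral_trans (R := A) (A := (⊥ : Subalgebra A B)) _ h1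
  · intro h
    exact (h.map (CAlgHom (R := A) (A := B))).tower_top

end reesAlgebra

lemma exists_colon_comap_eq {R M T : Type*} [CommRing R] [IsNoetherianRing R] [AddCommGroup M]
    [Module R M] [CommRing T] (φ : T →+* R) (N : Submodule R M) (x : M) {p : Ideal T}
    [hp : p.IsPrime] (h : p = ((N.colon {x}).comap φ).radical) :
    ∃ Q : Ideal R, Q.IsPrime ∧ Q.comap φ = p ∧ ∃ y, Q = N.colon {y} := by
  have hmin : p ∈ ((N.colon {x}).comap φ).minimalPrimes := by
    rw [← Ideal.radical_minimalPrimes, ← h, Ideal.minimalPrimes_eq_subsingleton_self]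
    rfl
  obtain ⟨Q, hQ, hQp⟩ := Ideal.exists_minimalPrimes_comap_eq φ p hmin
  exact ⟨Q, hQ.isPrime, hQp, Submodule.exists_eq_colon_of_mem_minimalPrimes hQ⟩

/-- The elements of `S` that are integral over `R`, as a submodule over a subalgebra of integral
elements. -/
def integralSubmodule {R S : Type*} [CommRing R] [CommRing S] [Algebra R S]
    (R₁ : Subalgebra R S) [Algebra.IsIntegral R R₁] : Submodule R₁ S where
  carrier := {y | IsIntegral R y}
  zero_mem' := isIntegral_zero
  add_mem' := IsIntegral.add
  smul_mem' a _ hy := ((Algebra.IsIntegral.isIntegral (R := R) a).map R₁.val).mul hy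

lemma mem_colon_integralSubmodule {R S : Type*} [CommRing R] [CommRing S] [Algebra R S]
    {R₁ : Subalgebra R S} [Algebra.IsIntegral R R₁] {x : S} {a : R₁} :
    a ∈ (integralSubmodule R₁).colon {x} ↔ IsIntegral R (a * x) :=
  Submodule.mem_colon_singleton

lemma exists_integral_conductor_comap_eq {R S T : Type*} [CommRing R] [CommRing S] [Algebra R S]
    {R₁ : Subalgebra R S} [Algebra.IsIntegral R R₁] [IsNoetherianRing R₁] [CommRing T]
    (φ : T →+* R₁) (x : S) {p I : Ideal T} [p.IsPrime]
    (hI : ∀ b, b ∈ I ↔ IsIntegral R (φ b * x)) (hp : p = I.radical) :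
    ∃ Q : Ideal R₁, (Q.IsPrime ∧ ∃ y : S, ∀ a : R₁, a ∈ Q ↔ IsIntegral R (a * y)) ∧
      Q.comap φ = p := by
  have hcolon : I = ((integralSubmodule R₁).colon {x}).comap φ := by
    ext b
    rw [Ideal.mem_comap, mem_colon_integralSubmodule, hI]
  obtain ⟨Q, hQp, hQc, y, hy⟩ := exists_colon_comap_eq φ (integralSubmodule R₁) x (hcolon ▸ hp)
  exact ⟨Q, ⟨hQp, y, fun a => by rw [hy, mem_colon_integralSubmodule]⟩, hQc⟩

theorem finite_setOf_radical_integral_conductor {A B D : Type*} [CommRing A] [CommRing B]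
    [CommRing D] [IsNoetherianRing A] [Algebra A B] [Algebra.FiniteType A B] (g : D →+* B)
    (hg : ∀ d, IsIntegral A (g d)) :
    {q : Ideal D | q.IsPrime ∧ ∃ (x : B) (I : Ideal D),
      (∀ d, d ∈ I ↔ IsIntegral A (g d * x)) ∧ q = I.radical}.Finite := by
  classical
  obtain ⟨G, hG⟩ := (Algebra.FiniteType.out : (⊤ : Subalgebra A B).FG)
  have := isNoetherianRing_reesSubalgebra (A := A) G
  let t : reesSubalgebra A G := ⟨X, X_mem_reesSubalgebra G⟩
  obtain ⟨L, hL⟩ := exists_card_le (S := B[X]) t Subtype.val_injective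
    (fun p hp => by
      have hp : X * p = 0 := hp
      exact Polynomial.isRegular_X.left (hp.trans (mul_zero X).symm))
    (fun p => by
      obtain ⟨k, hk⟩ := exists_mul_X_pow_mem_reesSubalgebra hG p
      exact ⟨k, Submodule.mem_one.2 ⟨⟨_, hk⟩, rfl⟩⟩)
  by_contra hinf
  obtain ⟨s, hs, hcard⟩ := Set.Infinite.exists_subset_card_eq hinf (L + 1)
  have hsep : ∀ q ∈ s, ∀ q' ∈ s, q ≠ q' → ∃ d, ¬ (d ∈ q ↔ d ∈ q') := fun q _ q' _ hne => by
    by_contra! h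
    exact hne (Ideal.ext h)
  choose! d hd using hsep
  let F : Finset B[X] := (s ×ˢ s).image fun z => C (g (d z.1 z.2))
  have hint (b : D) : IsIntegral (reesSubalgebra A G) (C (g b)) :=
    isIntegral_reesSubalgebra_C_iff.2 (hg b)
  let R₁ : Subalgebra (reesSubalgebra A G) B[X] := Algebra.adjoin _ (F : Set B[X])
  have : Module.Finite (reesSubalgebra A G) R₁ :=
    ⟨(Submodule.fg_top _).2 (fg_adjoin_of_finite F.finite_toSet fun y hy => by
      obtain ⟨z, _, rfl⟩ := Finset.mem_image.1 (Finset.mem_coe.1 hy)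
      exact hint _)⟩
  have : IsNoetherianRing R₁ := IsNoetherianRing.of_finite (reesSubalgebra A G) R₁
  let D₁ : Subring D := R₁.toSubring.comap ((C : B →+* B[X]).comp g)
  have hdmem : ∀ q ∈ s, ∀ q' ∈ s, d q q' ∈ D₁ := fun q hq q' hq' =>
    Algebra.subset_adjoin (Finset.mem_coe.2
      (Finset.mem_image.2 ⟨(q, q'), Finset.mk_mem_product hq hq', rfl⟩))
  let φ : D₁ →+* R₁ := (((C : B →+* B[X]).comp g).comp D₁.subtype).codRestrict R₁ fun b => b.2
  have hQ : ∀ q ∈ s, ∃ Q : Ideal R₁, (Q.IsPrime ∧ ∃ y : B[X], ∀ a : R₁,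
      a ∈ Q ↔ IsIntegral (reesSubalgebra A G) (a * y)) ∧ Q.comap φ = q.comap D₁.subtype := by
    intro q hq
    obtain ⟨hqp, x, I, hI, hqI⟩ := hs hq
    refine exists_integral_conductor_comap_eq φ (C x) (I := I.comap D₁.subtype) (fun b => ?_) ?_
    · rw [Ideal.mem_comap, hI, ← isIntegral_reesSubalgebra_C_iff (G := G), C_mul]
      rfl
    · rw [hqI, Ideal.comap_radical]
  choose! Q hQ hQc using hQ
  have hinj : Set.InjOn Q s := fun q hq q' hq' h => by
    by_contra hne
    have hcomap : q.comap D₁.subtype = q'.comap D₁.subtype := by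
      rw [← hQc q hq, ← hQc q' hq', h]
    exact hd q hq q' hq' hne (Ideal.ext_iff.1 hcomap ⟨_, hdmem q hq q' hq'⟩)
  have hle := hL R₁ (s.image Q) fun Q' hQ' => by
    obtain ⟨q, hq, rfl⟩ := Finset.mem_image.1 hQ'
    exact hQ q hq
  rw [Finset.card_image_of_injOn hinj, hcard] at hle
  lia

/-- Let `𝒜` be Noetherian, `ℬ` a finitely generated `𝒜`-algebra containing
`𝒜`, `𝒜̄` the integral closure of `𝒜` in `ℬ`.  Suppose every minimal prime of `ℬ` contracts
to a minimal prime of `𝒜` and the localization map `𝒜_𝔭 → 𝒜̄_𝔭` is an isomorphism for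
every minimal prime `𝔭` of `𝒜`.  Then `Ass_𝒜(ℬ/𝒜̄)` and `Ass_𝒜̄(ℬ/𝒜̄)` are finite. -/
theorem assPrimes_integralClosure_finite (A B : Type*)
    [CommRing A] [CommRing B] [IsNoetherianRing A] [Algebra A B]
    (hinj : Function.Injective (algebraMap A B))
    (hfg : Algebra.FiniteType A B)
    (hminB : ∀ Q ∈ minimalPrimes B, Q.comap (algebraMap A B) ∈ minimalPrimes A)
    (hloc : ∀ (p : Ideal A) (hp : p ∈ minimalPrimes A),
      haveI : p.IsPrime := hp.1.1
      Function.Bijective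
        (IsLocalization.map
          (Localization (Algebra.algebraMapSubmonoid (integralClosure A B) p.primeCompl))
          (algebraMap A (integralClosure A B))
          (show p.primeCompl ≤
              (Algebra.algebraMapSubmonoid (integralClosure A B) p.primeCompl).comap _ from
            p.primeCompl.le_comap_map) :
          Localization.AtPrime p →+* _)) :
    (associatedPrimes A (B ⧸ Subalgebra.toSubmodule (integralClosure A B))).Finite ∧
    (associatedPrimes (integralClosure A B)
      (B ⧸ LinearMap.range (Algebra.linearMap (integralClosure A B) B))).Finite := by
  constructor
  · refine (finite_setOf_radical_integral_conductor (algebraMap A B)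
      fun a => isIntegral_algebraMap).subset ?_
    rintro p ⟨hp, x, hx⟩
    obtain ⟨b, rfl⟩ := Submodule.mkQ_surjective _ x
    refine ⟨hp, b, _, fun a => ?_, hx⟩
    rw [Submodule.mem_colon_singleton, Submodule.mem_bot, ← map_smul, Submodule.mkQ_apply,
      Submodule.Quotient.mk_eq_zero, Algebra.smul_def]
    rfl
  · refine (finite_setOf_radical_integral_conductor (algebraMap (integralClosure A B) B)
      fun a => a.2).subset ?_
    rintro p ⟨hp, x, hx⟩
    obtain ⟨b, rfl⟩ := Submodule.mkQ_surjective _ x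
    refine ⟨hp, b, _, fun a => ?_, hx⟩
    rw [Submodule.mem_colon_singleton, Submodule.mem_bot, ← map_smul, Submodule.mkQ_apply,
      Submodule.Quotient.mk_eq_zero, Algebra.smul_def]
    exact ⟨fun ⟨y, hy⟩ => hy ▸ y.2, fun h => ⟨⟨_, h⟩, rfl⟩⟩
end

section
/- Let (R, 𝔪) be a local Noetherian domain of dimension d > 0. Let ℳ be a nonzero finitely generated R-module contained in a free module ℱ = R^k, let K be the fraction field of R, set e = rank(ℳ ⊗_R K), let ℛ(ℳ) ⊆ Sym(ℱ) be the Rees algebra of ℳ, let \overline{ℳⁿ} ⊆ ℱⁿ be the integral closure of the n-th graded piece of ℛ(ℳ) in the n-th graded piece of Sym(ℱ), and let ℓ(ℳ) = dim ℛ(ℳ)/𝔪ℛ(ℳ) be the analytic spread. If ℓ(ℳ) = d + e − 1, then 𝔪 ∈ Ass_R(ℱⁿ/\overline{ℳⁿ}) for some n, unless d = 1 and ℳ is a free module that is a direct summand of ℱ. -/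
open scoped TensorProduct

/-- The Rees algebra of a submodule `ℳ` of the free module `R^k`: the `R`-subalgebra of
`Sym(R^k) = R[y₁,…,y_k]` generated by the elements of `ℳ` viewed as linear forms. -/
noncomputable def modreesAlgebra (R : Type*) [CommRing R] {k : ℕ}
    (M : Submodule R (Fin k → R)) : Subalgebra R (MvPolynomial (Fin k) R) :=
  Algebra.adjoin R
    ((fun m => ∑ i, MvPolynomial.C (m i) * MvPolynomial.X i) '' (M : Set (Fin k → R)))

/-- The integral closure `\overline{ℳⁿ}` of the `n`-th graded piece of the Rees algebra of
`ℳ` inside the `n`-th graded piece `ℱⁿ` of `Sym(R^k)`: the elements of `ℱⁿ` (homogeneous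
polynomials of degree `n`) that are integral over the Rees algebra.  (This set is an
`R`-submodule of `ℱⁿ`; it is realised as an `R`-span, which adds nothing.) -/
noncomputable def modreesBar (R : Type*) [CommRing R] {k : ℕ}
    (M : Submodule R (Fin k → R)) (n : ℕ) :
    Submodule R ↥(MvPolynomial.homogeneousSubmodule (Fin k) R n) :=
  Submodule.span R {x : ↥(MvPolynomial.homogeneousSubmodule (Fin k) R n) |
    (x : MvPolynomial (Fin k) R) ∈
      integralClosure (modreesAlgebra R M) (MvPolynomial (Fin k) R)}

/-- The linear embedding of `R^k` into `R[y₁,…,y_k]` as the linear forms. -/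
noncomputable def linForm (R : Type*) [CommRing R] (k : ℕ) :
    (Fin k → R) →ₗ[R] MvPolynomial (Fin k) R :=
  Fintype.linearCombination R MvPolynomial.X

lemma linForm_apply {R : Type*} [CommRing R] {k : ℕ} (m : Fin k → R) :
    linForm R k m = ∑ i, MvPolynomial.C (m i) * MvPolynomial.X i := by
  simp [linForm, Fintype.linearCombination_apply, MvPolynomial.smul_eq_C_mul]

lemma linForm_isHomogeneous {R : Type*} [CommRing R] {k : ℕ} (m : Fin k → R) :
    (linForm R k m).IsHomogeneous 1 := by
  rw [linForm_apply]
  refine MvPolynomial.IsHomogeneous.sum _ _ _ fun i _ => ?_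
  simpa using (MvPolynomial.isHomogeneous_C (Fin k) (m i)).mul (MvPolynomial.isHomogeneous_X R i)

lemma modreesAlgebra_eq_adjoin {R : Type*} [CommRing R] {k : ℕ} (M : Submodule R (Fin k → R)) :
    modreesAlgebra R M = Algebra.adjoin R (linForm R k '' M) := by
  simp only [modreesAlgebra, ← linForm_apply]

lemma modreesAlgebra_span {R : Type*} [CommRing R] {k : ℕ} (s : Set (Fin k → R)) :
    modreesAlgebra R (Submodule.span R s) = Algebra.adjoin R (linForm R k '' s) := by
  rw [modreesAlgebra_eq_adjoin, ← Submodule.map_coe, Submodule.map_span, Algebra.adjoin_span]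

lemma linForm_mem_modreesAlgebra {R : Type*} [CommRing R] {k : ℕ} {M : Submodule R (Fin k → R)}
    {m : Fin k → R} (hm : m ∈ M) : linForm R k m ∈ modreesAlgebra R M := by
  rw [modreesAlgebra_eq_adjoin]
  exact Algebra.subset_adjoin ⟨m, hm, rfl⟩

lemma isNoetherianRing_modreesAlgebra {R : Type*} [CommRing R] [IsNoetherianRing R] {k : ℕ}
    {M : Submodule R (Fin k → R)} (hM : M.FG) : IsNoetherianRing (modreesAlgebra R M) := by
  classical
  obtain ⟨s, rfl⟩ := hM
  rw [modreesAlgebra_span, ← Finset.coe_image]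
  exact isNoetherianRing_of_fg ⟨_, rfl⟩

lemma homogeneousComponent_mem_modreesAlgebra {R : Type*} [CommRing R] {k : ℕ}
    (M : Submodule R (Fin k → R)) {h : MvPolynomial (Fin k) R} (hh : h ∈ modreesAlgebra R M)
    (n : ℕ) : MvPolynomial.homogeneousComponent n h ∈ modreesAlgebra R M := by
  rw [modreesAlgebra_eq_adjoin] at hh ⊢
  set A := Algebra.adjoin R (linForm R k '' M) with hA
  have key : h ∈ Subalgebra.toSubmodule A := hh
  rw [hA, Algebra.adjoin_eq_span] at key
  induction key using Submodule.span_induction with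
  | mem x hx =>
    obtain ⟨hxA, d, hd⟩ : x ∈ A ∧ ∃ d, x.IsHomogeneous d := by
      clear hh
      induction hx using Submonoid.closure_induction with
      | mem x hx =>
        refine ⟨Algebra.subset_adjoin hx, ?_⟩
        obtain ⟨m, -, rfl⟩ := hx
        exact ⟨1, linForm_isHomogeneous m⟩
      | one => exact ⟨one_mem _, 0, MvPolynomial.isHomogeneous_one _ _⟩
      | mul x y _ _ hx hy =>
        exact ⟨mul_mem hx.1 hy.1, _, hx.2.choose_spec.mul hy.2.choose_spec⟩
    rw [MvPolynomial.homogeneousComponent_of_mem hd]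
    split_ifs
    · exact hxA
    · exact zero_mem _
  | zero => simp
  | add x y hx' hy' hx hy =>
    rw [← Algebra.adjoin_eq_span] at hx' hy'
    rw [map_add]
    exact add_mem (hx hx') (hy hy')
  | smul a x hx' hx =>
    rw [← Algebra.adjoin_eq_span] at hx'
    rw [map_smul]
    exact Subalgebra.smul_mem _ (hx hx') a

lemma isIntegral_of_mem_modreesBar {R : Type*} [CommRing R] {k : ℕ} {M : Submodule R (Fin k → R)}
    {n : ℕ} {s : MvPolynomial.homogeneousSubmodule (Fin k) R n} (hs : s ∈ modreesBar R M n) :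
    IsIntegral (modreesAlgebra R M) (s : MvPolynomial (Fin k) R) := by
  induction hs using Submodule.span_induction with
  | mem x hx => exact hx
  | zero => exact isIntegral_zero
  | add x y _ _ hx hy => exact hx.add hy
  | smul a x _ hx =>
    have : ((a • x : MvPolynomial.homogeneousSubmodule (Fin k) R n) : MvPolynomial (Fin k) R) =
      algebraMap (modreesAlgebra R M) _ (algebraMap R _ a) * x := by
      rw [← IsScalarTower.algebraMap_apply, ← Algebra.smul_def]; rfl
    rw [this]
    exact isIntegral_algebraMap.mul hx

/-- If the maximal ideal is not associated to any `ℱⁿ/\overline{ℳⁿ}`, then homogeneous elements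
which are integral up to a power of the maximal ideal are integral. -/
lemma isIntegral_of_forall_mem_pow {R : Type*} [CommRing R] [IsLocalRing R] {k : ℕ}
    {M : Submodule R (Fin k → R)}
    (hM : ∀ n, IsLocalRing.maximalIdeal R ∉ associatedPrimes R
      (MvPolynomial.homogeneousSubmodule (Fin k) R n ⧸ modreesBar R M n))
    {n : ℕ} {s : MvPolynomial (Fin k) R} (hs : s.IsHomogeneous n) (N : ℕ)
    (h : ∀ c ∈ IsLocalRing.maximalIdeal R ^ N, MvPolynomial.C c * s ∈ modreesAlgebra R M) :
    IsIntegral (modreesAlgebra R M) s := by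
  suffices H : ∀ (N : ℕ) (s : MvPolynomial.homogeneousSubmodule (Fin k) R n),
      (∀ c ∈ IsLocalRing.maximalIdeal R ^ N, c • s ∈ modreesBar R M n) → s ∈ modreesBar R M n by
    refine isIntegral_of_mem_modreesBar (H N ⟨s, hs⟩ fun c hc => Submodule.subset_span ?_)
    have := h c hc
    rw [← MvPolynomial.smul_eq_C_mul] at this
    exact isIntegral_algebraMap (x := (⟨_, this⟩ : modreesAlgebra R M))
  intro N
  induction N with
  | zero => intro s hs; simpa using hs 1 (by simp)
  | succ N ih =>
    intro s hs
    refine ih s fun c hc => ?_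
    by_contra hcs
    refine hM n ((AssociatedPrimes.mem_iff).2 ⟨inferInstance, Submodule.Quotient.mk (c • s), ?_⟩)
    have hcol : Submodule.colon (⊥ : Submodule R (MvPolynomial.homogeneousSubmodule (Fin k) R n ⧸
        modreesBar R M n)) {Submodule.Quotient.mk (c • s)} = IsLocalRing.maximalIdeal R := by
      refine ((IsLocalRing.maximalIdeal.isMaximal R).eq_of_le ?_ ?_).symm
      · rw [Ne, Ideal.eq_top_iff_one, Submodule.mem_colon_singleton, one_smul, Submodule.mem_bot,
          Submodule.Quotient.mk_eq_zero]
        exact hcs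
      · intro a ha
        rw [Submodule.mem_colon_singleton, Submodule.mem_bot, ← Submodule.Quotient.mk_smul,
          Submodule.Quotient.mk_eq_zero, smul_smul]
        refine hs _ ?_
        rw [pow_succ']
        exact Ideal.mul_mem_mul ha hc
    rw [hcol]
    exact (Ideal.IsPrime.radical inferInstance).symm

lemma ringKrullDim_adjoin_singleton_le {B L : Type*} [CommRing B] [IsNoetherianRing B] [IsDomain B]
    [CommRing L] [Algebra B L] {d : ℕ} (hB : ringKrullDim B ≤ d)
    {t : L} {p : Polynomial B} (hp : p ≠ 0) (hpt : Polynomial.aeval t p = 0)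
    (C : Subalgebra B L) (hC : C = Algebra.adjoin B {t}) : ringKrullDim C ≤ d := by
  rw [Algebra.adjoin_singleton_eq_range_aeval] at hC
  subst hC
  have h1 : ringKrullDim (Polynomial.aeval (R := B) t).range + 1 ≤ ringKrullDim (Polynomial B) :=
    ringKrullDim_succ_le_of_surjective (Polynomial.aeval (R := B) t).rangeRestrict.toRingHom
      (Polynomial.aeval (R := B) t).rangeRestrict_surjective (mem_nonZeroDivisors_of_ne_zero hp)
      (Subtype.ext hpt)
  rw [Polynomial.ringKrullDim_of_isNoetherianRing] at h1
  exact ENat.WithBot.add_le_add_one_right_iff.1 (h1.trans (by gcongr))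

lemma ringKrullDim_adjoin_range_union_le {R L : Type*} [CommRing R] [IsNoetherianRing R]
    [CommRing L] [IsDomain L] [Algebra R L] {d e : ℕ} (hR : ringKrullDim R = d) (b : Fin e → L)
    (s : Finset L)
    (hs : ∀ t ∈ s, ∃ c : R, algebraMap R L c ≠ 0 ∧ c • t ∈ Submodule.span R (Set.range b)) :
    ringKrullDim (Algebra.adjoin R (Set.range b ∪ s)) ≤ (d + e : ℕ) := by
  classical
  induction s using Finset.induction_on with
  | empty =>
    rw [Finset.coe_empty, Set.union_empty, Algebra.adjoin_range_eq_range_aeval]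
    refine (ringKrullDim_le_of_surjective (MvPolynomial.aeval (R := R) b).rangeRestrict.toRingHom
      (MvPolynomial.aeval (R := R) b).rangeRestrict_surjective).trans ?_
    rw [MvPolynomial.ringKrullDim_of_isNoetherianRing, hR]
    simp
  | insert t s ht ih =>
    have ih := ih fun t ht => hs t (Finset.mem_insert_of_mem ht)
    obtain ⟨c, hc, hct⟩ := hs t (Finset.mem_insert_self t s)
    rw [Finset.coe_insert, Set.insert_eq, Set.union_comm {t}, ← Set.union_assoc,
      Algebra.adjoin_union_eq_adjoin_adjoin]
    set A := Algebra.adjoin R (Set.range b ∪ s) with hA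
    have hfin : IsNoetherianRing A := by
      refine isNoetherianRing_of_fg ⟨Finset.univ.image b ∪ s, ?_⟩
      simp [hA]
    have hctA : c • t ∈ A := by
      have : Submodule.span R (Set.range b) ≤ Subalgebra.toSubmodule A :=
        Submodule.span_le.2 (Set.subset_union_left.trans Algebra.subset_adjoin)
      exact this hct
    refine ringKrullDim_adjoin_singleton_le ih (t := t)
      (p := Polynomial.C (algebraMap R A c) * Polynomial.X - Polynomial.C ⟨_, hctA⟩) ?_ ?_
      (Algebra.adjoin A {t}) rfl
    · intro h
      have := congrArg (fun q => ((q.coeff 1 : A) : L)) h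
      simp [Polynomial.coeff_C] at this
      exact hc this
    · simp [Algebra.smul_def, ← IsScalarTower.algebraMap_apply]

lemma exists_smul_mem_span_of_finrank {R N : Type*} [CommRing R] [IsDomain R] [AddCommGroup N]
    [Module R N] [Module.Finite R N] :
    ∃ b : Fin (Module.finrank R N) → N,
      ∀ m : N, ∃ c : R, c ≠ 0 ∧ c • m ∈ Submodule.span R (Set.range b) := by
  obtain ⟨b, hb⟩ := exists_linearIndependent_of_le_finrank (R := R) (M := N) le_rfl
  refine ⟨b, fun m => ?_⟩
  by_contra! hm
  have : LinearIndependent R (Fin.cons m b : Fin (Module.finrank R N + 1) → N) := by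
    refine LinearIndependent.finCons' m b hb fun c y hy hcy => ?_
    by_contra hc
    refine hm c hc ?_
    rw [eq_neg_of_add_eq_zero_left hcy]
    exact neg_mem hy
  simpa using this.fintype_card_le_finrank

lemma ringKrullDim_modreesAlgebra_le {R : Type*} [CommRing R] [IsDomain R] [IsNoetherianRing R]
    {d : ℕ} (hd : ringKrullDim R = d) {k : ℕ} (M : Submodule R (Fin k → R)) :
    ringKrullDim (modreesAlgebra R M) ≤ (d + Module.finrank R M : ℕ) := by
  classical
  obtain ⟨s, hs⟩ := IsNoetherian.noetherian M
  obtain ⟨b, hb⟩ := exists_smul_mem_span_of_finrank (R := R) (N := M)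
  have key : modreesAlgebra R M = Algebra.adjoin R
      (Set.range (fun i => linForm R k (b i)) ∪ (s.image (linForm R k) : Finset _)) := by
    apply le_antisymm
    · refine (congrArg (modreesAlgebra R) hs.symm).le.trans ?_
      rw [modreesAlgebra_span, Finset.coe_image]
      exact Algebra.adjoin_mono Set.subset_union_right
    · refine Algebra.adjoin_le (Set.union_subset ?_ ?_)
      · rintro _ ⟨i, rfl⟩
        exact linForm_mem_modreesAlgebra (b i).2
      · rw [Finset.coe_image]
        rintro _ ⟨m, hm, rfl⟩
        exact linForm_mem_modreesAlgebra (hs ▸ Submodule.subset_span hm)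
  rw [key]
  refine ringKrullDim_adjoin_range_union_le hd _ _ fun t ht => ?_
  obtain ⟨m, hm, rfl⟩ := Finset.mem_image.1 ht
  obtain ⟨c, hc, hcm⟩ := hb ⟨m, hs ▸ Submodule.subset_span hm⟩
  refine ⟨c, by simpa using hc, ?_⟩
  have := Submodule.mem_map_of_mem (f := linForm R k ∘ₗ M.subtype) hcm
  rw [Submodule.map_span, ← Set.range_comp] at this
  rw [map_smul] at this
  exact this

/-- If `dim A ≤ dim A/I + 1`, then `I` lies in a prime of height at most one. -/
lemma exists_isPrime_le_of_ringKrullDim_quotient {A : Type*} [CommRing A] [IsDomain A]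
    {I : Ideal A} {n : ℕ} (hI : ringKrullDim (A ⧸ I) = n) (hA : ringKrullDim A ≤ (n + 1 : ℕ)) :
    ∃ P : Ideal A, P.IsPrime ∧ I ≤ P ∧ ∀ q : Ideal A, q.IsPrime → q < P → q = ⊥ := by
  obtain ⟨l, hl⟩ := Order.le_krullDim_iff.1 hI.ge
  have hmono : StrictMono (PrimeSpectrum.comap (Ideal.Quotient.mk I)) :=
    fun p q hpq => lt_of_le_of_ne (Ideal.comap_mono hpq.le) fun h => hpq.ne
      (PrimeSpectrum.comap_injective_of_surjective _ Ideal.Quotient.mk_surjective h)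
  refine ⟨(PrimeSpectrum.comap (Ideal.Quotient.mk I) l.head).asIdeal, inferInstance, ?_, ?_⟩
  · intro x hx
    simp [Ideal.Quotient.eq_zero_iff_mem.2 hx]
  · intro q hq hqP
    by_contra hq0
    have hlt : (⟨q, hq⟩ : PrimeSpectrum A) < (l.map _ hmono).head := hqP
    have hlt' : (⟨⊥, Ideal.isPrime_bot⟩ : PrimeSpectrum A) <
        ((l.map _ hmono).cons ⟨q, hq⟩ hlt).head := by
      rw [RelSeries.head_cons]
      exact (bot_lt_iff_ne_bot.2 hq0 : (⊥ : Ideal A) < q)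
    have := (Order.LTSeries.length_le_krullDim
      (((l.map _ hmono).cons ⟨q, hq⟩ hlt).cons _ hlt')).trans hA
    have h2 := Nat.cast_le.1 this
    simp [hl] at h2

lemma exists_notMem_mul_pow_mem_span_singleton {A : Type*} [CommRing A] {P : Ideal A}
    [hPp : P.IsPrime] (hP : ∀ q : Ideal A, q.IsPrime → q < P → q = ⊥) {x y : A} (hx : x ≠ 0)
    (hy : y ∈ P) : ∃ g ∉ P, ∃ n : ℕ, g * y ^ n ∈ Ideal.span {x} := by
  by_contra! h
  have hdisj : Disjoint (Ideal.span {x} : Set A)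
      (P.primeCompl ⊔ Submonoid.powers y : Submonoid A) := by
    rw [Set.disjoint_left]
    rintro _ hz hz'
    obtain ⟨g, hg, _, ⟨n, rfl⟩, rfl⟩ := Submonoid.mem_sup.1 hz'
    exact h g hg n hz
  obtain ⟨p, hp, hxp, hpd⟩ := Ideal.exists_le_prime_disjoint _ _ hdisj
  have hpP : p ≤ P := fun z hz => by
    by_contra hzP
    exact Set.disjoint_left.1 hpd hz ((le_sup_left : P.primeCompl ≤ _) hzP)
  have hyp : y ∉ p := fun hyp =>
    Set.disjoint_left.1 hpd hyp ((le_sup_right : Submonoid.powers y ≤ _) (Submonoid.mem_powers y))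
  have := hP p hp (lt_of_le_of_ne hpP fun h => hyp (h ▸ hy))
  subst this
  exact hx (by simpa using hxp (Ideal.mem_span_singleton_self x))

lemma exists_notMem_pow_mul_span_singleton_le {A : Type*} [CommRing A] [IsNoetherianRing A]
    {P : Ideal A} [hPp : P.IsPrime] (hP : ∀ q : Ideal A, q.IsPrime → q < P → q = ⊥) {x : A}
    (hx : x ≠ 0) : ∃ g ∉ P, ∃ N : ℕ, ∀ z ∈ P ^ N, z * g ∈ Ideal.span {x} := by
  classical
  let q : Ideal A :=
    { carrier := {z | ∃ g ∉ P, z * g ∈ Ideal.span {x}}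
      zero_mem' := ⟨1, fun h => hPp.ne_top ((Ideal.eq_top_iff_one _).2 h), by simp⟩
      add_mem' := by
        rintro z w ⟨g, hg, hz⟩ ⟨g', hg', hw⟩
        refine ⟨g * g', fun h => (hPp.mem_or_mem h).elim hg hg', ?_⟩
        rw [show (z + w) * (g * g') = g' * (z * g) + g * (w * g') by ring]
        exact add_mem (Ideal.mul_mem_left _ _ hz) (Ideal.mul_mem_left _ _ hw)
      smul_mem' := by
        rintro c z ⟨g, hg, hz⟩
        refine ⟨g, hg, ?_⟩
        rw [smul_eq_mul, mul_assoc]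
        exact Ideal.mul_mem_left _ _ hz }
  have hrad : P ≤ q.radical := fun y hy => by
    obtain ⟨g, hg, n, h⟩ := exists_notMem_mul_pow_mem_span_singleton hP hx hy
    exact ⟨n, g, hg, by rwa [mul_comm]⟩
  obtain ⟨N, hN⟩ := Ideal.exists_pow_le_of_le_radical_of_fg hrad (IsNoetherian.noetherian P)
  obtain ⟨s, hs⟩ := IsNoetherian.noetherian q
  have key : ∀ t : Finset A, (∀ z ∈ t, z ∈ q) →
      ∃ g ∉ P, ∀ z ∈ t, z * g ∈ Ideal.span {x} := by
    intro t
    induction t using Finset.induction_on with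
    | empty => exact fun _ => ⟨1, fun h => hPp.ne_top ((Ideal.eq_top_iff_one _).2 h), by simp⟩
    | insert z t _ ih =>
      intro ht
      obtain ⟨g, hg, h⟩ := ih fun z hz => ht z (Finset.mem_insert_of_mem hz)
      obtain ⟨g', hg', h'⟩ := ht z (Finset.mem_insert_self z t)
      refine ⟨g * g', fun h => (hPp.mem_or_mem h).elim hg hg', fun w hw => ?_⟩
      obtain rfl | hw := Finset.mem_insert.1 hw
      · rw [mul_left_comm]
        exact Ideal.mul_mem_left _ _ h'
      · rw [← mul_assoc]
        exact Ideal.mul_mem_right _ _ (h w hw)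
  obtain ⟨g, hg, h⟩ := key s fun z hz => hs ▸ Submodule.subset_span hz
  refine ⟨g, hg, N, fun z hz => ?_⟩
  have hle : q ≤ Submodule.comap (LinearMap.mulRight A g) (Ideal.span {x}) := by
    rw [← hs, Submodule.span_le]
    exact h
  exact hle (hN hz)

lemma mem_of_eq_mul_isIntegral {A S : Type*} [CommRing A] [CommRing S] [Algebra A S]
    (hinj : Function.Injective (algebraMap A S)) {P : Ideal A} [P.IsPrime] {x a : A} {t : S}
    (ha : a ∈ P) (ht : IsIntegral A t) (h : algebraMap A S x = algebraMap A S a * t) : x ∈ P := by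
  have hinj' : Function.Injective (algebraMap A (integralClosure A S)) := by
    refine Function.Injective.of_comp (f := algebraMap (integralClosure A S) S) ?_
    rwa [← RingHom.coe_comp, ← IsScalarTower.algebraMap_eq]
  obtain ⟨Q, -, hQ, hQP⟩ := Ideal.exists_ideal_over_prime_of_isIntegral
    (S := integralClosure A S) P ⊥ (by
      rw [← RingHom.ker_eq_comap_bot, (RingHom.injective_iff_ker_eq_bot _).1 hinj']
      exact bot_le)
  have hx : algebraMap A (integralClosure A S) x =
      algebraMap A (integralClosure A S) a * ⟨t, ht⟩ := Subtype.ext h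
  rw [← hQP, Ideal.mem_comap, hx]
  rw [← hQP] at ha
  exact Ideal.mul_mem_right _ _ ha

/-- If all coefficients of `g / a` are integral over `R`, then the powers of `g / a` have a common
denominator. -/
lemma exists_C_pow_dvd_C_mul_pow {R : Type*} [CommRing R] [IsDomain R] {σ : Type*}
    {g : MvPolynomial σ R} {a : R} (ha : a ≠ 0)
    (h : ∀ m, IsIntegral R (algebraMap R (FractionRing R) (g.coeff m) /
      algebraMap R (FractionRing R) a)) :
    ∃ b : R, b ≠ 0 ∧ ∀ n : ℕ, MvPolynomial.C (a ^ n) ∣ MvPolynomial.C b * g ^ n := by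
  classical
  set K := FractionRing R
  have ha' : algebraMap R K a ≠ 0 := by simpa using ha
  let G : MvPolynomial σ K := MvPolynomial.C (algebraMap R K a)⁻¹ *
    MvPolynomial.map (algebraMap R K) g
  have hG : ∀ m, G.coeff m = algebraMap R K (g.coeff m) / algebraMap R K a := fun m => by
    simp [G, MvPolynomial.coeff_map, div_eq_inv_mul]
  let B := Algebra.adjoin R (G.coeffs : Set K)
  have hB : (Subalgebra.toSubmodule B).FG := by
    refine fg_adjoin_of_finite G.coeffs.finite_toSet fun x hx => ?_
    obtain ⟨m, -, rfl⟩ := MvPolynomial.mem_coeffs_iff.1 hx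
    rw [hG]
    exact h m
  obtain ⟨s, hs⟩ := hB
  obtain ⟨b, hb⟩ := IsLocalization.exist_integer_multiples_of_finset (nonZeroDivisors R) s
  have hbB : ∀ y ∈ B, ∃ r : R, algebraMap R K r = algebraMap R K b * y := by
    intro y (hy : y ∈ Subalgebra.toSubmodule B)
    rw [← hs] at hy
    induction hy using Submodule.span_induction with
    | mem x hx =>
      obtain ⟨r, hr⟩ := hb x hx
      exact ⟨r, by rw [hr, Algebra.smul_def]⟩
    | zero => exact ⟨0, by simp⟩
    | add x y _ _ hx hy =>
      obtain ⟨r, hr⟩ := hx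
      obtain ⟨r', hr'⟩ := hy
      exact ⟨r + r', by rw [map_add, hr, hr', mul_add]⟩
    | smul c x _ hx =>
      obtain ⟨r, hr⟩ := hx
      exact ⟨c * r, by rw [map_mul, hr, Algebra.smul_def]; ring⟩
  obtain ⟨G', hG'⟩ : G ∈ Set.range (MvPolynomial.map (algebraMap B K)) := by
    rw [MvPolynomial.mem_range_map_iff_coeffs_subset]
    intro x hx
    exact ⟨⟨x, Algebra.subset_adjoin hx⟩, rfl⟩
  refine ⟨b, nonZeroDivisors.ne_zero b.2, fun n => ?_⟩
  rw [MvPolynomial.C_dvd_iff_dvd_coeff]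
  intro m
  obtain ⟨r, hr⟩ := hbB ((G ^ n).coeff m) (by
    rw [← hG', ← map_pow, MvPolynomial.coeff_map]
    exact ((G' ^ n).coeff m).2)
  refine ⟨r, IsFractionRing.injective R K ?_⟩
  have hGn : (G ^ n).coeff m = (algebraMap R K a)⁻¹ ^ n * algebraMap R K ((g ^ n).coeff m) := by
    rw [mul_pow, ← map_pow, MvPolynomial.coeff_C_mul, ← map_pow, MvPolynomial.coeff_map]
  rw [map_mul, hr, hGn, MvPolynomial.coeff_C_mul, map_mul, map_pow]
  rw [mul_left_comm, ← mul_assoc (algebraMap R K a ^ n), ← mul_pow, mul_inv_cancel₀ ha', one_pow,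
    one_mul]

lemma MvPolynomial.IsHomogeneous.of_C_mul {R σ : Type*} [CommRing R] [IsDomain R]
    {a : R} (ha : a ≠ 0) {p : MvPolynomial σ R} {n : ℕ}
    (h : (MvPolynomial.C a * p).IsHomogeneous n) :
    p.IsHomogeneous n := by
  intro m hm
  exact h (by rw [MvPolynomial.coeff_C_mul]; exact mul_ne_zero ha hm)


lemma exists_not_isIntegral_of_ringKrullDim_eq {R : Type*} [CommRing R] [IsDomain R]
    [IsNoetherianRing R] [IsLocalRing R] {d : ℕ} (hd : ringKrullDim R = d) (hd0 : 0 < d) {k : ℕ}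
    {M : Submodule R (Fin k → R)} (hMfg : M.FG)
    (hl : ringKrullDim (modreesAlgebra R M ⧸
        Ideal.map (algebraMap R (modreesAlgebra R M)) (IsLocalRing.maximalIdeal R)) =
      (d + Module.finrank R M - 1 : ℕ))
    (hM : ∀ n, IsLocalRing.maximalIdeal R ∉ associatedPrimes R
      (MvPolynomial.homogeneousSubmodule (Fin k) R n ⧸ modreesBar R M n)) :
    ∃ (x : FractionRing R) (N : ℕ), ¬ IsIntegral R x ∧
      ∀ c ∈ IsLocalRing.maximalIdeal R ^ N, ∃ r : R,
        algebraMap R (FractionRing R) r = algebraMap R (FractionRing R) c * x := by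
  by_contra! hint
  have := isNoetherianRing_modreesAlgebra hMfg
  set A := modreesAlgebra R M with hAdef
  have hinj : Function.Injective (algebraMap A (MvPolynomial (Fin k) R)) := Subtype.val_injective
  have hRA : ∀ c : R, algebraMap A (MvPolynomial (Fin k) R) (algebraMap R A c) =
      MvPolynomial.C c := fun c => rfl
  obtain ⟨P, hPp, hmP, hP⟩ := exists_isPrime_le_of_ringKrullDim_quotient hl (by
    have := ringKrullDim_modreesAlgebra_le hd M
    rwa [show d + Module.finrank R M - 1 + 1 = d + Module.finrank R M by omega])
  have hm0 : IsLocalRing.maximalIdeal R ≠ ⊥ := fun h => by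
    have := ringKrullDim_eq_zero_of_isField (IsLocalRing.isField_iff_maximalIdeal_eq.2 h)
    rw [hd] at this
    exact hd0.ne' (by exact_mod_cast this)
  obtain ⟨a, ham, ha0⟩ := Submodule.exists_mem_ne_zero_of_ne_bot hm0
  have haA : ∀ c : R, c ≠ 0 → algebraMap R A c ≠ 0 := fun c hc h => hc (by
    have := congrArg (algebraMap A (MvPolynomial (Fin k) R)) h
    rwa [hRA, map_zero, MvPolynomial.C_eq_zero] at this)
  have hmP' : ∀ c ∈ IsLocalRing.maximalIdeal R, algebraMap R A c ∈ P :=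
    fun c hc => hmP (Ideal.mem_map_of_mem _ hc)
  obtain ⟨g0, hg0, N, hN⟩ := exists_notMem_pow_mul_span_singleton_le hP (haA a ha0)
  have hN' : ∀ c ∈ IsLocalRing.maximalIdeal R ^ N, algebraMap R A c ∈ P ^ N := fun c hc => by
    have : Ideal.map (algebraMap R A) (IsLocalRing.maximalIdeal R ^ N) ≤ P ^ N := by
      rw [Ideal.map_pow]
      exact Ideal.pow_right_mono hmP N
    exact this (Ideal.mem_map_of_mem _ hc)
  obtain ⟨n, hn⟩ : ∃ n, (⟨MvPolynomial.homogeneousComponent n (g0 : MvPolynomial (Fin k) R),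
      homogeneousComponent_mem_modreesAlgebra M g0.2 n⟩ : A) ∉ P := by
    by_contra! h
    apply hg0
    have : g0 = ∑ n ∈ Finset.range ((g0 : MvPolynomial (Fin k) R).totalDegree + 1),
        (⟨MvPolynomial.homogeneousComponent n (g0 : MvPolynomial (Fin k) R),
          homogeneousComponent_mem_modreesAlgebra M g0.2 n⟩ : A) := by
      apply Subtype.ext
      rw [AddSubmonoidClass.coe_finsetSum]
      exact (MvPolynomial.sum_homogeneousComponent _).symm
    rw [this]
    exact sum_mem fun n _ => h n
  set g : A := ⟨MvPolynomial.homogeneousComponent n (g0 : MvPolynomial (Fin k) R),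
      homogeneousComponent_mem_modreesAlgebra M g0.2 n⟩
  have hghom : (g : MvPolynomial (Fin k) R).IsHomogeneous n :=
    MvPolynomial.homogeneousComponent_isHomogeneous n _
  have hdiv : ∀ c ∈ IsLocalRing.maximalIdeal R ^ N,
      algebraMap R A c * g ∈ Ideal.span {algebraMap R A a} := fun c hc => by
    obtain ⟨h, hh⟩ := Ideal.mem_span_singleton'.1 (hN _ (hN' c hc))
    refine Ideal.mem_span_singleton'.2 ⟨⟨MvPolynomial.homogeneousComponent n
      (h : MvPolynomial (Fin k) R), homogeneousComponent_mem_modreesAlgebra M h.2 n⟩, ?_⟩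
    apply Subtype.ext
    have := congrArg (fun z : A => MvPolynomial.homogeneousComponent n
      (z : MvPolynomial (Fin k) R)) hh
    change MvPolynomial.homogeneousComponent n ((h : MvPolynomial (Fin k) R) * MvPolynomial.C a) =
      MvPolynomial.homogeneousComponent n (MvPolynomial.C c * (g0 : MvPolynomial (Fin k) R)) at this
    rw [mul_comm, MvPolynomial.homogeneousComponent_C_mul,
      MvPolynomial.homogeneousComponent_C_mul, mul_comm] at this
    exact this
  obtain ⟨b, hb0, hb⟩ := exists_C_pow_dvd_C_mul_pow (g := (g : MvPolynomial (Fin k) R)) ha0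
    (fun m => by
      by_contra hni
      obtain ⟨c, hc, hcr⟩ := hint _ N hni
      obtain ⟨h, hh⟩ := Ideal.mem_span_singleton'.1 (hdiv c hc)
      refine hcr ((h : MvPolynomial (Fin k) R).coeff m) ?_
      have := congrArg (fun z : A => MvPolynomial.coeff m (z : MvPolynomial (Fin k) R)) hh
      change MvPolynomial.coeff m ((h : MvPolynomial (Fin k) R) * MvPolynomial.C a) =
        MvPolynomial.coeff m (MvPolynomial.C c * (g : MvPolynomial (Fin k) R)) at this
      rw [mul_comm, MvPolynomial.coeff_C_mul, MvPolynomial.coeff_C_mul] at this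
      have ha' : algebraMap R (FractionRing R) a ≠ 0 := by simpa using ha0
      rw [← mul_div_assoc, ← map_mul, ← this, map_mul, mul_div_cancel_left₀ _ ha'])
  obtain ⟨g', hg', r, hr⟩ := exists_notMem_mul_pow_mem_span_singleton hP (haA b hb0) (hmP' a ham)
  obtain ⟨c, hc⟩ := Ideal.mem_span_singleton'.1 hr
  obtain ⟨s, hs⟩ := hb (r + 1)
  have hs' : MvPolynomial.C (a ^ (r + 1)) * s =
      MvPolynomial.C b * (g : MvPolynomial (Fin k) R) ^ (r + 1) := hs.symm
  have hshom : s.IsHomogeneous (n * (r + 1)) :=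
    MvPolynomial.IsHomogeneous.of_C_mul (pow_ne_zero (r + 1) ha0) (by
      rw [hs', ← zero_add (n * (r + 1))]
      exact (MvPolynomial.isHomogeneous_C _ b).mul (hghom.pow (r + 1)))
  have hCne : ∀ {c : R}, c ≠ 0 → (MvPolynomial.C c : MvPolynomial (Fin k) R) ≠ 0 :=
    fun hc h => hc (MvPolynomial.C_eq_zero.1 h)
  have hsint : IsIntegral A s := by
    refine isIntegral_of_forall_mem_pow hM hshom (N * (r + 1)) fun c hc => ?_
    have hle : (Ideal.map (algebraMap R A) (IsLocalRing.maximalIdeal R ^ N) * Ideal.span {g}) ^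
        (r + 1) ≤ Ideal.span {algebraMap R A a ^ (r + 1)} := by
      rw [← Ideal.span_singleton_pow]
      refine Ideal.pow_right_mono ?_ _
      rw [Ideal.mul_le]
      intro z hz w hw
      obtain ⟨w, rfl⟩ := Ideal.mem_span_singleton'.1 hw
      rw [mul_left_comm]
      refine Ideal.mul_mem_left _ _ ?_
      have : Ideal.map (algebraMap R A) (IsLocalRing.maximalIdeal R ^ N) ≤
          Submodule.comap (LinearMap.mulRight A g) (Ideal.span {algebraMap R A a}) := by
        rw [Ideal.map, Submodule.span_le]
        rintro _ ⟨c, hc, rfl⟩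
        exact hdiv c hc
      exact this hz
    have hmem : algebraMap R A c * g ^ (r + 1) ∈ Ideal.span {algebraMap R A a ^ (r + 1)} := by
      apply hle
      rw [mul_pow, ← Ideal.map_pow, ← pow_mul]
      exact Ideal.mul_mem_mul (Ideal.mem_map_of_mem _ hc)
        (Ideal.pow_mem_pow (Ideal.mem_span_singleton_self g) _)
    obtain ⟨h', hh'⟩ := Ideal.mem_span_singleton'.1 hmem
    have h1 : (h' : MvPolynomial (Fin k) R) * MvPolynomial.C a ^ (r + 1) =
        MvPolynomial.C c * (g : MvPolynomial (Fin k) R) ^ (r + 1) := congrArg Subtype.val hh'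
    have h2 : MvPolynomial.C c * s = MvPolynomial.C b * (h' : MvPolynomial (Fin k) R) := by
      refine mul_left_cancel₀ (hCne (pow_ne_zero (r + 1) ha0)) ?_
      rw [mul_left_comm, hs', map_pow]
      linear_combination -MvPolynomial.C b * h1
    rw [h2]
    exact (algebraMap R A b * h').2
  have hfin : g ^ (r + 1) * g' ∈ P := by
    refine mem_of_eq_mul_isIntegral hinj (hmP' a ham)
      ((isIntegral_algebraMap (x := c)).mul hsint) ?_
    refine mul_left_cancel₀ (hCne hb0) ?_
    have hc' : (c : MvPolynomial (Fin k) R) * MvPolynomial.C b =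
        (g' : MvPolynomial (Fin k) R) * MvPolynomial.C a ^ r := congrArg Subtype.val hc
    rw [hRA]
    change MvPolynomial.C b *
        ((g : MvPolynomial (Fin k) R) ^ (r + 1) * (g' : MvPolynomial (Fin k) R)) =
      MvPolynomial.C b * (MvPolynomial.C a * ((c : MvPolynomial (Fin k) R) * s))
    rw [map_pow] at hs'
    linear_combination (-(g' : MvPolynomial (Fin k) R)) * hs' - MvPolynomial.C a * s * hc'
  exact (hPp.mem_or_mem hfin).elim (fun h => hn (hPp.mem_of_pow_mem _ h)) hg'

/-- A submodule of a finite flat module over a local ring contains part of a basis such that the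
remaining coordinates of its elements lie in the maximal ideal. -/
lemma exists_basis_mem_repr_mem_maximalIdeal {R F : Type*} [CommRing R] [IsLocalRing R]
    [AddCommGroup F] [Module R F] [Module.Finite R F] [Module.Flat R F] (M : Submodule R F) :
    ∃ (s : Set F) (v : Module.Basis s R F) (b : Set s), (∀ i ∈ b, v i ∈ M) ∧
      ∀ m ∈ M, ∀ i ∉ b, v.repr m i ∈ IsLocalRing.maximalIdeal R := by
  set f := TensorProduct.mk R (IsLocalRing.ResidueField R) F 1 with hf
  obtain ⟨b, hbM, -, hMb, hb⟩ := exists_linearIndepOn_extension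
    (linearIndepOn_empty (IsLocalRing.ResidueField R) f) (Set.empty_subset (M : Set F))
  obtain ⟨s, -, hbs, hs, hsi⟩ := exists_linearIndepOn_extension hb (Set.subset_univ b)
  have hsp : Submodule.span (IsLocalRing.ResidueField R) (f '' s) = ⊤ := by
    refine top_unique fun z _ => ?_
    induction z using TensorProduct.induction_on with
    | zero => exact zero_mem _
    | tmul c x =>
      have : c ⊗ₜ[R] x = c • f x := by simp [hf, TensorProduct.smul_tmul']
      rw [this]
      exact Submodule.smul_mem _ _ (hs ⟨x, trivial, rfl⟩)
    | add x y hx hy => exact add_mem (hx trivial) (hy trivial)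
  have hbij := Module.IsLocalRing.linearCombination_bijective_of_flat (R := R) (fun i : s => (i : F))
    ⟨hsi, by
      rw [← LinearMap.range_eq_top, Finsupp.range_linearCombination, ← hsp]
      congr 1
      ext z
      simp [hf]⟩
  let v : Module.Basis s R F := .mk hbij.1 (by
    rw [← Finsupp.range_linearCombination, LinearMap.range_eq_top.2 hbij.2])
  have hv : ∀ i : s, v i = i := fun i => Module.Basis.mk_apply _ _ i
  refine ⟨s, v, {i | (i : F) ∈ b}, fun i hi => ?_, fun m hm i hi => ?_⟩
  · rw [hv]
    exact hbM hi
  · have hmem : f m ∈ Submodule.span (IsLocalRing.ResidueField R)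
        ((v.baseChange (IsLocalRing.ResidueField R)) '' {i | (i : F) ∈ b}) := by
      have himg : (v.baseChange (IsLocalRing.ResidueField R)) '' {i | (i : F) ∈ b} = f '' b := by
        ext z
        simp only [Set.mem_image, Set.mem_ofPred_eq, Module.Basis.baseChange_apply, hv, hf,
          TensorProduct.mk_apply]
        exact ⟨fun ⟨x, hx, h⟩ => ⟨x, hx, h⟩, fun ⟨x, hx, h⟩ => ⟨⟨x, hbs hx⟩, hx, h⟩⟩
      rw [himg]
      exact hMb ⟨m, hm, rfl⟩
    rw [Module.Basis.mem_span_image] at hmem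
    have h0 : (v.baseChange (IsLocalRing.ResidueField R)).repr (f m) i = 0 := by
      by_contra h
      exact hi (hmem (Finsupp.mem_support_iff.2 h))
    rw [hf, TensorProduct.mk_apply, Module.Basis.baseChange_repr_tmul] at h0
    simpa [Algebra.smul_def] using h0

lemma linForm_mem_map_C {R : Type*} [CommRing R] {k : ℕ} {I : Ideal R} {m : Fin k → R}
    (hm : ∀ i, m i ∈ I) : linForm R k m ∈ Ideal.map MvPolynomial.C I := by
  rw [linForm_apply]
  exact sum_mem fun i _ => Ideal.mul_mem_right _ _ (Ideal.mem_map_of_mem _ (hm i))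

lemma aeval_linForm {R S : Type*} [CommRing R] [CommRing S] [Algebra R S] {k : ℕ}
    (l : (Fin k → R) →ₗ[R] S) (m : Fin k → R) :
    MvPolynomial.aeval (fun j => l (Pi.single j 1)) (linForm R k m) = l m := by
  rw [linForm_apply, map_sum]
  conv_rhs => rw [pi_eq_sum_univ' m, map_sum]
  refine Finset.sum_congr rfl fun i _ => ?_
  rw [map_smul, map_mul, MvPolynomial.aeval_X, Algebra.smul_def, MvPolynomial.algHom_C]

lemma mem_valuationSubring_of_linForm {R K : Type*} [CommRing R] [IsDomain R] [IsLocalRing R]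
    [Field K] [Algebra R K] [IsFractionRing R K] {k : ℕ} {M : Submodule R (Fin k → R)}
    (hM : ∀ n, IsLocalRing.maximalIdeal R ∉ associatedPrimes R
      (MvPolynomial.homogeneousSubmodule (Fin k) R n ⧸ modreesBar R M n))
    (O : ValuationSubring K) (hO : ∀ r, algebraMap R K r ∈ O)
    {x : K} {N : ℕ} (hx : ∀ c ∈ IsLocalRing.maximalIdeal R ^ N, ∃ r : R,
        algebraMap R K r = algebraMap R K c * x)
    (l : (Fin k → R) →ₗ[R] K) (hl : ∀ m ∈ M, l m ∈ O) {m : Fin k → R} (hm : m ∈ M)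
    (hm' : ∀ i, m i ∈ IsLocalRing.maximalIdeal R) (hlm : l m = 1) : x ∈ O := by
  obtain ⟨p, q, hq, rfl⟩ := IsFractionRing.div_surjective (A := R) x
  have hq0 : q ≠ 0 := nonZeroDivisors.ne_zero hq
  have hq' : algebraMap R K q ≠ 0 := by simpa using hq0
  have hx' : ∀ c ∈ IsLocalRing.maximalIdeal R ^ N, ∃ r : R, p * c = q * r := fun c hc => by
    obtain ⟨r, hr⟩ := hx c hc
    refine ⟨r, IsFractionRing.injective R K ?_⟩
    rw [map_mul, map_mul, hr]
    field_simp
  set u := linForm R k m with hu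
  have huN : u ^ N ∈ Ideal.map MvPolynomial.C (IsLocalRing.maximalIdeal R ^ N) := by
    rw [Ideal.map_pow]
    exact Ideal.pow_mem_pow (linForm_mem_map_C hm') N
  obtain ⟨s, hs⟩ : MvPolynomial.C q ∣ MvPolynomial.C p * u ^ N := by
    rw [MvPolynomial.C_dvd_iff_dvd_coeff]
    intro i
    obtain ⟨r, hr⟩ := hx' _ (MvPolynomial.mem_map_C_iff.1 huN i)
    exact ⟨r, by rw [MvPolynomial.coeff_C_mul, hr]⟩
  have hCne : (MvPolynomial.C q : MvPolynomial (Fin k) R) ≠ 0 :=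
    fun h => hq0 (MvPolynomial.C_eq_zero.1 h)
  have hshom : s.IsHomogeneous N := MvPolynomial.IsHomogeneous.of_C_mul hq0 (by
    rw [← hs, ← zero_add N]
    refine (MvPolynomial.isHomogeneous_C _ p).mul ?_
    simpa using (linForm_isHomogeneous m).pow N)
  have hsint : IsIntegral (modreesAlgebra R M) s := by
    refine isIntegral_of_forall_mem_pow hM hshom N fun c hc => ?_
    obtain ⟨r, hr⟩ := hx' c hc
    have : MvPolynomial.C c * s = MvPolynomial.C r * u ^ N := by
      refine mul_left_cancel₀ hCne ?_
      rw [mul_left_comm, ← hs, ← mul_assoc, ← mul_assoc, ← map_mul, ← map_mul, mul_comm c, hr]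
    rw [this]
    exact mul_mem (Subalgebra.algebraMap_mem _ r) (pow_mem (linForm_mem_modreesAlgebra hm) N)
  let ev : MvPolynomial (Fin k) R →ₐ[R] K := MvPolynomial.aeval fun j => l (Pi.single j 1)
  have hevs : ev s = algebraMap R K p / algebraMap R K q := by
    have := congrArg ev hs
    rw [map_mul, map_mul, map_pow, MvPolynomial.algHom_C, MvPolynomial.algHom_C, hu,
      aeval_linForm, hlm, one_pow, mul_one] at this
    rw [this, mul_div_cancel_left₀ _ hq']
  have hevA : ∀ z ∈ modreesAlgebra R M, ev z ∈ O := by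
    intro z hz
    rw [modreesAlgebra_eq_adjoin] at hz
    induction hz using Algebra.adjoin_induction with
    | mem z hz =>
      obtain ⟨m, hm, rfl⟩ := hz
      rw [aeval_linForm]
      exact hl m hm
    | algebraMap r =>
      rw [AlgHom.commutes]
      exact hO r
    | add x y _ _ hx hy =>
      rw [map_add]
      exact add_mem hx hy
    | mul x y _ _ hx hy =>
      rw [map_mul]
      exact mul_mem hx hy
  let φ : modreesAlgebra R M →+* O :=
    ((ev : MvPolynomial (Fin k) R →+* K).comp (modreesAlgebra R M).val.toRingHom).codRestrict
      O fun z => hevA z z.2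
  have : IsIntegral O (ev s) := hsint.map_of_comp_eq φ (ev : MvPolynomial (Fin k) R →+* K) rfl
  rw [← hevs]
  obtain ⟨y, hy⟩ := IsIntegrallyClosed.isIntegral_iff.1 this
  rw [← hy]
  exact y.2

lemma exists_valuationSubring_notMem {R K : Type*} [CommRing R] [Field K] [Algebra R K] {x : K}
    (hx : ¬ IsIntegral R x) :
    ∃ O : ValuationSubring K, (∀ r, algebraMap R K r ∈ O) ∧ x ∉ O := by
  by_contra! h
  have hmem : x ∈ ⨅ V : {V : ValuationSubring K // Set.range (algebraMap R K) ⊆ V.toSubring},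
      V.1.toSubring :=
    Subring.mem_iInf.2 fun V => h V.1 fun r => V.2 ⟨r, rfl⟩
  rw [iInf_valuationSubring_superset, ← RingHom.coe_range, Subring.closure_eq] at hmem
  obtain ⟨p, hp, hpx⟩ := hmem
  obtain ⟨q, rfl, -, hq⟩ := Polynomial.lifts_and_degree_eq_and_monic
    ((Polynomial.mem_lifts _).2
      (Polynomial.map_surjective _ (algebraMap R K).rangeRestrict_surjective p)) hp
  exact hx ⟨q, hq, by rwa [Polynomial.eval₂_map] at hpx⟩

/-- If `R` is not integrally closed at its maximal ideal, and `𝔪` is never associated to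
`ℱⁿ / \overline{ℳⁿ}`, then `ℳ` is a free direct summand. -/
lemma free_and_exists_isCompl_of_not_isIntegral {R K : Type*} [CommRing R] [IsDomain R]
    [IsLocalRing R] [Field K] [Algebra R K] [IsFractionRing R K] {k : ℕ}
    {M : Submodule R (Fin k → R)} (hMfg : M.FG)
    (hM : ∀ n, IsLocalRing.maximalIdeal R ∉ associatedPrimes R
      (MvPolynomial.homogeneousSubmodule (Fin k) R n ⧸ modreesBar R M n))
    {x : K} (hxint : ¬ IsIntegral R x) {N : ℕ}
    (hx : ∀ c ∈ IsLocalRing.maximalIdeal R ^ N, ∃ r : R,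
        algebraMap R K r = algebraMap R K c * x) :
    Module.Free R M ∧ ∃ M' : Submodule R (Fin k → R), IsCompl M M' := by
  classical
  obtain ⟨O, hO, hxO⟩ := exists_valuationSubring_notMem hxint
  obtain ⟨s, v, b, hb, hbm⟩ := exists_basis_mem_repr_mem_maximalIdeal M
  have : Finite s := Module.Finite.finite_basis v
  have := Fintype.ofFinite s
  have hzero : ∀ i ∉ b, ∀ m ∈ M, v.repr m i = 0 := by
    intro i hi
    by_contra! hne
    obtain ⟨m₀, hm₀, hne⟩ := hne
    obtain ⟨t, ht⟩ := hMfg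
    have htM : ∀ g ∈ t, g ∈ M := fun g hg => ht ▸ Submodule.subset_span hg
    have htne : t.Nonempty := by
      rw [Finset.nonempty_iff_ne_empty]
      rintro rfl
      rw [Finset.coe_empty, Submodule.span_empty] at ht
      rw [← ht, Submodule.mem_bot] at hm₀
      simp [hm₀] at hne
    obtain ⟨g, hg, hmax⟩ := t.exists_max_image
      (fun g => O.valuation (algebraMap R K (v.repr g i))) htne
    let l₀ : (Fin k → R) →ₗ[R] K := Algebra.linearMap R K ∘ₗ v.coord i
    have hl₀ : ∀ m, l₀ m = algebraMap R K (v.repr m i) := fun m => rfl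
    have hγ : l₀ g ≠ 0 := by
      intro h0
      have hle : M ≤ LinearMap.ker l₀ := by
        rw [← ht, Submodule.span_le]
        intro g' hg'
        have := hmax g' hg'
        rw [← hl₀, ← hl₀, h0, map_zero, le_zero_iff, map_eq_zero] at this
        exact this
      have := hle hm₀
      rw [LinearMap.mem_ker, hl₀] at this
      exact hne (by simpa using this)
    let l : (Fin k → R) →ₗ[R] K := LinearMap.mulRight R (l₀ g)⁻¹ ∘ₗ l₀
    have hl : ∀ m, l m = l₀ m * (l₀ g)⁻¹ := fun m => rfl
    let O' : Submodule R K :=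
      { carrier := O
        zero_mem' := O.zero_mem
        add_mem' := O.add_mem _ _
        smul_mem' := fun r y hy => by
          rw [Algebra.smul_def]
          exact O.mul_mem _ _ (hO r) hy }
    have hlO : M ≤ O'.comap l := by
      rw [← ht, Submodule.span_le]
      intro g' hg'
      change l g' ∈ O
      rw [← ValuationSubring.valuation_le_one_iff, hl, map_mul, map_inv₀]
      exact mul_inv_le_one_of_le₀ (hmax g' hg') zero_le
    have hgm : ∑ j ∈ b.toFinset, v.repr g j • v j ∈ M :=
      sum_mem fun j hj => M.smul_mem _ (hb j (Set.mem_toFinset.1 hj))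
    have hrepr : ∀ j, v.repr (g - ∑ j ∈ b.toFinset, v.repr g j • v j) j =
        if j ∈ b then 0 else v.repr g j := by
      intro j
      simp only [map_sub, map_sum, map_smul, Module.Basis.repr_self, Finsupp.smul_single,
        smul_eq_mul, mul_one, Finsupp.sub_apply, Finsupp.finsetSum_apply, Finsupp.single_apply,
        Finset.sum_ite_eq', Set.mem_toFinset]
      split_ifs <;> simp
    refine hxO (mem_valuationSubring_of_linForm hM O hO hx l (fun m hm => hlO hm)
      (m := g - ∑ j ∈ b.toFinset, v.repr g j • v j) (M.sub_mem (htM g hg) hgm) ?_ ?_)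
    · intro c
      rw [← v.sum_repr (g - _), Finset.sum_apply]
      refine sum_mem fun j _ => ?_
      rw [Pi.smul_apply, smul_eq_mul, hrepr]
      refine Ideal.mul_mem_right _ _ ?_
      split_ifs with hj
      · exact zero_mem _
      · exact hbm g (htM g hg) j hj
    · rw [hl, hl₀, hrepr, if_neg hi, ← hl₀, mul_inv_cancel₀ hγ]
  have hMspan : M = Submodule.span R (v '' b) := by
    refine le_antisymm (fun m hm => ?_) ?_
    · rw [Module.Basis.mem_span_image]
      intro i hi
      by_contra hib
      exact Finsupp.mem_support_iff.1 hi (hzero i hib m hm)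
    · rw [Submodule.span_le]
      rintro _ ⟨i, hi, rfl⟩
      exact hb i hi
  subst hMspan
  refine ⟨?_, Submodule.span R (v '' bᶜ), ?_, ?_⟩
  · rw [Set.image_eq_range]
    exact Module.Free.of_basis (Module.Basis.span (v.linearIndependent.comp _
      (Subtype.val_injective (p := (· ∈ b)))))
  · exact v.linearIndependent.disjoint_span_image disjoint_compl_right
  · rw [codisjoint_iff, ← Submodule.span_union, ← Set.image_union, Set.union_compl_self,
      Set.image_univ, v.span_eq]

lemma ringKrullDim_modreesAlgebra_quotient_le {R : Type*} [CommRing R] [IsDomain R]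
    [IsLocalRing R] {k : ℕ} (M : Submodule R (Fin k → R)) [Module.Free R M] [Module.Finite R M] :
    ringKrullDim (modreesAlgebra R M ⧸
        Ideal.map (algebraMap R (modreesAlgebra R M)) (IsLocalRing.maximalIdeal R)) ≤
      (Module.finrank R M : ℕ) := by
  set A := modreesAlgebra R M with hA
  let w := Module.finBasis R M
  have hgen : A = Algebra.adjoin R (Set.range fun i => linForm R k (w i)) := by
    have : M = Submodule.span R (Set.range fun i => (w i : Fin k → R)) := by
      have := congrArg (Submodule.map M.subtype) w.span_eq
      rwa [Submodule.map_span, Submodule.map_top, Submodule.range_subtype, ← Set.range_comp,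
        eq_comm] at this
    rw [hA]
    conv_lhs => rw [this]
    rw [modreesAlgebra_span, ← Set.range_comp]
    rfl
  let I := Ideal.map (algebraMap R A) (IsLocalRing.maximalIdeal R)
  let a : Fin (Module.finrank R M) → A ⧸ I := fun i =>
    Ideal.Quotient.mk I ⟨linForm R k (w i), linForm_mem_modreesAlgebra (w i).2⟩
  let ρ : IsLocalRing.ResidueField R →+* A ⧸ I := Ideal.Quotient.lift _
    ((Ideal.Quotient.mk I).comp (algebraMap R A)) fun c hc =>
      Ideal.Quotient.eq_zero_iff_mem.2 (Ideal.mem_map_of_mem _ hc)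
  let φ : MvPolynomial (Fin (Module.finrank R M)) (IsLocalRing.ResidueField R) →+* A ⧸ I :=
    MvPolynomial.eval₂Hom ρ a
  have hφ : Function.Surjective φ := by
    intro z
    obtain ⟨⟨z, hz⟩, rfl⟩ := Ideal.Quotient.mk_surjective z
    have hz' := hz
    rw [hgen, Algebra.adjoin_range_eq_range_aeval] at hz'
    obtain ⟨p, hp⟩ := hz'
    refine ⟨MvPolynomial.map (IsLocalRing.residue R) p, ?_⟩
    have h1 : φ (MvPolynomial.map (IsLocalRing.residue R) p) = Ideal.Quotient.mk I
        (MvPolynomial.aeval (fun i => (⟨linForm R k (w i),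
          linForm_mem_modreesAlgebra (w i).2⟩ : A)) p) := by
      simp only [φ, MvPolynomial.coe_eval₂Hom, MvPolynomial.eval₂_map, MvPolynomial.aeval_def]
      have hρ : ρ.comp (IsLocalRing.residue R) =
          (Ideal.Quotient.mk I).comp (algebraMap R A) := rfl
      rw [hρ]
      exact (MvPolynomial.hom_eval₂ _ _ _ _).symm
    rw [h1]
    congr 1
    apply Subtype.ext
    have h2 := MvPolynomial.comp_aeval_apply (fun i => (⟨linForm R k (w i),
      linForm_mem_modreesAlgebra (w i).2⟩ : A)) A.val p
    exact h2.trans hp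
  refine (ringKrullDim_le_of_surjective φ hφ).trans ?_
  rw [MvPolynomial.ringKrullDim_of_isNoetherianRing, ringKrullDim_eq_zero_of_field]
  simp

/-- Let `(R, 𝔪)` be a local Noetherian domain of dimension `d > 0`,
`ℳ ⊆ ℱ = R^k` a nonzero finitely generated module of generic rank `e`.  If the analytic
spread `ℓ(ℳ) = dim ℛ(ℳ)/𝔪ℛ(ℳ)` equals `d + e - 1`, then `𝔪 ∈ Ass_R(ℱⁿ/\overline{ℳⁿ})`
for some `n`, unless `d = 1` and `ℳ` is a free module that is a direct summand of `ℱ`. -/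
theorem maximalIdeal_mem_assPrimes_of_analyticSpread_eq (R : Type*)
    [CommRing R] [IsDomain R] [IsNoetherianRing R] [IsLocalRing R]
    (d : ℕ) (hd : ringKrullDim R = d) (hd0 : 0 < d)
    (k : ℕ) (M : Submodule R (Fin k → R)) (hM : M ≠ ⊥) (hMfg : M.FG)
    (e : ℕ) (he : e = Module.finrank (FractionRing R) (FractionRing R ⊗[R] ↥M))
    (hl : ringKrullDim (↥(modreesAlgebra R M) ⧸
        Ideal.map (algebraMap R ↥(modreesAlgebra R M)) (IsLocalRing.maximalIdeal R)) =
      (d + e - 1 : ℕ)) :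
    (∃ n : ℕ, IsLocalRing.maximalIdeal R ∈ associatedPrimes R
      (↥(MvPolynomial.homogeneousSubmodule (Fin k) R n) ⧸ modreesBar R M n)) ∨
    (d = 1 ∧ Module.Free R ↥M ∧ ∃ N : Submodule R (Fin k → R), IsCompl M N) := by
  refine or_iff_not_imp_left.2 fun hnot => ?_
  have hass : ∀ n, IsLocalRing.maximalIdeal R ∉ associatedPrimes R
      (MvPolynomial.homogeneousSubmodule (Fin k) R n ⧸ modreesBar R M n) :=
    fun n hn => hnot ⟨n, hn⟩
  have he' : e = Module.finrank R M := by
    rw [he, IsLocalization.finrank_eq (FractionRing R) (nonZeroDivisors R) le_rfl,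
      IsLocalizedModule.finrank_eq (nonZeroDivisors R)
        (TensorProduct.mk R (FractionRing R) M 1) le_rfl]
  subst he'
  obtain ⟨x, N, hx, hxN⟩ := exists_not_isIntegral_of_ringKrullDim_eq hd hd0 hMfg hl hass
  obtain ⟨hfree, hcompl⟩ := free_and_exists_isCompl_of_not_isIntegral hMfg hass hx hxN
  refine ⟨?_, hfree, hcompl⟩
  have : Module.Finite R M := Module.Finite.iff_fg.2 hMfg
  have hle := ringKrullDim_modreesAlgebra_quotient_le M
  rw [hl] at hle
  have : d + Module.finrank R M - 1 ≤ Module.finrank R M := by exact_mod_cast hle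
  omega
end

section
/- Let 𝒜 be a Noetherian ring, ℬ a finitely generated 𝒜-algebra containing 𝒜, and 𝒜̄ the integral closure of 𝒜 in ℬ. Suppose that 𝒜_{𝔭} = 𝒜̄_{𝔭} for every minimal prime 𝔭 of 𝒜. Then there exists f ∈ 𝒜 not contained in any minimal prime of 𝒜 such that the localization map 𝒜_f → 𝒜̄_f is an isomorphism, i.e. 𝒜_f = 𝒜̄_f. -/
/-- The `A`-subalgebra `C` of `B` is such that the `S`-torsion of any finitely generated
`C`-submodule of `B`, taken modulo the sum of a `C`-submodule `L` and a finitely generated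
`A`-submodule `N`, is killed by powers of a single element of `S`. -/
def HasUniformTorsion {A B : Type*} [CommRing A] [CommRing B] [Algebra A B] (S : Submonoid A)
    (C : Subalgebra A B) : Prop :=
  ∀ (T : Set B) (L : Submodule C B) (N : Submodule A B), T.Finite → N.FG →
    ∃ f ∈ S, ∀ e ∈ Submodule.span C T, ∀ s ∈ S, s • e ∈ L.restrictScalars A ⊔ N →
      ∃ k : ℕ, f ^ k • e ∈ L.restrictScalars A ⊔ N

section

variable {A B : Type*} [CommRing A] [CommRing B] [Algebra A B] (S : Submonoid A)

theorem Submodule.FG.exists_mem_forall_smul_mem {M : Type*} [AddCommGroup M] [Module A M]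
    {W : Submodule A M} (hW : W.FG) (P : Submodule A M)
    (h : ∀ e ∈ W, ∃ s ∈ S, s • e ∈ P) : ∃ f ∈ S, ∀ e ∈ W, f • e ∈ P := by
  induction W, hW using Submodule.fg_induction with
  | singleton x =>
    obtain ⟨s, hs, hx⟩ := h x (Submodule.mem_span_singleton_self x)
    refine ⟨s, hs, fun e he => ?_⟩
    obtain ⟨a, rfl⟩ := Submodule.mem_span_singleton.1 he
    rw [smul_comm]
    exact P.smul_mem a hx
  | sup U V _ _ hU hV =>
    obtain ⟨f, hf, hfU⟩ := hU fun e he => h e (Submodule.mem_sup_left he)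
    obtain ⟨g, hg, hgV⟩ := hV fun e he => h e (Submodule.mem_sup_right he)
    refine ⟨f * g, S.mul_mem hf hg, fun e he => ?_⟩
    obtain ⟨u, hu, v, hv, rfl⟩ := Submodule.mem_sup.1 he
    rw [smul_add]
    refine P.add_mem ?_ ?_
    · rw [mul_comm, mul_smul]
      exact P.smul_mem g (hfU u hu)
    · rw [mul_smul]
      exact P.smul_mem f (hgV v hv)

theorem hasUniformTorsion_bot [IsNoetherianRing A] :
    HasUniformTorsion S (⊥ : Subalgebra A B) := by
  intro T L N hT _
  set P := L.restrictScalars A ⊔ N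
  let W : Submodule A B :=
    { carrier := {e | e ∈ Submodule.span A T ∧ ∃ s ∈ S, s • e ∈ P}
      zero_mem' := ⟨zero_mem _, 1, S.one_mem, by simp⟩
      add_mem' := by
        rintro a b ⟨ha, s, hs, hsa⟩ ⟨hb, t, ht, htb⟩
        refine ⟨add_mem ha hb, s * t, S.mul_mem hs ht, ?_⟩
        rw [smul_add]
        refine P.add_mem ?_ ?_
        · rw [mul_comm, mul_smul]
          exact P.smul_mem t hsa
        · rw [mul_smul]
          exact P.smul_mem s htb
      smul_mem' := by
        rintro c a ⟨ha, s, hs, hsa⟩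
        refine ⟨Submodule.smul_mem _ c ha, s, hs, ?_⟩
        rw [smul_comm]
        exact P.smul_mem c hsa }
  have hWT : W ≤ Submodule.span A T := fun e he => he.1
  have hspan : (Submodule.span A T).FG := Submodule.fg_span hT
  have hW : W.FG := by
    have := isNoetherian_of_fg_of_noetherian _ hspan
    exact (isNoetherian_submodule.1 this) W hWT
  obtain ⟨f, hf, hfW⟩ := hW.exists_mem_forall_smul_mem S P fun e he => he.2
  refine ⟨f, hf, fun e he s hs hse => ⟨1, ?_⟩⟩
  rw [pow_one]
  refine hfW e ⟨?_, s, hs, hse⟩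
  have hle : Submodule.span (⊥ : Subalgebra A B) T ≤
      { Submodule.span A T with
        smul_mem' := by
          rintro ⟨c, hc⟩ y hy
          obtain ⟨a, rfl⟩ := Algebra.mem_bot.1 hc
          rw [Subalgebra.smul_def, smul_eq_mul, ← Algebra.smul_def]
          exact Submodule.smul_mem (Submodule.span A T) a hy } :=
    Submodule.span_le.2 fun y hy => Submodule.subset_span (R := A) hy
  exact hle he

theorem HasUniformTorsion.adjoin_insert {C D : Subalgebra A B} [IsNoetherianRing C]
    (h : HasUniformTorsion S C) {x : B} (hD : D = Algebra.adjoin A (insert x (C : Set B))) :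
    HasUniformTorsion S D := by
  intro T L N hT hN
  obtain ⟨U, hU, rfl⟩ := Submodule.fg_def.1 hN
  have hCD : ∀ c ∈ C, c ∈ D := fun c hc => hD ▸ Algebra.subset_adjoin (Set.mem_insert_of_mem x hc)
  have hxD : x ∈ D := hD ▸ Algebra.subset_adjoin (Set.mem_insert x _)
  let L' : Submodule C B :=
    { L with smul_mem' := fun c y hy => L.smul_mem (⟨c, hCD c c.2⟩ : D) hy }
  have hxL : ∀ y ∈ L', x * y ∈ L' := fun y hy => L.smul_mem (⟨x, hxD⟩ : D) hy
  let M : Submodule C B := Submodule.span C (T ∪ U)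
  let G : ℕ → Submodule C B := fun i => Nat.rec (L' ⊔ M)
    (fun i g => g ⊔ M.map (LinearMap.mulLeft C (x ^ (i + 1)))) i
  have hG0 : G 0 = L' ⊔ M := rfl
  have hGs (i : ℕ) : G (i + 1) = G i ⊔ M.map (LinearMap.mulLeft C (x ^ (i + 1))) := rfl
  have hGmono : Monotone G := monotone_nat_of_le_succ fun i => by rw [hGs]; exact le_sup_left
  have hxG (i : ℕ) : ∀ y ∈ G i, x * y ∈ G (i + 1) := by
    induction i with
    | zero =>
      intro y hy
      rw [hG0] at hy
      obtain ⟨l, hl, m, hm, rfl⟩ := Submodule.mem_sup.1 hy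
      rw [mul_add, hGs]
      refine add_mem (Submodule.mem_sup_left (Submodule.mem_sup_left (hxL l hl)))
        (Submodule.mem_sup_right ⟨m, hm, by simp⟩)
    | succ i ih =>
      intro y hy
      rw [hGs] at hy
      obtain ⟨g, hg, _, ⟨m, hm, rfl⟩, rfl⟩ := Submodule.mem_sup.1 hy
      rw [mul_add, hGs (i + 1)]
      refine add_mem (Submodule.mem_sup_left (ih g hg))
        (Submodule.mem_sup_right ⟨m, hm, ?_⟩)
      simp only [LinearMap.mulLeft_apply]
      ring
  have hTG : ∀ e ∈ Submodule.span D T, ∃ i, e ∈ G i := by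
    intro e he
    induction he using Submodule.span_induction with
    | mem y hy => exact ⟨0, Submodule.mem_sup_right (Submodule.subset_span (Or.inl hy))⟩
    | zero => exact ⟨0, zero_mem _⟩
    | add y z _ _ hy hz =>
      obtain ⟨i, hi⟩ := hy
      obtain ⟨j, hj⟩ := hz
      exact ⟨max i j, add_mem (hGmono (le_max_left i j) hi) (hGmono (le_max_right i j) hj)⟩
    | smul c y _ hy =>
      obtain ⟨c, hc⟩ := c
      rw [Subalgebra.smul_def, smul_eq_mul]
      dsimp only
      rw [hD] at hc
      clear * - hc hy hGmono hxG
      induction hc using Algebra.adjoin_induction generalizing y with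
      | mem c hc =>
        obtain ⟨i, hi⟩ := hy
        obtain rfl | hc := hc
        · exact ⟨i + 1, hxG i y hi⟩
        · exact ⟨i, (G i).smul_mem ⟨c, hc⟩ hi⟩
      | algebraMap a =>
        obtain ⟨i, hi⟩ := hy
        exact ⟨i, (G i).smul_mem (algebraMap A C a) hi⟩
      | add c d _ _ hc hd =>
        obtain ⟨i, hi⟩ := hc y hy
        obtain ⟨j, hj⟩ := hd y hy
        rw [add_mul]
        exact ⟨max i j, add_mem (hGmono (le_max_left i j) hi) (hGmono (le_max_right i j) hj)⟩
      | mul c d _ _ hc hd =>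
        rw [mul_assoc]
        exact hc _ (hd y hy)
  let K : ℕ → Submodule C B := fun i => (G i).comap (LinearMap.mulLeft C (x ^ (i + 1)))
  have hK {i : ℕ} {y : B} : y ∈ K i ↔ x ^ (i + 1) * y ∈ G i := Iff.rfl
  have hKmono : Monotone K := monotone_nat_of_le_succ fun i y hy => by
    rw [hK, pow_succ', mul_assoc]
    exact hxG i _ hy
  have hTU : (T ∪ U).Finite := hT.union hU
  obtain ⟨r, hr⟩ : ∃ r, ∀ i, r ≤ i → ∀ y ∈ M, y ∈ K i → y ∈ K r := by
    have : IsNoetherian C M := isNoetherian_of_fg_of_noetherian _ (Submodule.fg_span hTU)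
    obtain ⟨r, hr⟩ := monotone_stabilizes_iff_noetherian.2 this
      ⟨fun i => (K i).comap M.subtype, fun i j hij => Submodule.comap_mono (hKmono hij)⟩
    refine ⟨r, fun i hi y hy hyi => ?_⟩
    have : (⟨y, hy⟩ : M) ∈ (K i).comap M.subtype := hyi
    rw [← show (K r).comap M.subtype = (K i).comap M.subtype from hr i hi] at this
    exact this
  obtain ⟨f₀, hf₀, hN₀⟩ := h (T ∪ U) L' (Submodule.span A U) hTU hN
  choose f hf hfK using fun i => h (T ∪ U) (K i) ⊥ hTU Submodule.fg_bot
  simp only [sup_bot_eq, Submodule.restrictScalars_mem] at hfK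
  set P := L.restrictScalars A ⊔ Submodule.span A U
  have hP : L'.restrictScalars A ⊔ Submodule.span A U = P := rfl
  rw [hP] at hN₀
  have hPG (i : ℕ) : P ≤ (G i).restrictScalars A := by
    refine sup_le (fun y hy => hGmono (Nat.zero_le i) (Submodule.mem_sup_left hy))
      (Submodule.span_le.2 fun y hy => hGmono (Nat.zero_le i)
        (Submodule.mem_sup_right (Submodule.subset_span (Or.inr hy))))
  have hdvd {g g' : A} (hg : g ∣ g') (k : ℕ) {y : B} {Q : Submodule A B} (hy : g ^ k • y ∈ Q) :
      g' ^ k • y ∈ Q := by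
    obtain ⟨d, rfl⟩ := hg
    rw [mul_pow, mul_comm, mul_smul]
    exact Q.smul_mem _ hy
  let F : A := f₀ * ∏ i ∈ Finset.range (r + 1), f i
  have hfF (i : ℕ) (hi : i ≤ r) : f i ∣ F :=
    (Finset.dvd_prod_of_mem f (Finset.mem_range.2 (Nat.lt_succ_of_le hi))).mul_left _
  have hFK (i : ℕ) : ∀ y ∈ M, ∀ s ∈ S, s • y ∈ K i → ∃ k : ℕ, F ^ k • y ∈ K i := by
    intro y hy s hs hsy
    obtain hi | hi := le_total i r
    · obtain ⟨k, hk⟩ := hfK i y hy s hs hsy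
      exact ⟨k, hdvd (hfF i hi) k (Q := (K i).restrictScalars A) hk⟩
    · obtain ⟨k, hk⟩ := hfK r y hy s hs
        (hr i hi _ ((M.restrictScalars A).smul_mem s hy) hsy)
      exact ⟨k, hKmono hi (hdvd (hfF r le_rfl) k (Q := (K r).restrictScalars A) hk)⟩
  refine ⟨F, S.mul_mem hf₀ (S.prod_mem fun i _ => hf i), fun e he s hs hse => ?_⟩
  obtain ⟨i, hi⟩ := hTG e he
  clear he
  induction i generalizing e with
  | zero =>
    obtain ⟨l, hl, m, hm, rfl⟩ := Submodule.mem_sup.1 hi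
    have hlP : l ∈ P := Submodule.mem_sup_left hl
    rw [smul_add, P.add_mem_iff_right (P.smul_mem s hlP)] at hse
    obtain ⟨k, hk⟩ := hN₀ m hm s hs hse
    refine ⟨k, ?_⟩
    rw [smul_add]
    exact P.add_mem (P.smul_mem _ hlP) (hdvd (Dvd.intro _ rfl) k hk)
  | succ i ih =>
    rw [hGs] at hi
    obtain ⟨g, hg, _, ⟨m, hm, rfl⟩, rfl⟩ := Submodule.mem_sup.1 hi
    rw [LinearMap.mulLeft_apply] at hse ⊢
    have hgG (a : A) : a • g ∈ G i := ((G i).restrictScalars A).smul_mem a hg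
    have hsm : s • m ∈ K i := by
      have := hPG i hse
      rw [Submodule.restrictScalars_mem, smul_add, (G i).add_mem_iff_right (hgG s),
        ← mul_smul_comm] at this
      exact this
    obtain ⟨k, hk⟩ := hFK i m hm s hs hsm
    obtain ⟨k', hk'⟩ := ih (F ^ k • (g + x ^ (i + 1) * m))
      (by rw [smul_comm]; exact P.smul_mem _ hse)
      (by
        rw [smul_add, ← mul_smul_comm]
        exact add_mem (hgG _) hk)
    exact ⟨k' + k, by rwa [pow_add, mul_smul]⟩

theorem hasUniformTorsion_adjoin [IsNoetherianRing A] {T : Set B} (hT : T.Finite) :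
    HasUniformTorsion S (Algebra.adjoin A T) := by
  induction T, hT using Set.Finite.induction_on with
  | empty =>
    rw [Algebra.adjoin_empty]
    exact hasUniformTorsion_bot S
  | @insert x T _ hT ih =>
    have : IsNoetherianRing (Algebra.adjoin A T) :=
      isNoetherianRing_of_fg (Subalgebra.fg_def.2 ⟨T, hT, rfl⟩)
    exact ih.adjoin_insert S (Algebra.adjoin_insert_adjoin A T x).symm

/-- If `B` is a finitely generated algebra over a Noetherian ring `A`, the elements of `B` which
some element of `S` multiplies into the image of `A` are multiplied into it by powers of a single
element of `S`. -/
theorem exists_mem_forall_pow_smul_mem_range [IsNoetherianRing A] [Algebra.FiniteType A B] :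
    ∃ f ∈ S, ∀ b : B, ∀ s ∈ S, s • b ∈ (algebraMap A B).range →
      ∃ k : ℕ, f ^ k • b ∈ (algebraMap A B).range := by
  obtain ⟨T, hT⟩ := Algebra.FiniteType.out (R := A) (A := B)
  obtain ⟨f, hf, h⟩ := hasUniformTorsion_adjoin S T.finite_toSet {1} ⊥ (1 : Submodule A B)
    (Set.finite_singleton 1) ⟨{1}, by simp [Submodule.one_eq_span]⟩
  have hmem {b : B} : b ∈ (algebraMap A B).range ↔
      b ∈ (⊥ : Submodule (Algebra.adjoin A (T : Set B)) B).restrictScalars A ⊔ 1 := by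
    rw [Submodule.restrictScalars_bot, bot_sup_eq, Submodule.mem_one, RingHom.mem_range]
  refine ⟨f, hf, fun b s hs hsb => ?_⟩
  simp only [hmem] at hsb ⊢
  refine h b (Submodule.mem_span_singleton.2 ⟨⟨b, hT ▸ Algebra.mem_top⟩, ?_⟩) s hs hsb
  simp [Subalgebra.smul_def]

end



/-- Let `𝒜` be Noetherian, `ℬ` a finitely generated `𝒜`-algebra containing
`𝒜`, and `𝒜̄` the integral closure of `𝒜` in `ℬ`.  If the localization map `𝒜_𝔭 → 𝒜̄_𝔭` is
an isomorphism for every minimal prime `𝔭` of `𝒜`, then there is `f ∈ 𝒜`, outside every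
minimal prime of `𝒜`, such that the localization map `𝒜_f → 𝒜̄_f` is an isomorphism. -/
theorem exists_localization_away_bijective (A B : Type*)
    [CommRing A] [CommRing B] [IsNoetherianRing A] [Algebra A B]
    (hinj : Function.Injective (algebraMap A B))
    (hfg : Algebra.FiniteType A B)
    (hloc : ∀ (p : Ideal A) (hp : p ∈ minimalPrimes A),
      haveI : p.IsPrime := hp.1.1
      Function.Bijective
        (IsLocalization.map
          (Localization (Algebra.algebraMapSubmonoid (integralClosure A B) p.primeCompl))
          (algebraMap A (integralClosure A B))
          (show p.primeCompl ≤
              (Algebra.algebraMapSubmonoid (integralClosure A B) p.primeCompl).comap _ from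
            p.primeCompl.le_comap_map) :
          Localization.AtPrime p →+* _)) :
    ∃ f : A, (∀ p ∈ minimalPrimes A, f ∉ p) ∧
      Function.Bijective
        (Localization.awayMap (algebraMap A (integralClosure A B)) f) := by
  let S : Submonoid A :=
    { carrier := {f | ∀ p ∈ minimalPrimes A, f ∉ p}
      one_mem' := fun p hp => p.ne_top_iff_one.1 hp.1.1.ne_top
      mul_mem' := fun ha hb p hp hab => (hp.1.1.mem_or_mem hab).elim (ha p hp) (hb p hp) }
  obtain ⟨f, hf, h⟩ := exists_mem_forall_pow_smul_mem_range (B := B) S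
  have hS (b : integralClosure A B) : ∃ s ∈ S, s • (b : B) ∈ (algebraMap A B).range := by
    let I : Ideal A := (1 : Submodule A B).comap (LinearMap.toSpanSingleton A B b)
    have hI {a : A} : a ∈ I ↔ a • (b : B) ∈ (algebraMap A B).range := by
      simp [I, Submodule.mem_one]
    have hIp : ∀ p ∈ minimalPrimes A, ¬ I ≤ p := by
      intro p hp hle
      have : p.IsPrime := hp.1.1
      obtain ⟨z, hz⟩ := (hloc p hp).2 (algebraMap (integralClosure A B) _ b)
      obtain ⟨⟨a, s⟩, rfl⟩ := IsLocalization.mk'_surjective p.primeCompl z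
      rw [IsLocalization.map_mk', eq_comm, IsLocalization.eq_mk'_iff_mul_eq, ← map_mul,
        IsLocalization.eq_iff_exists
          (Algebra.algebraMapSubmonoid (integralClosure A B) p.primeCompl)] at hz
      obtain ⟨⟨_, t, ht, rfl⟩, hc⟩ := hz
      have hmem : t * s ∈ I := by
        refine hI.2 ⟨t * a, ?_⟩
        have := congrArg (algebraMap (integralClosure A B) B) hc
        simp only [map_mul, ← IsScalarTower.algebraMap_apply] at this
        rw [map_mul, ← this, Algebra.smul_def, map_mul,
          show algebraMap (integralClosure A B) B b = b from rfl]
        ring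
      exact (p.primeCompl.mul_mem ht s.2) (hle hmem)
    have hfin := minimalPrimes.finite_of_isNoetherianRing A
    have : ¬ (I : Set A) ⊆ ⋃ p ∈ minimalPrimes A, (p : Set A) := by
      rw [Ideal.subset_union_prime_finite hfin (f := fun p => p) ⊤ ⊤ fun p hp _ _ => hp.1.1]
      rintro ⟨p, hp, hle⟩
      exact hIp p hp hle
    obtain ⟨s, hsI, hs⟩ := Set.not_subset.1 this
    refine ⟨s, fun p hp hsp => hs (Set.mem_biUnion hp hsp), hI.1 hsI⟩
  refine ⟨f, hf, ?_, ?_⟩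
  · exact IsLocalization.map_injective_of_injective _ _ _ fun a b hab =>
      hinj (congrArg (algebraMap (integralClosure A B) B) hab)
  · intro z
    obtain ⟨b, ⟨_, n, rfl⟩, rfl⟩ := IsLocalization.exists_mk'_eq
      (Submonoid.powers (algebraMap A (integralClosure A B) f)) z
    obtain ⟨s, hs, hsb⟩ := hS b
    obtain ⟨k, a, hk⟩ := h b s hs hsb
    refine ⟨IsLocalization.mk' _ a (⟨f ^ (k + n), k + n, rfl⟩ : Submonoid.powers f), ?_⟩
    rw [Localization.awayMap, IsLocalization.Away.map, IsLocalization.map_mk',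
      IsLocalization.mk'_eq_iff_eq]
    refine congrArg _ (Subtype.ext ?_)
    change algebraMap A B f ^ n * algebraMap A B a = algebraMap A B (f ^ (k + n)) * (b : B)
    rw [hk, Algebra.smul_def, map_pow, map_pow, pow_add]
    ring
end

section
/- Let 𝒜 be a Noetherian ring, ℬ a finitely generated 𝒜-algebra containing 𝒜, and 𝒜̄ the integral closure of 𝒜 in ℬ. Then for each prime ideal 𝔭 of 𝒜, there are only finitely many prime ideals of 𝒜̄ contracting to 𝔭 (i.e. primes 𝔮 of 𝒜̄ with 𝔮 ∩ 𝒜 = 𝔭). -/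
section

open Polynomial TensorProduct

/-- A surjective ring homomorphism `f` induces a surjection from the `J`-adic completion to the
`f(J)`-adic completion. -/
theorem AdicCompletion.exists_surjective_ringHom_map {R S : Type*} [CommRing R] [CommRing S]
    (f : R →+* S) (hf : Function.Surjective f) (J : Ideal R) (I : Ideal S)
    (hI : J.map f = I) :
    ∃ g : AdicCompletion J R →+* AdicCompletion I S, Function.Surjective g := by
  subst hI
  have hle (n : ℕ) : J ^ n ≤ ((J.map f) ^ n).comap f := by
    rw [← Ideal.map_le_iff_le_comap, Ideal.map_pow]
  let F (n : ℕ) : AdicCompletion J R →+* S ⧸ (J.map f) ^ n :=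
    (Ideal.quotientMap _ f (hle n)).comp (evalₐ J n : AdicCompletion J R →+* R ⧸ J ^ n)
  have hF (n : ℕ) (c : AdicCauchySequence J R) :
      F n (mk J R c) = Ideal.Quotient.mk _ (f (c n)) := by
    simp [F]
  refine ⟨liftRingHom _ F ?_, fun y ↦ ?_⟩
  · intro m n hmn
    ext x
    obtain ⟨c, rfl⟩ := mk_surjective J R x
    rw [RingHom.comp_apply, hF, hF]
    change Ideal.Quotient.mk _ (f (c n)) = Ideal.Quotient.mk _ (f (c m))
    rw [Ideal.Quotient.eq, ← map_sub]
    refine hle m ?_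
    have := c.property hmn
    rw [SModEq.sub_mem] at this
    simpa using neg_mem this
  · obtain ⟨c, rfl⟩ := mk_surjective _ _ y
    have hd (n : ℕ) : ∃ d ∈ J ^ n, f d = c (n + 1) - c n := by
      have := c.property n.le_succ
      rw [SModEq.sub_mem] at this
      rw [← Ideal.mem_map_iff_of_surjective f hf, Ideal.map_pow]
      simpa using neg_mem this
    choose d hdJ hd using hd
    obtain ⟨s, hs⟩ := hf (c 0)
    let t (n : ℕ) : R := s + ∑ i ∈ Finset.range n, d i
    have ht (n : ℕ) : f (t n) = c n := by
      simp [t, hs, hd, Finset.sum_range_sub (fun i ↦ c i)]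
    refine ⟨mk J R (AdicCauchySequence.mk J R t fun n ↦ ?_), ?_⟩
    · rw [SModEq.sub_mem]
      simpa [t, Finset.sum_range_succ, ← sub_sub] using hdJ n
    · refine ext_evalₐ fun n ↦ ?_
      rw [evalₐ_liftRingHom, hF, evalₐ_mk]
      simp [ht]

/-- Adic completions of Noetherian rings are Noetherian. -/
theorem AdicCompletion.isNoetherianRing {R : Type*} [CommRing R] [IsNoetherianRing R]
    (I : Ideal R) : IsNoetherianRing (AdicCompletion I R) := by
  obtain ⟨s, rfl⟩ := I.fg_of_isNoetherianRing
  let f : MvPolynomial s R →+* R := (MvPolynomial.aeval (R := R) ((↑) : s → R)).toRingHom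
  have hf : Function.Surjective f := fun r ↦ ⟨MvPolynomial.C r, by simp [f]⟩
  have hI : (MvPolynomial.idealOfVars s R).map f = Ideal.span s := by
    rw [MvPolynomial.idealOfVars, Ideal.map_span, ← Set.range_comp]
    congr 1
    ext; simp [f]
  obtain ⟨g, hg⟩ := AdicCompletion.exists_surjective_ringHom_map f hf _ _ hI
  have := isNoetherianRing_of_ringEquiv _ (MvPowerSeries.toAdicCompletionAlgEquiv s R).toRingEquiv
  exact isNoetherianRing_of_surjective _ _ g hg

/-- A finite algebra over an adically complete Noetherian ring is adically complete. -/
theorem IsAdicComplete.map_algebraMap_of_finite.{u} {S D : Type u} [CommRing S] [IsNoetherianRing S]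
    [CommRing D] [Algebra S D] [Module.Finite S D] (I : Ideal S) [IsAdicComplete I S] :
    IsAdicComplete (I.map (algebraMap S D)) D := by
  rw [IsAdicComplete.map_algebraMap_iff, ← AdicCompletion.of_bijective_iff]
  let e := AdicCompletion.ofLinearEquiv I S
  have h1 := AdicCompletion.ofTensorProduct_bijective_of_finite_of_isNoetherian I D
  let f : D →ₗ[S] AdicCompletion I S ⊗[S] D :=
    (e.rTensor D).toLinearMap ∘ₗ (TensorProduct.lid S D).symm.toLinearMap
  have hf : Function.Bijective f :=
    (e.rTensor D).bijective.comp (TensorProduct.lid S D).symm.bijective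
  convert h1.comp hf using 1
  funext x
  change _ = AdicCompletion.ofTensorProduct I D (e 1 ⊗ₜ x)
  rw [AdicCompletion.ofTensorProduct_tmul, show e 1 = 1 from rfl, one_smul]

/-- In an Artinian ring, every element generates the same ideal up to radical as some
idempotent. -/
theorem exists_isIdempotentElem_dvd_pow {R : Type*} [CommRing R] [IsArtinianRing R] (x : R) :
    ∃ e : R, IsIdempotentElem e ∧ x ∣ e ∧ ∃ k : ℕ, e ∣ x ^ k := by
  obtain ⟨n, y, hy⟩ := IsArtinian.exists_pow_succ_smul_dvd x (1 : R)
  replace hy : x ^ n * (x * y) = x ^ n := by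
    simpa [pow_succ, mul_assoc] using hy
  have hpow (m : ℕ) : x ^ n * (x * y) ^ m = x ^ n := by
    induction m with
    | zero => simp
    | succ m ih => rw [pow_succ, ← mul_assoc, ih, hy]
  refine ⟨(x * y) ^ (n + 1), ?_, ?_, n, x ^ n, ?_⟩
  · calc (x * y) ^ (n + 1) * (x * y) ^ (n + 1)
        = x ^ n * (x * y) ^ (n + 1) * (x * y ^ (n + 1)) := by ring
      _ = (x * y) ^ (n + 1) := by rw [hpow]; ring
  · exact (dvd_mul_right x y).trans (dvd_pow_self _ n.succ_ne_zero)
  · rw [mul_comm, hpow]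

/-- If `D` is finite over the adically complete ring `S`, then two primes of `D` over the maximal
ideal `n` that contain a common prime have the same elements: idempotents of `D / nD` lift to `D`,
and are trivial in a domain. -/
theorem mem_of_prime_le_of_adicComplete.{u} {S D : Type u} [CommRing S] [IsNoetherianRing S]
    [CommRing D] [Algebra S D] [Module.Finite S D] (n : Ideal S) [n.IsMaximal]
    [IsAdicComplete n S] (P M M' : Ideal D) [hP : P.IsPrime] [hMp : M.IsPrime] [hMp' : M'.IsPrime]
    (hM : P ≤ M) (hM' : P ≤ M') (hn : n ≤ M.comap (algebraMap S D))
    (hn' : n ≤ M'.comap (algebraMap S D)) {x : D} (hx : x ∈ M) : x ∈ M' := by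
  let J := n.map (algebraMap S D)
  have hJ : J ≤ M := Ideal.map_le_iff_le_comap.2 hn
  have hJ' : J ≤ M' := Ideal.map_le_iff_le_comap.2 hn'
  have : IsAdicComplete J D := IsAdicComplete.map_algebraMap_of_finite n
  let := Ideal.Quotient.field n
  have : IsArtinianRing (D ⧸ J) := IsArtinianRing.of_finite (S ⧸ n) (D ⧸ J)
  obtain ⟨e', he, hxe, k, hek⟩ := exists_isIdempotentElem_dvd_pow (Ideal.Quotient.mk J x)
  obtain ⟨e, rfl⟩ := Ideal.Quotient.mk_surjective e'
  have hmem (K : Ideal D) (hK : J ≤ K) (a b : D)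
      (hab : Ideal.Quotient.mk J a ∣ Ideal.Quotient.mk J b) (ha : a ∈ K) : b ∈ K := by
    obtain ⟨c', hc⟩ := hab
    obtain ⟨c, rfl⟩ := Ideal.Quotient.mk_surjective c'
    rw [← map_mul, Ideal.Quotient.eq] at hc
    exact (Submodule.sub_mem_iff_left K (K.mul_mem_right c ha)).1 (hK hc)
  have heM := hmem M hJ _ _ hxe hx
  obtain ⟨a, ha, hae⟩ := HenselianRing.is_henselian (I := J) (X ^ 2 - X : D[X]) (by monicity!) e
    (by
      rw [← Ideal.Quotient.eq_zero_iff_mem]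
      simp [pow_two, he.eq])
    (by
      refine IsUnit.of_mul_eq_one (Ideal.Quotient.mk J (2 * e - 1)) ?_
      rw [← map_mul, ← map_one (Ideal.Quotient.mk J), Ideal.Quotient.eq]
      have := J.mul_mem_left 4 (Ideal.Quotient.eq.1 ((map_mul _ e e).trans he.eq))
      convert this using 1
      simp
      ring)
  have haP : a * (a - 1) ∈ P := by
    have : a ^ 2 - a = 0 := by simpa using ha
    rw [show a * (a - 1) = 0 by linear_combination this]
    exact P.zero_mem
  rcases hP.mem_or_mem haP with h | h
  · have : e ∈ M' := (Submodule.sub_mem_iff_right M' (hM' h)).1 (hJ' hae)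
    exact hMp'.mem_of_pow_mem k (hmem M' hJ' _ _ (by simpa using hek) this)
  · have : a ∈ M := (Submodule.sub_mem_iff_left M heM).1 (hJ hae)
    exact absurd ((Submodule.sub_mem_iff_right M this).1 (hM h))
      fun h ↦ hMp.ne_top ((Ideal.eq_top_iff_one _).2 h)

/-- The same comparison of primes as `mem_of_prime_le_of_adicComplete`, for integral algebras. -/
theorem le_of_prime_le_of_adicComplete {S T : Type*} [CommRing S] [IsNoetherianRing S]
    [CommRing T] [Algebra S T] [Algebra.IsIntegral S T] (n : Ideal S) [n.IsMaximal]
    [IsAdicComplete n S] (P M M' : Ideal T) [P.IsPrime] [M.IsPrime] [M'.IsPrime]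
    (hM : P ≤ M) (hM' : P ≤ M') (hn : n ≤ M.comap (algebraMap S T))
    (hn' : n ≤ M'.comap (algebraMap S T)) : M ≤ M' := by
  intro x hx
  obtain ⟨f, hf, hfx⟩ := Algebra.IsIntegral.isIntegral (R := S) x
  have := hf.finite_adjoinRoot
  let φ : AdjoinRoot f →ₐ[S] T := AdjoinRoot.liftAlgHom f (Algebra.ofId S T) x hfx
  have hφ : (φ : AdjoinRoot f →+* T).comp (algebraMap S (AdjoinRoot f)) = algebraMap S T :=
    φ.comp_algebraMap
  have hφx : φ (AdjoinRoot.root f) = x := AdjoinRoot.liftAlgHom_root ..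
  have := mem_of_prime_le_of_adicComplete n (P.comap (φ : AdjoinRoot f →+* T))
    (M.comap (φ : AdjoinRoot f →+* T)) (M'.comap (φ : AdjoinRoot f →+* T))
    (Ideal.comap_mono hM) (Ideal.comap_mono hM')
    (by rwa [Ideal.comap_comap, hφ]) (by rwa [Ideal.comap_comap, hφ])
    (x := AdjoinRoot.root f) (by simpa [hφx] using hx)
  simpa [hφx] using this

/-- A prime `q` of `C` over `p` is the contraction of a prime of the base change of `C` to the
completion of `A` at `p`, lying over the maximal ideal of that completion. -/
theorem exists_prime_tensorProduct_adicCompletion {A C : Type*} [CommRing A] [CommRing C]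
    [Algebra A C] [IsNoetherianRing A]
    (p : Ideal A) [hp : p.IsPrime] (q : Ideal C) [q.IsPrime] (hq : q.comap (algebraMap A C) = p) :
    ∃ M : Ideal (AdicCompletion (IsLocalRing.maximalIdeal (Localization.AtPrime p))
        (Localization.AtPrime p) ⊗[A] C), M.IsPrime ∧
      M.comap (algebraMap _ _) = IsLocalRing.maximalIdeal (AdicCompletion
        (IsLocalRing.maximalIdeal (Localization.AtPrime p)) (Localization.AtPrime p)) ∧
      M.comap (Algebra.TensorProduct.includeRight : C →ₐ[A] _).toRingHom = q := by
  let m := IsLocalRing.maximalIdeal (Localization.AtPrime p)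
  let ev : AdicCompletion m (Localization.AtPrime p) →ₐ[A] p.ResidueField :=
    (AdicCompletion.evalOneₐ m).restrictScalars A
  let ι : p.ResidueField →ₐ[A] q.ResidueField :=
    Ideal.ResidueField.mapₐ p q (Algebra.ofId A C) hq.symm
  let Φ := Algebra.TensorProduct.lift (ι.comp ev) (IsScalarTower.toAlgHom A C q.ResidueField)
    fun _ _ ↦ Commute.all _ _
  refine ⟨RingHom.ker Φ, RingHom.ker_isPrime _, ?_, ?_⟩
  · refine (IsLocalRing.eq_maximalIdeal ?_)
    have : RingHom.ker ev.toRingHom = (RingHom.ker Φ).comap (algebraMap _ _) := by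
      ext x
      simp [Φ, RingHom.mem_ker]
    rw [← this]
    exact RingHom.ker_isMaximal_of_surjective _ (AdicCompletion.evalOneₐ_surjective m)
  · ext x
    simp [Φ, RingHom.mem_ker]

/-- An integral algebra that embeds into a finitely generated algebra over a Noetherian ring has
finitely many primes over each prime of the base. -/
theorem finite_primes_over_of_injective {A B C : Type*} [CommRing A] [CommRing B] [CommRing C]
    [IsNoetherianRing A] [Algebra A B] [Algebra A C] [Algebra.FiniteType A B]
    [Algebra.IsIntegral A C] (f : C →ₐ[A] B) (hf : Function.Injective f)
    (p : Ideal A) [p.IsPrime] :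
    {q : Ideal C | q.IsPrime ∧ q.comap (algebraMap A C) = p}.Finite := by
  let R := Localization.AtPrime p
  let S := AdicCompletion (IsLocalRing.maximalIdeal R) R
  have : IsNoetherianRing S := AdicCompletion.isNoetherianRing _
  have : Module.Flat A S := .trans A R S
  have : IsNoetherianRing (S ⊗[A] B) := Algebra.FiniteType.isNoetherianRing S _
  let g : S ⊗[A] C →ₐ[S] S ⊗[A] B := Algebra.TensorProduct.map (AlgHom.id S S) f
  have hg : Function.Injective g :=
    Module.Flat.lTensor_preserves_injective_linearMap (M := S) f.toLinearMap hf
  have key (q : {q : Ideal C | q.IsPrime ∧ q.comap (algebraMap A C) = p}) :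
      ∃ N : minimalPrimes (S ⊗[A] B), ∃ M : Ideal (S ⊗[A] C), M.IsPrime ∧
        M.comap (algebraMap S _) = IsLocalRing.maximalIdeal S ∧
        M.comap (Algebra.TensorProduct.includeRight : C →ₐ[A] S ⊗[A] C).toRingHom = q ∧
        N.1.comap g.toRingHom ≤ M := by
    obtain ⟨q, hq, hqp⟩ := q
    obtain ⟨M, hM, hMS, hMq⟩ := exists_prime_tensorProduct_adicCompletion p q hqp
    obtain ⟨P, hP, hPM⟩ := Ideal.exists_minimalPrimes_le (bot_le : ⊥ ≤ M)
    obtain ⟨N, hN, rfl⟩ := Ideal.exists_minimalPrimes_comap_eq (I := ⊥) g.toRingHom P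
      (by rwa [← RingHom.ker_eq_comap_bot, (RingHom.injective_iff_ker_eq_bot g.toRingHom).1 hg])
    exact ⟨⟨N, hN⟩, M, hM, hMS, hMq, hPM⟩
  choose N M hM hMS hMq hNM using key
  have : Finite (minimalPrimes (S ⊗[A] B)) := minimalPrimes.finite_of_isNoetherianRing _
  refine Finite.of_injective N fun q q' h ↦ Subtype.ext ?_
  have hprime : (N q).1.IsPrime := (N q).2.1.1
  have := Ideal.comap_isPrime g.toRingHom (N q).1
  have h1 := hNM q
  have h2 := h ▸ hNM q'
  have := hM q
  have := hM q'
  rw [← hMq q, ← hMq q', le_antisymm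
    (le_of_prime_le_of_adicComplete (IsLocalRing.maximalIdeal S) _ _ _ h1 h2 (hMS q).ge (hMS q').ge)
    (le_of_prime_le_of_adicComplete (IsLocalRing.maximalIdeal S) _ _ _ h2 h1
      (hMS q').ge (hMS q).ge)]

end

/-- Let `𝒜` be Noetherian, `ℬ` a finitely generated `𝒜`-algebra containing
`𝒜`, and `𝒜̄` the integral closure of `𝒜` in `ℬ`.  Then for each prime `𝔭` of `𝒜` there
are only finitely many primes of `𝒜̄` contracting to `𝔭`. -/
theorem finite_primes_over_integralClosure (A B : Type*)
    [CommRing A] [CommRing B] [IsNoetherianRing A] [Algebra A B]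
    (hinj : Function.Injective (algebraMap A B))
    (hfg : Algebra.FiniteType A B)
    (p : Ideal A) (hp : p.IsPrime) :
    {q : Ideal (integralClosure A B) | q.IsPrime ∧
      q.comap (algebraMap A (integralClosure A B)) = p}.Finite := by
  exact finite_primes_over_of_injective (integralClosure A B).val Subtype.val_injective p
end

section
/- Let 𝒜 be a Noetherian ring, ℬ a ring containing 𝒜, and t ∈ ℬ. For i ≥ 0 set 𝒜_i := 𝒜 + 𝒜t + ⋯ + 𝒜tⁱ, a finitely generated 𝒜-submodule of 𝒜[t]. Then there exists N such that for all n ≥ N the map 𝒜_n/𝒜_{n−1} → 𝒜_{n+1}/𝒜_n induced by multiplication by t is an isomorphism of 𝒜-modules; consequently the union ⋃_{i≥0} Ass_𝒜(𝒜_{i+1}/𝒜_i) is finite. -/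
section PowSpan

variable {A B : Type*} [CommRing A] [CommRing B] [Algebra A B]

/-- The submodule generated by `1, t, …, tⁱ`. -/
def powSpan (A : Type*) {B : Type*} [CommRing A] [CommRing B] [Algebra A B] (t : B) (i : ℕ) :
    Submodule A B :=
  Submodule.span A {x : B | ∃ j ≤ i, x = t ^ j}

/-- The ideal of all `a` such that `a • t ^ (i + 1)` lies in the span of `1, t, …, tⁱ`. -/
def leadingIdeal (A : Type*) {B : Type*} [CommRing A] [CommRing B] [Algebra A B] (t : B) (i : ℕ) :
    Ideal A :=
  (powSpan A t i).comap (LinearMap.toSpanSingleton A B (t ^ (i + 1)))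

theorem mem_leadingIdeal {t : B} {i : ℕ} {a : A} :
    a ∈ leadingIdeal A t i ↔ a • t ^ (i + 1) ∈ powSpan A t i := Iff.rfl

theorem pow_mem_powSpan (t : B) {i j : ℕ} (h : j ≤ i) : t ^ j ∈ powSpan A t i :=
  Submodule.subset_span ⟨j, h, rfl⟩

theorem mul_mem_powSpan {t x : B} {i : ℕ} (hx : x ∈ powSpan A t i) :
    t * x ∈ powSpan A t (i + 1) := by
  have h : powSpan A t i ≤ (powSpan A t (i + 1)).comap (LinearMap.mulLeft A t) := by
    refine Submodule.span_le.2 ?_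
    rintro _ ⟨j, hj, rfl⟩
    change t * t ^ j ∈ powSpan A t (i + 1)
    rw [← pow_succ']
    exact pow_mem_powSpan t (by omega)
  exact h hx

theorem exists_sub_smul_pow_mem_powSpan {t x : B} {i : ℕ} (hx : x ∈ powSpan A t (i + 1)) :
    ∃ a : A, x - a • t ^ (i + 1) ∈ powSpan A t i := by
  induction hx using Submodule.span_induction with
  | mem x hx =>
    obtain ⟨j, hj, rfl⟩ := hx
    rcases hj.lt_or_eq with h | rfl
    · exact ⟨0, by simpa using pow_mem_powSpan t (Nat.lt_succ_iff.1 h)⟩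
    · exact ⟨1, by simp⟩
  | zero => exact ⟨0, by simp⟩
  | add x y _ _ hx hy =>
    obtain ⟨a, ha⟩ := hx
    obtain ⟨b, hb⟩ := hy
    exact ⟨a + b, by simpa only [add_smul, add_sub_add_comm] using add_mem ha hb⟩
  | smul c x _ hx =>
    obtain ⟨a, ha⟩ := hx
    exact ⟨c * a, by simpa only [mul_smul, smul_sub] using Submodule.smul_mem _ c ha⟩

theorem leadingIdeal_mono (t : B) : Monotone (leadingIdeal A t) := by
  refine monotone_nat_of_le_succ fun i a ha ↦ ?_
  rw [mem_leadingIdeal, pow_succ', ← mul_smul_comm]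
  exact mul_mem_powSpan (mem_leadingIdeal.1 ha)

theorem mem_powSpan_of_mul_mem {t x : B} {i : ℕ}
    (h : leadingIdeal A t i = leadingIdeal A t (i + 1))
    (hx : x ∈ powSpan A t (i + 1)) (htx : t * x ∈ powSpan A t (i + 1)) :
    x ∈ powSpan A t i := by
  obtain ⟨a, ha⟩ := exists_sub_smul_pow_mem_powSpan hx
  have key : a ∈ leadingIdeal A t (i + 1) := by
    have := sub_mem htx (mul_mem_powSpan ha)
    rwa [← mul_sub, sub_sub_cancel, mul_smul_comm, ← pow_succ'] at this
  rw [← h, mem_leadingIdeal] at key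
  simpa using add_mem ha key

theorem exists_sub_mul_mem_powSpan {t y : B} {i : ℕ} (hy : y ∈ powSpan A t (i + 1)) :
    ∃ x ∈ powSpan A t i, y - t * x ∈ powSpan A t i := by
  obtain ⟨a, ha⟩ := exists_sub_smul_pow_mem_powSpan hy
  refine ⟨a • t ^ i, Submodule.smul_mem _ _ (pow_mem_powSpan t le_rfl), ?_⟩
  rwa [mul_smul_comm, ← pow_succ']

theorem associatedPrimes_powSpan_quotient (t : B) (i : ℕ) :
    associatedPrimes A
      (↥(powSpan A t (i + 1)) ⧸ (powSpan A t i).comap (powSpan A t (i + 1)).subtype) =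
    associatedPrimes A (A ⧸ leadingIdeal A t i) := by
  let P := (powSpan A t i).comap (powSpan A t (i + 1)).subtype
  let f : A →ₗ[A] ↥(powSpan A t (i + 1)) ⧸ P := P.mkQ ∘ₗ
    LinearMap.toSpanSingleton A _ ⟨t ^ (i + 1), pow_mem_powSpan t le_rfl⟩
  have hker : LinearMap.ker f = leadingIdeal A t i := by
    rw [LinearMap.ker_comp, Submodule.ker_mkQ]
    rfl
  have hsurj : Function.Surjective f := by
    intro q
    obtain ⟨⟨x, hx⟩, rfl⟩ := P.mkQ_surjective q
    obtain ⟨a, ha⟩ := exists_sub_smul_pow_mem_powSpan hx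
    refine ⟨a, ((Submodule.Quotient.eq P).2 ?_).symm⟩
    exact ha
  rw [← hker]
  exact (LinearEquiv.AssociatedPrimes.eq (f.quotKerEquivOfSurjective hsurj)).symm

end PowSpan


/-- Let `𝒜` be a Noetherian ring, `ℬ` a ring containing `𝒜`, `t ∈ ℬ`, and
`𝒜ᵢ := 𝒜 + 𝒜t + ⋯ + 𝒜tⁱ` the `𝒜`-submodule of `ℬ` generated by `1, t, …, tⁱ`.  Then there
is an `N` such that for all `n ≥ N` the map `𝒜ₙ/𝒜ₙ₋₁ → 𝒜ₙ₊₁/𝒜ₙ` induced by multiplication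
by `t` is an isomorphism of `𝒜`-modules (expressed elementwise: injectivity and surjectivity
of the induced map); consequently `⋃ᵢ Ass_𝒜(𝒜ᵢ₊₁/𝒜ᵢ)` is finite. -/
theorem stable_filtration_assPrimes_finite (A B : Type*)
    [CommRing A] [CommRing B] [IsNoetherianRing A] [Algebra A B]
    (hinj : Function.Injective (algebraMap A B)) (t : B)
    (𝒜 : ℕ → Submodule A B)
    (h𝒜 : ∀ i, 𝒜 i = Submodule.span A {x : B | ∃ j ≤ i, x = t ^ j}) :
    (∃ N : ℕ, ∀ n ≥ N,
      -- injectivity of 𝒜ₙ₊₁/𝒜ₙ → 𝒜ₙ₊₂/𝒜ₙ₊₁ induced by multiplication by t: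
      (∀ x ∈ 𝒜 (n + 1), t * x ∈ 𝒜 (n + 1) → x ∈ 𝒜 n) ∧
      -- surjectivity:
      (∀ y ∈ 𝒜 (n + 2), ∃ x ∈ 𝒜 (n + 1), y - t * x ∈ 𝒜 (n + 1))) ∧
    (⋃ i : ℕ, associatedPrimes A
      (↥(𝒜 (i + 1)) ⧸ (𝒜 i).comap (𝒜 (i + 1)).subtype)).Finite := by
  obtain rfl : 𝒜 = powSpan A t := funext h𝒜
  obtain ⟨N, hN⟩ := monotone_stabilizes_iff_noetherian.2 ‹IsNoetherianRing A›
    ⟨leadingIdeal A t, leadingIdeal_mono t⟩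
  replace hN : ∀ n ≥ N, leadingIdeal A t N = leadingIdeal A t n := hN
  refine ⟨⟨N, fun n hn ↦ ⟨fun x hx htx ↦ mem_powSpan_of_mul_mem ?_ hx htx,
    fun y hy ↦ exists_sub_mul_mem_powSpan hy⟩⟩, ?_⟩
  · rw [← hN n hn, ← hN (n + 1) (by omega)]
  · simp only [associatedPrimes_powSpan_quotient]
    refine ((Set.finite_Iic N).biUnion fun i _ ↦
      associatedPrimes.finite A (A ⧸ leadingIdeal A t i)).subset ?_
    refine Set.iUnion_subset fun i ↦ ?_
    rcases le_total i N with h | h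
    · exact Set.subset_biUnion_of_mem (u := fun i ↦ associatedPrimes A (A ⧸ leadingIdeal A t i)) h
    · rw [← hN i h]
      exact Set.subset_biUnion_of_mem (u := fun i ↦ associatedPrimes A (A ⧸ leadingIdeal A t i))
        (Set.mem_Iic.2 le_rfl)
end

section
/- Let 𝒜 be a Noetherian ring, ℬ a Noetherian finitely generated 𝒜-algebra containing 𝒜, and 𝒜̄ the integral closure of 𝒜 in ℬ. Then every minimal prime of 𝒜̄ is the contraction to 𝒜̄ of a minimal prime of ℬ; in particular, 𝒜̄ has only finitely many minimal primes. -/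
/-- Let `𝒜` be Noetherian, `ℬ` a Noetherian finitely generated `𝒜`-algebra
containing `𝒜`, and `𝒜̄` the integral closure of `𝒜` in `ℬ`.  Then every minimal prime of
`𝒜̄` is the contraction of a minimal prime of `ℬ`; in particular `𝒜̄` has finitely many
minimal primes. -/
theorem minimalPrimes_integralClosure_comap (A B : Type*)
    [CommRing A] [CommRing B] [IsNoetherianRing A] [IsNoetherianRing B] [Algebra A B]
    (hinj : Function.Injective (algebraMap A B))
    (hfg : Algebra.FiniteType A B) :
    (∀ q ∈ minimalPrimes (integralClosure A B),
      ∃ Q ∈ minimalPrimes B, Q.comap (algebraMap (integralClosure A B) B) = q) ∧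
    (minimalPrimes (integralClosure A B)).Finite := by
  have key : ∀ q ∈ minimalPrimes (integralClosure A B),
      ∃ Q ∈ minimalPrimes B, Q.comap (algebraMap (integralClosure A B) B) = q := by
    intro q hq
    refine Ideal.exists_minimalPrimes_comap_eq (I := ⊥) (algebraMap (integralClosure A B) B) q ?_
    rwa [← RingHom.ker_eq_comap_bot, (RingHom.injective_iff_ker_eq_bot _).mp
      (FaithfulSMul.algebraMap_injective (integralClosure A B) B)]
  refine ⟨key, ((minimalPrimes.finite_of_isNoetherianRing B).image
    (Ideal.comap (algebraMap (integralClosure A B) B))).subset ?_⟩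
  intro q hq
  exact key q hq
end
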